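/- Let K be an infinite field of characteristic p, and let f_1, ..., f_r ∈ K[T,X] be pairwise non-associate absolutely irreducible polynomials such that for each i, writing d_i for the total degree of f_i, one has d_i ≥ 2, p does not divide d_i(d_i − 1), and the projective plane curve defined by the homogenization of f_i is smooth. Then there exist α, β ∈ K such that the polynomial g(U, T) := ∏_{i=1}^r U^{d_i} · f_i(T, (α + T + β·U)/U), regarded as a polynomial in T over the rational function field K̄(U) (where K̄ is an algebraic closure of K), has splitting field over K̄(U) with Galois group isomorphic to the direct product S_{d_1} × ⋯ × S_{d_r} of symmetric groups. -/

import Mathlib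

open MvPolynomial

/-- `f ∈ K[T,X]` is absolutely irreducible: it is irreducible over an algebraic
closure of `K`. -/
def AbsolutelyIrreducible {K : Type*} [Field K] (f : MvPolynomial (Fin 2) K) : Prop :=
  Irreducible (MvPolynomial.map (algebraMap K (AlgebraicClosure K)) f)

/-- `F ∈ K[X₀,X₁,X₂]` is the degree-`d` homogenization of `f ∈ K[T,X]`
(so `F` is homogeneous of degree `d` with `F(1,T,X) = f(T,X)`) and the projective
plane curve `F = 0` is smooth: `F` and its three partial derivatives have no common
zero `≠ (0,0,0)` with coordinates in an algebraic closure of `K`. -/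
def IsSmoothHomogenization {K : Type*} [Field K] (F : MvPolynomial (Fin 3) K)
    (f : MvPolynomial (Fin 2) K) (d : ℕ) : Prop :=
  F.IsHomogeneous d ∧
  MvPolynomial.aeval ![1, MvPolynomial.X 0, MvPolynomial.X 1] F = f ∧
  ∀ x : Fin 3 → AlgebraicClosure K, x ≠ 0 →
    MvPolynomial.eval x (F.map (algebraMap K (AlgebraicClosure K))) = 0 →
    ∃ j : Fin 3, MvPolynomial.eval x ((MvPolynomial.pderiv j F).map
      (algebraMap K (AlgebraicClosure K))) ≠ 0

/-- `U^d · f(T, (α + T + β·U)/U)`, regarded as a polynomial in `T` over the rational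
function field `K̄(U) = Frac(K̄[U])`, where `K̄` is an algebraic closure of `K`
(the substitution `X := (α + T + β·U)/U` applied to `f ∈ K[T,X]` with the denominator
cleared; variable `0` of `f` is `T` and variable `1` is `X`). -/
noncomputable def lineSubU {K : Type*} [Field K] (f : MvPolynomial (Fin 2) K) (d : ℕ)
    (α β : K) : Polynomial (FractionRing (Polynomial (AlgebraicClosure K))) :=
  letI Kb := AlgebraicClosure K
  letI Fq := FractionRing (Polynomial Kb)
  letI u : Fq := algebraMap (Polynomial Kb) Fq Polynomial.X
  Polynomial.C (u ^ d) *
    MvPolynomial.aeval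
      ![Polynomial.X,
        Polynomial.C ((algebraMap Kb Fq (algebraMap K Kb α)) * u⁻¹ +
            algebraMap Kb Fq (algebraMap K Kb β)) +
          Polynomial.C u⁻¹ * Polynomial.X]
      (f.map (algebraMap K Kb))

section

theorem gpl {M W : Type*} [Field M] [Field W] [Algebra M W] (f q : MvPolynomial (Fin 2) M)
    (hf : Irreducible f) (v : Fin 2 → W) (hv : aeval v f = 0)
    (hnalg : ¬ ∀ i, IsAlgebraic M (v i)) (hq : aeval v q = 0) : f ∣ q := by
  by_contra hnd
  apply hnalg
  set I : Ideal (MvPolynomial (Fin 2) M) := RingHom.ker (aeval v : MvPolynomial (Fin 2) M →ₐ[M] W)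
    with hI
  have hIp : I.IsPrime := RingHom.ker_isPrime _
  have hfp : (Ideal.span {f}).IsPrime :=
    (Ideal.span_singleton_prime hf.ne_zero).2 hf.prime
  have hlt : Ideal.span {f} < I := by
    refine lt_of_le_of_ne ?_ ?_
    · rw [Ideal.span_singleton_le_iff_mem]; exact hv
    · intro h
      apply hnd
      rw [← Ideal.mem_span_singleton, h]
      exact hq
  have h0 : (⊥ : Ideal (MvPolynomial (Fin 2) M)) < Ideal.span {f} := by
    rw [bot_lt_iff_ne_bot]
    simpa [Ideal.span_singleton_eq_bot] using hf.ne_zero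
  have e1 := Ideal.height_add_one_le_of_lt_of_isPrime h0
  have e2 := Ideal.height_add_one_le_of_lt_of_isPrime hlt
  have hmax : I.IsMaximal := by
    obtain ⟨m, hm, hIm⟩ := Ideal.exists_le_maximal I hIp.ne_top
    rcases eq_or_lt_of_le hIm with h | h
    · rw [h]; exact hm
    · exfalso
      have hmp := hm.isPrime
      have e3 := Ideal.height_add_one_le_of_lt_of_isPrime h
      have e4 := Ideal.height_le_ringKrullDim_of_ne_top hm.ne_top
      rw [MvPolynomial.ringKrullDim_of_isNoetherianRing, ringKrullDim_eq_zero_of_field] at e4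
      have e5 : m.height ≤ 2 := by
        have : (m.height : WithBot ℕ∞) ≤ ((2 : ℕ∞) : WithBot ℕ∞) := by simpa using e4
        exact_mod_cast this
      have e6 : (3 : ℕ∞) ≤ m.height := by
        calc (3 : ℕ∞) = 0 + 1 + 1 + 1 := by norm_num
          _ ≤ (⊥ : Ideal (MvPolynomial (Fin 2) M)).height + 1 + 1 + 1 := by gcongr; exact bot_le
          _ ≤ (Ideal.span {f}).height + 1 + 1 := by gcongr
          _ ≤ I.height + 1 := by gcongr
          _ ≤ _ := e3
      have := e6.trans e5
      exact absurd this (by decide)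
  let _ : Field (MvPolynomial (Fin 2) M ⧸ I) := Ideal.Quotient.field I
  have hIntg := MvPolynomial.comp_C_integral_of_surjective_of_isJacobsonRing
      (Ideal.Quotient.mk I) Ideal.Quotient.mk_surjective
  intro i
  have h1 := hIntg (Ideal.Quotient.mk I (X i))
  let φ : MvPolynomial (Fin 2) M ⧸ I →ₐ[M] W := Ideal.Quotient.liftₐ I (aeval v) (fun a ha => ha)
  have h2 : IsIntegral M (Ideal.Quotient.mk I (X i : MvPolynomial (Fin 2) M)) := h1
  have h3 := h2.map φ
  have : φ (Ideal.Quotient.mk I (X i : MvPolynomial (Fin 2) M)) = v i := by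
    change aeval v (X i) = v i
    simp
  rw [this] at h3
  exact h3.isAlgebraic

/-- apply a functional to the coefficients -/
noncomputable def fnl {k M σ : Type*} [Field k] [Field M] [Algebra k M] (φ : M →ₗ[k] k)
    (g : MvPolynomial σ M) : MvPolynomial σ k := ∑ m ∈ g.support, monomial m (φ (coeff m g))

theorem coeff_fnl {k M σ : Type*} [Field k] [Field M] [Algebra k M] (φ : M →ₗ[k] k)
    (g : MvPolynomial σ M) (m : σ →₀ ℕ) : coeff m (fnl φ g) = φ (coeff m g) := by
  classical
  simp only [fnl, coeff_sum, coeff_monomial]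
  rw [Finset.sum_ite_eq']
  split_ifs with h
  · rfl
  · rw [notMem_support_iff] at h
    simp [h]

theorem eval_fnl {k M σ : Type*} [Field k] [Field M] [Algebra k M] (φ : M →ₗ[k] k)
    (g : MvPolynomial σ M) (P : σ → k) :
    eval P (fnl φ g) = φ (eval (fun i => algebraMap k M (P i)) g) := by
  classical
  rw [eval_eq (f := g), map_sum, fnl, map_sum]
  refine Finset.sum_congr rfl fun m _ => ?_
  have h : ∏ i ∈ m.support, (algebraMap k M (P i)) ^ m i
      = algebraMap k M (∏ i ∈ m.support, P i ^ m i) := by simp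
  rw [eval_monomial, Finsupp.prod, h, mul_comm (coeff m g),
    ← Algebra.smul_def, map_smul, smul_eq_mul, mul_comm]

theorem dvd_of_fnl {k M σ : Type*} [Field k] [Field M] [Algebra k M]
    (f : MvPolynomial σ k) (g : MvPolynomial σ M) (h : ∀ φ : M →ₗ[k] k, f ∣ fnl φ g) :
    map (algebraMap k M) f ∣ g := by
  classical
  let b := Module.Basis.ofVectorSpace k M
  let I := g.support.biUnion (fun m => (b.repr (coeff m g)).support)
  have : g = ∑ i ∈ I, C (b i) * map (algebraMap k M) (fnl (b.coord i) g) := by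
    ext m
    rw [coeff_sum]
    simp only [coeff_C_mul, coeff_map, coeff_fnl, Module.Basis.coord_apply]
    by_cases hm : m ∈ g.support
    · conv_lhs => rw [← b.linearCombination_repr (coeff m g), Finsupp.linearCombination_apply,
        Finsupp.sum]
      apply Finset.sum_subset_zero_on_sdiff
      · exact Finset.subset_biUnion_of_mem (fun m => (b.repr (coeff m g)).support) hm
      · intro x hx
        have := (Finset.mem_sdiff.1 hx).2
        rw [Finsupp.notMem_support_iff] at this
        simp [this]
      · intro x _
        rw [Algebra.smul_def, mul_comm]
    · rw [notMem_support_iff] at hm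
      simp [hm]
  rw [this]
  refine Finset.dvd_sum fun i _ => Dvd.dvd.mul_left ?_ _
  exact map_dvd (map (algebraMap k M)) (h _)

theorem prime_map {k M : Type*} [Field k] [IsAlgClosed k] [Field M] [Algebra k M] {n : ℕ}
    (f : MvPolynomial (Fin n) k) (hf : Irreducible f) : Prime (map (algebraMap k M) f) := by
  refine ⟨?_, ?_, ?_⟩
  · rw [Ne, map_eq_zero_iff _ (map_injective _ (algebraMap k M).injective)]
    exact hf.ne_zero
  · intro hu
    rw [MvPolynomial.isUnit_iff_eq_C_of_isReduced] at hu
    obtain ⟨r, hr, h⟩ := hu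
    apply hf.not_isUnit
    rw [MvPolynomial.isUnit_iff_eq_C_of_isReduced]
    have h0 : f = C (coeff 0 f) := by
      apply map_injective _ (algebraMap k M).injective
      rw [map_C, ← coeff_map, h]; simp
    refine ⟨coeff 0 f, ?_, h0⟩
    rw [isUnit_iff_ne_zero]
    intro h1
    rw [h1] at h0
    exact hf.ne_zero (by simpa using h0)
  · intro g h hgh
    have hp : Prime f := hf.prime
    have hfp : (Ideal.span {f}).IsPrime :=
      (Ideal.span_singleton_prime hf.ne_zero).2 hp
    have key : ∀ φ ψ : M →ₗ[k] k, f ∣ fnl φ g ∨ f ∣ fnl ψ h := by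
      intro φ ψ
      apply hp.2.2
      rw [← Ideal.mem_span_singleton, ← IsPrime.vanishingIdeal_zeroLocus (K := k) (Ideal.span {f}),
        mem_vanishingIdeal_iff]
      intro P hP
      have hfP : eval P f = 0 := by
        have := hP f (Ideal.mem_span_singleton_self f)
        simpa using this
      have : eval (fun i => algebraMap k M (P i)) (g * h) = 0 := by
        obtain ⟨c, hc⟩ := hgh
        rw [hc, map_mul]
        have : eval (fun i => algebraMap k M (P i)) (map (algebraMap k M) f) = 0 := by
          rw [eval_map, ← aeval_def]
          have := aeval_algebraMap_apply M P f
          rw [show (aeval P) f = eval P f from rfl, hfP, map_zero] at this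
          exact this
        rw [this, zero_mul]
      rw [map_mul, mul_eq_zero] at this
      rw [show (aeval P) (fnl φ g * fnl ψ h) = eval P (fnl φ g * fnl ψ h) from rfl, map_mul, eval_fnl, eval_fnl]
      rcases this with h | h <;> rw [h] <;> simp
    by_cases h1 : ∀ φ : M →ₗ[k] k, f ∣ fnl φ g
    · exact Or.inl (dvd_of_fnl f g h1)
    · push Not at h1
      obtain ⟨φ, hφ⟩ := h1
      exact Or.inr (dvd_of_fnl f h fun ψ => (key φ ψ).resolve_left hφ)

end

section

/-- dehomogenization -/
noncomputable def dehom {k : Type*} [Field k] (F : MvPolynomial (Fin 3) k) :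
    MvPolynomial (Fin 2) k := aeval ![1, X 0, X 1] F

structure SmC {k : Type*} [Field k] (F : MvPolynomial (Fin 3) k) (d : ℕ) : Prop where
  hom : F.IsHomogeneous d
  deg : (dehom F).totalDegree = d
  irr : Irreducible (dehom F)
  two_le : 2 ≤ d
  two_ne : (2 : k) ≠ 0
  d_ne : (d : k) ≠ 0
  d1_ne : ((d - 1 : ℕ) : k) ≠ 0
  smooth : ∀ x : Fin 3 → k, x ≠ 0 → eval x F = 0 → ∃ j, eval x (pderiv j F) ≠ 0

theorem hom_aeval_smul {k R σ : Type*} [Field k] [CommRing R] [Algebra k R]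
    {F : MvPolynomial σ k} {d : ℕ} (h : F.IsHomogeneous d) (c : R) (v : σ → R) :
    aeval (fun i => c * v i) F = c ^ d * aeval v F := by
  rw [aeval_def, eval₂_eq, aeval_def, eval₂_eq, Finset.mul_sum]
  refine Finset.sum_congr rfl fun m hm => ?_
  have h1 : m.degree = d := by
    have := h (mem_support_iff.1 hm)
    rw [Finsupp.degree_eq_weight_one]
    exact this
  simp only [mul_pow, Finset.prod_mul_distrib]
  rw [Finset.prod_pow_eq_pow_sum]
  have h2 : ∑ i ∈ m.support, m i = d := by rw [← h1]; rfl
  rw [h2]; ring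

theorem deriv_aeval {k A E : Type*} [Field k] [CommRing A] [Algebra k A] [AddCommGroup E]
    [Module A E] [Module k E] [IsScalarTower k A E] {n : ℕ}
    (D : Derivation k A E) (v : Fin n → A) (F : MvPolynomial (Fin n) k) :
    D (aeval v F) = ∑ l, aeval v (pderiv l F) • D (v l) := by
  induction F using MvPolynomial.induction_on with
  | C a => simp
  | add p q hp hq => simp [hp, hq, add_smul, Finset.sum_add_distrib]
  | mul_X p i hp =>
    simp only [map_mul, aeval_X, Derivation.leibniz, hp, smul_eq_mul, map_add, add_smul,
      Finset.sum_add_distrib, Finset.smul_sum, pderiv_X, mul_smul]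
    congr 1
    rw [Finset.sum_eq_single i]
    · simp
    · intro j _ hj
      simp [hj.symm]
    · simp

theorem pderiv_comm' {k σ : Type*} [Field k] (i j : σ) (F : MvPolynomial σ k) :
    pderiv i (pderiv j F) = pderiv j (pderiv i F) := by
  classical
  have : ⁅(pderiv i : Derivation k (MvPolynomial σ k) (MvPolynomial σ k)),
      (pderiv j : Derivation k (MvPolynomial σ k) (MvPolynomial σ k))⁆ = 0 := by
    apply MvPolynomial.derivation_ext
    intro l
    rw [Derivation.commutator_apply]
    simp only [pderiv_X, Pi.single_apply]
    split_ifs <;> simp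
  have h2 := congrArg (fun D => D F) this
  simp only [Derivation.commutator_apply] at h2
  exact sub_eq_zero.1 (by simpa using h2)

theorem euler_aeval {k R : Type*} [Field k] [CommRing R] [Algebra k R] {n : ℕ}
    {F : MvPolynomial (Fin n) k} {d : ℕ} (h : F.IsHomogeneous d) (v : Fin n → R) :
    ∑ i, v i * aeval v (pderiv i F) = (d : R) * aeval v F := by
  have := congrArg (aeval v) h.sum_X_mul_pderiv
  simpa using this

theorem totalDegree_dehom_le {k : Type*} [Field k] (G : MvPolynomial (Fin 3) k) :
    (dehom G).totalDegree ≤ G.totalDegree := by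
  rw [dehom, aeval_def, eval₂_eq']
  refine totalDegree_finsetSum_le fun m hm => ?_
  refine (totalDegree_mul _ _).trans ?_
  rw [show (algebraMap k (MvPolynomial (Fin 2) k)) = C from rfl, totalDegree_C, zero_add]
  refine (totalDegree_finsetProd _ _).trans ?_
  refine le_trans (Finset.sum_le_sum (g := fun i => m i) fun i _ => ?_) ?_
  · refine (totalDegree_pow _ _).trans ?_
    have : totalDegree ((![1, X 0, X 1] : Fin 3 → MvPolynomial (Fin 2) k) i) ≤ 1 := by
      fin_cases i <;> simp
    nlinarith
  · refine le_trans (le_of_eq ?_) (le_totalDegree hm)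
    rw [Finsupp.sum_fintype]
    simp

theorem aeval_dehom {k R : Type*} [Field k] [CommRing R] [Algebra k R]
    (F : MvPolynomial (Fin 3) k) (t x : R) :
    aeval ![t, x] (dehom F) = aeval ![1, t, x] F := by
  rw [dehom, ← AlgHom.comp_apply]
  congr 1
  ext i
  fin_cases i <;> simp

theorem hom_scale {k R : Type*} [Field k] [CommRing R] [Algebra k R]
    {F : MvPolynomial (Fin 3) k} {d : ℕ} (h : F.IsHomogeneous d) (c y0 y1 y2 : R) :
    aeval ![c * y0, c * y1, c * y2] F = c ^ d * aeval ![y0, y1, y2] F := by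
  rw [← hom_aeval_smul h]
  congr 2
  ext i
  fin_cases i <;> simp

theorem dehom_ne_zero {k : Type*} [Field k] {G : MvPolynomial (Fin 3) k} {e : ℕ}
    (h : G.IsHomogeneous e) (h0 : G ≠ 0) : dehom G ≠ 0 := by
  intro hG
  apply h0
  let L := FractionRing (MvPolynomial (Fin 3) k)
  let ι := algebraMap (MvPolynomial (Fin 3) k) L
  have hX0 : ι (X 0) ≠ 0 := by
    rw [Ne, map_eq_zero_iff ι (IsFractionRing.injective _ L)]
    exact X_ne_zero 0
  have h1 := hom_scale (R := L) h (ι (X 0)) 1 (ι (X 1) / ι (X 0)) (ι (X 2) / ι (X 0))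
  rw [← aeval_dehom, hG, map_zero, mul_zero, mul_one, mul_div_cancel₀ _ hX0,
    mul_div_cancel₀ _ hX0] at h1
  apply IsFractionRing.injective (MvPolynomial (Fin 3) k) L
  rw [map_zero, ← h1]
  have : (fun i => ι (X i)) = ![ι (X 0), ι (X 1), ι (X 2)] := by
    ext i; fin_cases i <;> rfl
  rw [← this]
  have h3 := aeval_algebraMap_apply L (X : Fin 3 → MvPolynomial (Fin 3) k) G
  rw [aeval_X_left_apply] at h3
  exact h3.symm

theorem gen_ne_zero {k W : Type*} [Field k] [Field W] [Algebra k W]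
    {F : MvPolynomial (Fin 3) k} {d : ℕ} (hF : SmC F d) {t x : W}
    (hz : aeval ![1, t, x] F = 0) (hg : ¬ ∀ i, IsAlgebraic k (![t, x] i))
    {G : MvPolynomial (Fin 3) k} {e : ℕ} (h : G.IsHomogeneous e) (h0 : G ≠ 0) (he : e < d) :
    aeval ![1, t, x] G ≠ 0 := by
  intro hG
  rw [← aeval_dehom] at hz hG
  obtain ⟨c, hc⟩ := gpl _ _ hF.irr _ hz hg hG
  have hne := dehom_ne_zero h h0
  rw [hc] at hne
  have h1 := totalDegree_dehom_le G
  have h2 := h.totalDegree_le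
  rw [hc, totalDegree_mul_of_isDomain (left_ne_zero_of_mul hne) (right_ne_zero_of_mul hne),
    hF.deg] at h1
  omega

theorem infty_ne_zero {k : Type*} [Field k]
    {F : MvPolynomial (Fin 3) k} {d : ℕ} (hF : SmC F d) :
    aeval ![0, Polynomial.X, 1] F ≠ (0 : Polynomial k) := by
  intro h
  -- then `F(0,X1,X2) = 0`
  have hL : aeval ![0, X 1, X 2] F = (0 : MvPolynomial (Fin 3) k) := by
    let L := FractionRing (MvPolynomial (Fin 3) k)
    let ι := algebraMap (MvPolynomial (Fin 3) k) L
    have hX0 : ι (X 2) ≠ 0 := by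
      rw [Ne, map_eq_zero_iff ι (IsFractionRing.injective _ L)]
      exact X_ne_zero 2
    have h1 := hom_scale (R := L) hF.hom (ι (X 2)) 0 (ι (X 1) / ι (X 2)) 1
    have h2 : aeval ![0, ι (X 1) / ι (X 2), 1] F = 0 := by
      have := congrArg (Polynomial.aeval (ι (X 1) / ι (X 2))) h
      rw [map_zero, ← AlgHom.comp_apply] at this
      have h5 : (aeval ![0, ι (X 1) / ι (X 2), 1] : MvPolynomial (Fin 3) k →ₐ[k] L) =
          (Polynomial.aeval (ι (X 1) / ι (X 2))).comp
            (aeval ![0, Polynomial.X, 1] : MvPolynomial (Fin 3) k →ₐ[k] Polynomial k) := by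
        ext i; fin_cases i <;> simp
      rw [h5]; exact this
    rw [h2, mul_zero, mul_zero, mul_one, mul_div_cancel₀ _ hX0] at h1
    apply IsFractionRing.injective (MvPolynomial (Fin 3) k) L
    rw [map_zero, ← h1]
    have : (fun i => ι ((![0, X 1, X 2] : Fin 3 → MvPolynomial (Fin 3) k) i))
        = ![0, ι (X 1), ι (X 2)] := by
      ext i; fin_cases i <;> simp
    rw [← this]
    have h3 := aeval_algebraMap_apply L (![0, X 1, X 2] : Fin 3 → MvPolynomial (Fin 3) k) F
    exact h3.symm
  have hdvd : (X 0 : MvPolynomial (Fin 3) k) ∣ F := by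
    have : (Ideal.Quotient.mkₐ k (Ideal.span {(X 0 : MvPolynomial (Fin 3) k)})).comp
        (aeval ![0, X 1, X 2]) = Ideal.Quotient.mkₐ k (Ideal.span {(X 0 : MvPolynomial (Fin 3) k)}) := by
      ext i
      fin_cases i
      · simp only [Fin.zero_eta, AlgHom.comp_apply, aeval_X, Matrix.cons_val_zero, map_zero]
        symm
        exact Ideal.Quotient.eq_zero_iff_mem.2 (Ideal.mem_span_singleton_self _)
      · simp
      · simp
    have h2 := congrArg (fun φ => φ F) this
    simp only [AlgHom.comp_apply, hL, map_zero] at h2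
    rw [← Ideal.mem_span_singleton]
    exact Ideal.Quotient.eq_zero_iff_mem.1 h2.symm
  obtain ⟨G, hG⟩ := hdvd
  have hF0 : F ≠ 0 := by
    intro h0
    apply hF.irr.ne_zero
    rw [h0, dehom, map_zero]
  rw [hG] at hF0
  have h1 : dehom F = dehom G := by
    rw [hG, dehom, map_mul, aeval_X]; simp [dehom]
  have h2 := totalDegree_dehom_le G
  rw [← h1, hF.deg] at h2
  have h3 := hF.hom.totalDegree_le
  rw [hG, totalDegree_mul_of_isDomain (left_ne_zero_of_mul hF0) (right_ne_zero_of_mul hF0),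
    totalDegree_X] at h3
  omega

theorem pderiv2_ne_zero {k : Type*} [Field k]
    {F : MvPolynomial (Fin 3) k} {d : ℕ} (hF : SmC F d) : pderiv 2 F ≠ 0 := by
  intro h
  have h1 : ∀ i, eval ![0, 0, 1] (pderiv i F) = 0 := by
    intro i
    have := euler_aeval (R := k) (hF.hom.pderiv (i := i)) ![0, 0, 1]
    simp only [Fin.sum_univ_three] at this
    rw [pderiv_comm' 2 i, h] at this
    simp at this
    exact this.resolve_left hF.d1_ne
  have h2 := euler_aeval (R := k) hF.hom ![0, 0, 1]
  simp only [Fin.sum_univ_three] at h2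
  obtain ⟨j, hj⟩ := hF.smooth ![0, 0, 1] (by
    intro h; have := congrFun h 2; simp at this) (by
      have e := h1 2
      rw [← coe_aeval_eq_eval] at e ⊢
      simp only [RingHom.coe_coe] at e ⊢
      rw [e] at h2
      simp at h2
      exact h2.resolve_left hF.d_ne)
  exact hj (h1 j)

theorem smooth_ext {k : Type*} [Field k] [IsAlgClosed k]
    {F : MvPolynomial (Fin 3) k} {d : ℕ} (hF : SmC F d) (j : Fin 3) :
    ∃ (N : ℕ) (q : Fin 3 → MvPolynomial (Fin 3) k), X j ^ N = ∑ i, q i * pderiv i F := by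
  have : (X j : MvPolynomial (Fin 3) k) ∈
      (Ideal.span (Set.range fun i => pderiv i F)).radical := by
    rw [← vanishingIdeal_zeroLocus_eq_radical (K := k), mem_vanishingIdeal_iff]
    intro x hx
    have hz : ∀ i, eval x (pderiv i F) = 0 := fun i => by
      have := hx (pderiv i F) (Ideal.subset_span ⟨i, rfl⟩)
      simpa using this
    by_contra hne
    have hx0 : x ≠ 0 := by
      rintro rfl; simp at hne
    have h2 := euler_aeval (R := k) hF.hom x
    obtain ⟨l, hl⟩ := hF.smooth x hx0 (by
      have h3 : ∀ i, aeval x (pderiv i F) = 0 := hz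
      simp only [h3, mul_zero, Finset.sum_const_zero] at h2
      have := (mul_eq_zero.1 h2.symm).resolve_left hF.d_ne
      exact this)
    exact hl (hz l)
  obtain ⟨N, hN⟩ := this
  rw [Ideal.mem_span_range_iff_exists_fun] at hN
  obtain ⟨q, hq⟩ := hN
  exact ⟨N, q, hq.symm⟩

end

section

theorem aeval3_map {k A B : Type*} [Field k] [CommRing A] [Algebra k A] [CommRing B] [Algebra k B]
    (φ : A →ₐ[k] B) (a b c : A) (F : MvPolynomial (Fin 3) k) :
    φ (aeval ![a, b, c] F) = aeval ![φ a, φ b, φ c] F := by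
  rw [← AlgHom.comp_apply]
  congr 1
  ext i
  fin_cases i <;> simp

theorem mem_range_of_alg {k E : Type*} [Field k] [IsAlgClosed k] [Field E] [Algebra k E] {z : E}
    (h : IsAlgebraic k z) : ∃ c : k, algebraMap k E c = z := by
  have h1 := IsAlgClosed.degree_eq_one_of_irreducible k (minpoly.irreducible h.isIntegral)
  obtain ⟨c, hc⟩ := minpoly.mem_range_of_degree_eq_one k z h1
  exact ⟨c, hc⟩

/-- the bordered second derivative along the tangent -/
noncomputable def Dl {k E : Type*} [Field k] [Field E] [Algebra k E] (F : MvPolynomial (Fin 3) k)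
    (t x : E) : E :=
  (aeval ![1, t, x] (pderiv 2 F)) ^ 2 * aeval ![1, t, x] (pderiv 1 (pderiv 1 F))
  - 2 * aeval ![1, t, x] (pderiv 1 F) * aeval ![1, t, x] (pderiv 2 F) *
      aeval ![1, t, x] (pderiv 1 (pderiv 2 F))
  + (aeval ![1, t, x] (pderiv 1 F)) ^ 2 * aeval ![1, t, x] (pderiv 2 (pderiv 2 F))

theorem exists_gauss {k E : Type*} [Field k] [Field E] [Algebra k E]
    {F : MvPolynomial (Fin 3) k} {d : ℕ} (hF : SmC F d) {t x : E}
    (hz : aeval ![1, t, x] F = 0) (h2 : aeval ![1, t, x] (pderiv 2 F) ≠ 0)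
    (hD : Dl F t x = 0) :
    ∃ l : Fin 3 → E, (∀ i j, aeval ![1, t, x] (pderiv i (pderiv j F)) =
      aeval ![1, t, x] (pderiv i F) * l j + aeval ![1, t, x] (pderiv j F) * l i) ∧
      l 0 + t * l 1 + x * l 2 = ((d - 1 : ℕ) : E) := by
  have e0 := euler_aeval hF.hom ![1, t, x]
  have e1 : ∀ j, _ := fun j => euler_aeval (hF.hom.pderiv (i := j)) ![1, t, x]
  have two : (2 : E) ≠ 0 := by
    have := (map_ne_zero (algebraMap k E)).2 hF.two_ne
    rwa [map_ofNat] at this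
  have c10 := pderiv_comm' 1 0 F
  have c20 := pderiv_comm' 2 0 F
  have c21 := pderiv_comm' 2 1 F
  have a0 := e1 0
  have a1 := e1 1
  have a2 := e1 2
  simp only [Fin.sum_univ_three, Matrix.cons_val_zero, Matrix.cons_val_one, Matrix.cons_val,
    one_mul, hz, mul_zero, c10, c20, c21] at e0 a0 a1 a2
  unfold Dl at hD
  set g0 := aeval ![1, t, x] (pderiv 0 F)
  set g1 := aeval ![1, t, x] (pderiv 1 F)
  set g2 := aeval ![1, t, x] (pderiv 2 F)
  set m00 := aeval ![1, t, x] (pderiv 0 (pderiv 0 F))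
  set m01 := aeval ![1, t, x] (pderiv 0 (pderiv 1 F))
  set m02 := aeval ![1, t, x] (pderiv 0 (pderiv 2 F))
  set m11 := aeval ![1, t, x] (pderiv 1 (pderiv 1 F))
  set m12 := aeval ![1, t, x] (pderiv 1 (pderiv 2 F))
  set m22 := aeval ![1, t, x] (pderiv 2 (pderiv 2 F))
  set D : E := ((d - 1 : ℕ) : E)
  set l2 : E := m22 / (2 * g2) with hl2
  set l0 : E := (m02 - g0 * l2) / g2 with hl0
  set l1 : E := (m12 - g1 * l2) / g2 with hl1
  have r2 : m22 = g2 * l2 + g2 * l2 := by rw [hl2]; field_simp; ring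
  have r0 : m02 = g0 * l2 + g2 * l0 := by rw [hl0]; field_simp; ring
  have r1 : m12 = g1 * l2 + g2 * l1 := by rw [hl1]; field_simp; ring
  clear_value l0 l1 l2
  have r11 : m11 = g1 * l1 + g1 * l1 := by
    have : g2 ^ 2 * (m11 - (g1 * l1 + g1 * l1)) = 0 := by
      rw [r1, r2] at hD
      linear_combination hD
    rcases mul_eq_zero.1 this with h | h
    · exact absurd h (pow_ne_zero 2 h2)
    · linear_combination h
  have rD : l0 + t * l1 + x * l2 = D := by
    have : g2 * (l0 + t * l1 + x * l2 - D) = 0 := by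
      rw [r0, r1, r2] at a2
      linear_combination a2 - l2 * e0
    rcases mul_eq_zero.1 this with h | h
    · exact absurd h h2
    · linear_combination h
  have r01 : m01 = g0 * l1 + g1 * l0 := by
    rw [r11, r1] at a1
    linear_combination a1 - l1 * e0 - g1 * rD
  have r00 : m00 = g0 * l0 + g0 * l0 := by
    rw [r01, r0] at a0
    linear_combination a0 - l0 * e0 - g0 * rD
  refine ⟨![l0, l1, l2], ?_, by simpa using rD⟩
  intro i j
  fin_cases i <;> fin_cases j <;> simp [c10, c20, c21]
  · exact r00
  · exact r01
  · exact r0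
  · exact r01.trans (by ring)
  · exact r11
  · exact r1
  · exact r0.trans (by ring)
  · exact r1.trans (by ring)
  · exact r2

theorem val_gauss {k E : Type*} [Field k] [IsAlgClosed k] [Field E] [Algebra k E]
    {F : MvPolynomial (Fin 3) k} {d : ℕ} (hF : SmC F d) {y : Fin 3 → E} (hy : y 0 ≠ 0)
    (l : Fin 3 → E) (hl : ∀ i j, aeval y (pderiv i (pderiv j F)) =
      aeval y (pderiv i F) * l j + aeval y (pderiv j F) * l i)
    (O : ValuationSubring E) (hO : ∀ c : k, algebraMap k E c ∈ O) (i j : Fin 3) :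
    y j * l i ∈ O := by
  obtain ⟨j0, hj0⟩ := Finite.exists_max (fun i => O.valuation (y i))
  have hc : y j0 ≠ 0 := by
    intro h
    have := hj0 0
    rw [h, map_zero, le_zero_iff, map_eq_zero] at this
    exact hy this
  set c := y j0 with hcdef
  let y' : Fin 3 → E := fun i => y i / c
  let l' : Fin 3 → E := fun i => c * l i
  have hy' : ∀ i, y' i ∈ O := by
    intro i
    rw [← O.valuation_le_one_iff, map_div₀]
    exact div_le_one_of_le₀ (hj0 i) zero_le
  have hyy : y = fun i => c * y' i := by
    ext i; simp only [y']; rw [mul_div_cancel₀ _ hc]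
  have hpol : ∀ G : MvPolynomial (Fin 3) k, aeval y' G ∈ O := by
    intro G
    rw [aeval_def, eval₂_eq]
    exact sum_mem fun m _ => mul_mem (hO _) (prod_mem fun i _ => pow_mem (hy' i) _)
  have hl' : ∀ i j, aeval y' (pderiv i (pderiv j F)) =
      aeval y' (pderiv i F) * l' j + aeval y' (pderiv j F) * l' i := by
    intro i j
    have := hl i j
    rw [hyy, hom_aeval_smul (hF.hom.pderiv), hom_aeval_smul (hF.hom.pderiv),
      hom_aeval_smul (hF.hom.pderiv.pderiv)] at this
    obtain ⟨e, he⟩ : ∃ e, d = e + 2 := ⟨d - 2, by have := hF.two_le; omega⟩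
    have h1 : d - 1 = e + 1 := by omega
    have h2 : d - 1 - 1 = e := by omega
    rw [h1, Nat.add_sub_cancel] at this
    apply mul_left_cancel₀ (pow_ne_zero e hc)
    rw [this]
    simp only [l']
    ring
  obtain ⟨i0, hi0⟩ : ∃ i0, O.valuation (aeval y' (pderiv i0 F)) = 1 := by
    by_contra hne
    push Not at hne
    have hlt : ∀ i, O.valuation (aeval y' (pderiv i F)) < 1 := fun i =>
      lt_of_le_of_ne ((O.valuation_le_one_iff _).2 (hpol _)) (hne i)
    obtain ⟨N, q, hq⟩ := smooth_ext hF j0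
    have := congrArg (aeval y') hq
    rw [map_pow, aeval_X, show y' j0 = 1 from div_self hc, one_pow, map_sum] at this
    have h1 : O.valuation (∑ i, aeval y' (q i * pderiv i F)) < 1 := by
      apply Valuation.map_sum_lt _ one_ne_zero
      intro i _
      rw [map_mul, map_mul]
      exact mul_lt_one_of_nonneg_of_lt_one_right ((O.valuation_le_one_iff _).2 (hpol _)) zero_le (hlt i)
    rw [← this, map_one] at h1
    exact lt_irrefl _ h1
  have two : (2 : E) ≠ 0 := by
    have := (map_ne_zero (algebraMap k E)).2 hF.two_ne
    rwa [map_ofNat] at this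
  set g := aeval y' (pderiv i0 F) with hg
  have hg0 : g ≠ 0 := by
    intro h; rw [h, map_zero] at hi0; exact zero_ne_one hi0
  have hginv : g⁻¹ ∈ O := by
    rw [← O.valuation_le_one_iff, map_inv₀, hi0, inv_one]
  have h2inv : (2 : E)⁻¹ ∈ O := by
    have := hO (2⁻¹)
    rwa [map_inv₀, map_ofNat] at this
  have hli0 : l' i0 ∈ O := by
    have : l' i0 = aeval y' (pderiv i0 (pderiv i0 F)) * (2⁻¹ * g⁻¹) := by
      rw [hl', ← hg]; field_simp; ring
    rw [this]
    exact mul_mem (hpol _) (mul_mem h2inv hginv)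
  have hlj : ∀ j, l' j ∈ O := by
    intro j
    have : l' j = (aeval y' (pderiv i0 (pderiv j F)) - aeval y' (pderiv j F) * l' i0) * g⁻¹ := by
      rw [hl', ← hg]; field_simp; ring
    rw [this]
    exact mul_mem (sub_mem (hpol _) (mul_mem (hpol _) hli0)) hginv
  have : y j * l i = y' j * l' i := by
    simp only [y', l']; field_simp
  rw [this]
  exact mul_mem (hy' j) (hlj i)

theorem Dl_ne_zero {k E : Type*} [Field k] [IsAlgClosed k] [Field E] [Algebra k E]
    {F : MvPolynomial (Fin 3) k} {d : ℕ} (hF : SmC F d) {t x : E}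
    (hz : aeval ![1, t, x] F = 0) (hg : ¬ ∀ i, IsAlgebraic k (![t, x] i)) : Dl F t x ≠ 0 := by
  intro hD
  have h2 := gen_ne_zero hF hz hg hF.hom.pderiv (pderiv2_ne_zero hF)
    (by have := hF.two_le; omega)
  obtain ⟨l, hl, hsum⟩ := exists_gauss hF hz h2 hD
  have key : ∀ i j, IsAlgebraic k (![1, t, x] j * l i) := by
    intro i j
    have h1 : (![1, t, x] j * l i) ∈ (⨅ V : {V : ValuationSubring E //
        Set.range (algebraMap k E) ⊆ V.toSubring}, V.1.toSubring) := by
      rw [Subring.mem_iInf]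
      rintro ⟨V, hV⟩
      exact val_gauss hF (by simp) l hl V (fun c => hV ⟨c, rfl⟩) i j
    rw [iInf_valuationSubring_superset] at h1
    have h3 : IsIntegral (Subring.closure (Set.range (algebraMap k E))) (![1, t, x] j * l i) := h1
    have h4 : Subring.closure (Set.range (algebraMap k E)) = (algebraMap k E).range := by
      rw [← RingHom.coe_range, Subring.closure_eq]
    rw [h4] at h3
    have h5 : IsIntegral k (![1, t, x] j * l i) := by
      obtain ⟨p, hp, hp2⟩ := h3
      have hsurj : Function.Surjective (algebraMap k E).rangeRestrict :=
        (algebraMap k E).rangeRestrict_surjective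
      obtain ⟨q, hq, hq1, hq2⟩ := Polynomial.lifts_and_natDegree_eq_and_monic
        ((Polynomial.lifts_iff_coeff_lifts p).2 fun n => hsurj _) hp
      refine ⟨q, hq2, ?_⟩
      rw [← hq, Polynomial.eval₂_map] at hp2
      exact hp2
    exact h5.isAlgebraic
  have hl0 : ∀ i, l i = 0 := by
    intro i
    by_contra hne
    apply hg
    have h0 := key i 0
    have h1 := (key i 1).mul h0.inv
    have h2 := (key i 2).mul h0.inv
    simp only [Matrix.cons_val_zero, Matrix.cons_val_one, Matrix.cons_val, one_mul,
      mul_assoc, mul_inv_cancel₀ hne, mul_one] at h1 h2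
    intro j
    fin_cases j
    · exact h1
    · exact h2
  rw [hl0, hl0, hl0] at hsum
  apply hF.d1_ne
  apply (algebraMap k E).injective
  rw [map_natCast, map_zero, ← hsum]
  ring

end

section

/-- nonzero derivation on a finitely generated non-algebraic extension -/
theorem exists_deriv {k W : Type*} [Field k] [Field W] [Algebra k W] {n : ℕ}
    (s : Fin n → W) (h : ¬ ∀ i, IsAlgebraic k (s i)) :
    ∃ (L : IntermediateField k W) (s' : Fin n → L) (D : Derivation k L L),
      (∀ i, (s' i : W) = s i) ∧ ∃ i, D (s' i) ≠ 0 := by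
  let L := IntermediateField.adjoin k (Set.range s)
  have hmem : ∀ i, s i ∈ L := fun i => IntermediateField.subset_adjoin _ _ ⟨i, rfl⟩
  have hfg : L.FG := IntermediateField.fg_def.2 ⟨Set.range s, Set.finite_range s, rfl⟩
  have hess : Algebra.EssFiniteType k L := IntermediateField.essFiniteType_iff.2 hfg
  have hnu : ¬ Algebra.FormallyUnramified k L := by
    intro hu
    have := Algebra.FormallyUnramified.isSeparable k L
    apply h
    intro i
    have h1 : IsAlgebraic k (⟨s i, hmem i⟩ : L) := (this.isAlgebraic).isAlgebraic _
    exact h1.algebraMap (A := W)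
  rw [Algebra.formallyUnramified_iff, not_subsingleton_iff_nontrivial] at hnu
  obtain ⟨D0, hD0⟩ : ∃ D0 : Derivation k L L, D0 ≠ 0 := by
    obtain ⟨z, hz⟩ : ∃ z, KaehlerDifferential.D k L z ≠ 0 := by
      by_contra hne
      push Not at hne
      have h1 := KaehlerDifferential.span_range_derivation k L
      have h2 : Set.range (KaehlerDifferential.D k L) ⊆ {0} := by
        rintro _ ⟨z, rfl⟩; exact hne z
      have h3 : (⊤ : Submodule L (Ω[L⁄k])) ≤ ⊥ := by
        rw [← h1]
        exact Submodule.span_le.2 (fun z hz => by simpa using h2 hz)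
      exact top_ne_bot (le_bot_iff.1 h3)
    have h4 := (Module.forall_dual_apply_eq_zero_iff L (KaehlerDifferential.D k L z)).not.2 hz
    push Not at h4
    obtain ⟨φ, hφ⟩ := h4
    refine ⟨LinearMap.compDer φ (KaehlerDifferential.D k L), fun h => hφ ?_⟩
    simpa using congrArg (fun D => D z) h
  refine ⟨L, fun i => ⟨s i, hmem i⟩, D0, fun i => rfl, ?_⟩
  by_contra hall
  push Not at hall
  apply hD0
  ext ⟨z, hz⟩
  simp only [Derivation.coe_zero, Pi.zero_apply]
  congr 1
  induction hz using IntermediateField.adjoin_induction with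
  | mem y hy =>
    obtain ⟨i, rfl⟩ := hy
    exact hall i
  | algebraMap c => exact D0.map_algebraMap c
  | add a b ha hb h1 h2 =>
    have := D0.map_add ⟨a, ha⟩ ⟨b, hb⟩
    rw [h1, h2, add_zero] at this
    exact this
  | mul a b ha hb h1 h2 =>
    have := D0.leibniz ⟨a, ha⟩ ⟨b, hb⟩
    rw [h1, h2, smul_zero, smul_zero, add_zero] at this
    exact this
  | inv a ha h1 =>
    have := D0.leibniz_inv ⟨a, ha⟩
    rw [h1, smul_zero] at this
    exact this

theorem deriv_curve {k L : Type*} [Field k] [Field L] [Algebra k L]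
    {F : MvPolynomial (Fin 3) k} {t x : L} (D : Derivation k L L)
    (hz : aeval ![1, t, x] F = 0) (h2 : aeval ![1, t, x] (pderiv 2 F) ≠ 0) (u : L)
    (hu : aeval ![1, t, x] (pderiv 1 F) + u * aeval ![1, t, x] (pderiv 2 F) = 0) :
    D x = u * D t ∧ (aeval ![1, t, x] (pderiv 2 F)) ^ 3 * D u = - Dl F t x * D t ∧
      D (x - u * t) = - (t * D u) := by
  have e0 := deriv_aeval D ![1, t, x] F
  have e1 := deriv_aeval D ![1, t, x] (pderiv 1 F)
  have e2 := deriv_aeval D ![1, t, x] (pderiv 2 F)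
  have e3 := congrArg D hu
  simp only [Fin.sum_univ_three, Matrix.cons_val_zero, Matrix.cons_val_one, Matrix.cons_val,
    hz, map_zero, Derivation.map_one_eq_zero, smul_eq_mul, map_add,
    Derivation.leibniz, pderiv_comm' 2 1 F] at e0 e1 e2 e3
  have hx : D x = u * D t := by
    apply mul_left_cancel₀ h2
    linear_combination - e0 - D t * hu
  refine ⟨hx, ?_, ?_⟩
  · rw [e1, e2] at e3
    rw [hx] at e3
    unfold Dl
    have hu' : aeval ![1, t, x] (pderiv 1 F) = - u * aeval ![1, t, x] (pderiv 2 F) := by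
      linear_combination hu
    rw [hu']
    linear_combination (aeval ![1, t, x] (pderiv 2 F)) ^ 2 * e3
  · simp only [map_sub, Derivation.leibniz, smul_eq_mul, hx]; ring

theorem slope_trans {k W : Type*} [Field k] [IsAlgClosed k] [Field W] [Algebra k W]
    {F : MvPolynomial (Fin 3) k} {d : ℕ} (hF : SmC F d) {t x : W}
    (hz : aeval ![1, t, x] F = 0) (hg : ¬ ∀ i, IsAlgebraic k (![t, x] i)) (u : W)
    (hu : aeval ![1, t, x] (pderiv 1 F) + u * aeval ![1, t, x] (pderiv 2 F) = 0) :
    ¬ IsAlgebraic k u := by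
  intro halg
  obtain ⟨c, rfl⟩ := mem_range_of_alg halg
  obtain ⟨L, s, D, hs, i, hi⟩ := exists_deriv _ hg
  have ht : (s 0 : W) = t := hs 0
  have hx : (s 1 : W) = x := hs 1
  have h2 := gen_ne_zero hF hz hg hF.hom.pderiv (pderiv2_ne_zero hF)
    (by have := hF.two_le; omega)
  have tr : ∀ G : MvPolynomial (Fin 3) k, ((aeval ![1, s 0, s 1] G : L) : W) = aeval ![1, t, x] G := by
    intro G
    have := aeval3_map L.val 1 (s 0) (s 1) G
    simpa [ht, hx] using this
  have hgL : ¬ ∀ i, IsAlgebraic k (![s 0, s 1] i) := by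
    intro hh
    apply hg
    intro i
    fin_cases i
    · simpa [ht] using (hh 0).algebraMap (A := W)
    · simpa [hx] using (hh 1).algebraMap (A := W)
  have hzL : aeval ![1, s 0, s 1] F = 0 := by
    apply Subtype.val_injective; rw [tr]; simpa using hz
  obtain ⟨h3, h4, -⟩ := deriv_curve D (F := F) (t := s 0) (x := s 1) hzL (by
      intro h; apply h2; rw [← tr, h]; simp) (algebraMap k L c) (by
      apply Subtype.val_injective
      simp only [L.coe_add, L.coe_mul, tr]
      exact hu)
  rw [D.map_algebraMap, mul_zero] at h4
  have hDt : D (s 0) = 0 := by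
    rcases mul_eq_zero.1 h4.symm with h | h
    · exact absurd (neg_eq_zero.1 h) (Dl_ne_zero hF hzL hgL)
    · exact h
  rw [hDt, mul_zero] at h3
  fin_cases i
  · exact hi hDt
  · exact hi h3

theorem gen_of_trans {k W : Type*} [Field k] [IsAlgClosed k] [Field W] [Algebra k W]
    {F : MvPolynomial (Fin 3) k} {d : ℕ} (hF : SmC F d) {t x : W}
    (hz : aeval ![1, t, x] F = 0) (u : W) (hut : ¬ IsAlgebraic k u)
    (hu : aeval ![1, t, x] (pderiv 1 F) + u * aeval ![1, t, x] (pderiv 2 F) = 0) :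
    ¬ ∀ i, IsAlgebraic k (![t, x] i) := by
  intro hall
  obtain ⟨t, rfl⟩ := mem_range_of_alg (hall 0)
  obtain ⟨x, hx⟩ := mem_range_of_alg (hall 1)
  simp only [Matrix.cons_val_one, Matrix.cons_val_zero] at hx hz hu
  rw [← hx] at hz hu
  have tr : ∀ G : MvPolynomial (Fin 3) k, aeval ![1, algebraMap k W t, algebraMap k W x] G =
      algebraMap k W (eval ![1, t, x] G) := by
    intro G
    have := aeval3_map (Algebra.ofId k W) 1 t x G
    rw [map_one] at this
    exact this.symm
  rw [tr] at hz
  rw [tr, tr] at hu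
  have hz' : eval ![1, t, x] F = 0 := by simpa using hz
  have e2 : eval ![1, t, x] (pderiv 2 F) = 0 := by
    by_contra hne
    apply hut
    have : u = algebraMap k W (-(eval ![1, t, x] (pderiv 1 F)) / eval ![1, t, x] (pderiv 2 F)) := by
      have h0 : algebraMap k W (eval ![1, t, x] (pderiv 2 F)) ≠ 0 := by simpa using hne
      rw [map_div₀, map_neg, eq_div_iff h0]
      linear_combination hu
    rw [this]
    exact isAlgebraic_algebraMap _
  have e1 : eval ![1, t, x] (pderiv 1 F) = 0 := by simpa [e2] using hu
  have e0 : eval ![1, t, x] (pderiv 0 F) = 0 := by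
    have h := euler_aeval (R := k) hF.hom ![1, t, x]
    simp only [Fin.sum_univ_three] at h
    have a1 : aeval ![1, t, x] (pderiv 1 F) = 0 := e1
    have a2 : aeval ![1, t, x] (pderiv 2 F) = 0 := e2
    have a3 : aeval ![1, t, x] F = 0 := hz'
    rw [a1, a2, a3] at h
    have : aeval ![1, t, x] (pderiv 0 F) = 0 := by simpa using h
    exact this
  obtain ⟨j, hj⟩ := hF.smooth ![1, t, x] (by
    intro h; have := congrFun h 0; simp at this) hz'
  fin_cases j
  · exact hj e0
  · exact hj e1
  · exact hj e2

theorem tangent_unique {k W : Type*} [Field k] [IsAlgClosed k] [Field W] [Algebra k W]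
    {F G : MvPolynomial (Fin 3) k} {d e : ℕ} (hF : SmC F d) (hG : SmC G e) {t x t' x' : W}
    (hz : aeval ![1, t, x] F = 0) (hg : ¬ ∀ i, IsAlgebraic k (![t, x] i)) (u : W)
    (hu : aeval ![1, t, x] (pderiv 1 F) + u * aeval ![1, t, x] (pderiv 2 F) = 0)
    (hz' : aeval ![1, t', x'] G = 0)
    (hu' : aeval ![1, t', x'] (pderiv 1 G) + u * aeval ![1, t', x'] (pderiv 2 G) = 0)
    (hl : x' - u * t' = x - u * t) : t' = t ∧ x' = x := by
  have hut := slope_trans hF hz hg u hu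
  have hg' := gen_of_trans hG hz' u hut hu'
  have h2 := gen_ne_zero hF hz hg hF.hom.pderiv (pderiv2_ne_zero hF)
    (by have := hF.two_le; omega)
  have h2' := gen_ne_zero hG hz' hg' hG.hom.pderiv (pderiv2_ne_zero hG)
    (by have := hG.two_le; omega)
  obtain ⟨L, s, D, hs, i, hi⟩ := exists_deriv (k := k) ![t, x, t', x', u] (by
    intro h; exact hut (h 4))
  have ht : (s 0 : W) = t := hs 0
  have hx : (s 1 : W) = x := hs 1
  have ht' : (s 2 : W) = t' := hs 2
  have hx' : (s 3 : W) = x' := hs 3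
  have huu : (s 4 : W) = u := hs 4
  have tr : ∀ G : MvPolynomial (Fin 3) k, ((aeval ![1, s 0, s 1] G : L) : W) = aeval ![1, t, x] G := by
    intro G
    have := aeval3_map L.val 1 (s 0) (s 1) G
    simpa [ht, hx] using this
  have tr' : ∀ G : MvPolynomial (Fin 3) k, ((aeval ![1, s 2, s 3] G : L) : W) =
      aeval ![1, t', x'] G := by
    intro G
    have := aeval3_map L.val 1 (s 2) (s 3) G
    simpa [ht', hx'] using this
  have gl : ∀ {a b : L} {a' b' : W}, (a : W) = a' → (b : W) = b' →
      (¬ ∀ i, IsAlgebraic k (![a', b'] i)) → ¬ ∀ i, IsAlgebraic k (![a, b] i) := by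
    intro a b a' b' ha hb hg hh
    apply hg
    intro i
    fin_cases i
    · simpa [ha] using (hh 0).algebraMap (A := W)
    · simpa [hb] using (hh 1).algebraMap (A := W)
  have hgL := gl ht hx hg
  have hgL' := gl ht' hx' hg'
  have hzL : aeval ![1, s 0, s 1] F = 0 := by
    apply Subtype.val_injective; rw [tr]; simpa using hz
  have hzL' : aeval ![1, s 2, s 3] G = 0 := by
    apply Subtype.val_injective; rw [tr']; simpa using hz'
  obtain ⟨a1, a2, a3⟩ := deriv_curve D (F := F) (t := s 0) (x := s 1) hzL (by
      intro h; apply h2; rw [← tr, h]; simp) (s 4) (by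
      apply Subtype.val_injective
      simp only [L.coe_add, L.coe_mul, tr, huu]
      exact hu)
  obtain ⟨b1, b2, b3⟩ := deriv_curve D (F := G) (t := s 2) (x := s 3) hzL' (by
      intro h; apply h2'; rw [← tr', h]; simp) (s 4) (by
      apply Subtype.val_injective
      simp only [L.coe_add, L.coe_mul, tr', huu]
      exact hu')
  have hDu : D (s 4) ≠ 0 := by
    intro h0
    rw [h0, mul_zero] at a2 b2
    have c1 : D (s 0) = 0 := by
      rcases mul_eq_zero.1 a2.symm with h | h
      · exact absurd (neg_eq_zero.1 h) (Dl_ne_zero hF hzL hgL)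
      · exact h
    have c2 : D (s 2) = 0 := by
      rcases mul_eq_zero.1 b2.symm with h | h
      · exact absurd (neg_eq_zero.1 h) (Dl_ne_zero hG hzL' hgL')
      · exact h
    rw [c1, mul_zero] at a1
    rw [c2, mul_zero] at b1
    fin_cases i
    · exact hi c1
    · exact hi a1
    · exact hi c2
    · exact hi b1
    · exact hi h0
  have hlL : s 3 - s 4 * s 2 = s 1 - s 4 * s 0 := by
    apply Subtype.val_injective
    simp only [L.coe_sub, L.coe_mul, ht, hx, ht', hx', huu]
    exact hl
  rw [hlL, a3] at b3
  have htt : s 0 = s 2 := mul_right_cancel₀ hDu (by linear_combination - b3)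
  have : t' = t := by rw [← ht, ← ht', htt]
  refine ⟨this, ?_⟩
  rw [this] at hl
  linear_combination hl

end

section

/-- the polynomial `F(U, U T, a + T + b U)` in `T` -/
noncomputable def Gp {k R : Type*} [Field k] [CommRing R] [Algebra k R]
    (F : MvPolynomial (Fin 3) k) (a b U : R) : Polynomial R :=
  aeval ![Polynomial.C U, Polynomial.C U * Polynomial.X,
    Polynomial.C a + Polynomial.X + Polynomial.C (b * U)] F

section
variable {k R S : Type*} [Field k] [CommRing R] [Algebra k R] [CommRing S] [Algebra k S]

theorem Gp_map (F : MvPolynomial (Fin 3) k) (a b U : R) (φ : R →ₐ[k] S) :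
    (Gp F a b U).map (φ : R →+* S) = Gp F (φ a) (φ b) (φ U) := by
  have := aeval3_map (Polynomial.mapAlgHom φ) (Polynomial.C U) (Polynomial.C U * Polynomial.X)
    (Polynomial.C a + Polynomial.X + Polynomial.C (b * U)) F
  simpa [Gp] using this

theorem Gp_eval (F : MvPolynomial (Fin 3) k) (a b U t : R) :
    (Gp F a b U).eval t = aeval ![U, U * t, a + t + b * U] F := by
  have := aeval3_map ((Polynomial.aeval t : Polynomial R →ₐ[R] R).restrictScalars k)
    (Polynomial.C U) (Polynomial.C U * Polynomial.X)
    (Polynomial.C a + Polynomial.X + Polynomial.C (b * U)) F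
  simpa [Gp, Polynomial.coe_aeval_eq_eval] using this

theorem Gp_natDegree_le {F : MvPolynomial (Fin 3) k} {d : ℕ} (h : F.IsHomogeneous d) (a b U : R) :
    (Gp F a b U).natDegree ≤ d := by
  rw [Gp, aeval_def, eval₂_eq']
  refine Polynomial.natDegree_sum_le_of_forall_le _ _ fun m hm => ?_
  have h1 : m.degree = d := by
    have := h (mem_support_iff.1 hm)
    rw [Finsupp.degree_eq_weight_one]
    exact this
  rw [IsScalarTower.algebraMap_apply k R (Polynomial R), Polynomial.algebraMap_eq]
  refine (Polynomial.natDegree_C_mul_le _ _).trans ?_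
  refine (Polynomial.natDegree_prod_le _ _).trans ?_
  rw [← h1, Finsupp.degree_eq_sum]
  refine Finset.sum_le_sum fun i _ => ?_
  refine (Polynomial.natDegree_pow_le).trans ?_
  have : ((![Polynomial.C U, Polynomial.C U * Polynomial.X,
    Polynomial.C a + Polynomial.X + Polynomial.C (b * U)] : Fin 3 → Polynomial R) i).natDegree ≤ 1 := by
    fin_cases i
    · simp
    · exact (Polynomial.natDegree_C_mul_le _ _).trans Polynomial.natDegree_X_le
    · simp only [Fin.reduceFinMk, Matrix.cons_val]
      compute_degree
  nlinarith

theorem Gp_coeff {F : MvPolynomial (Fin 3) k} {d : ℕ} (h : F.IsHomogeneous d) (a b U : R) :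
    (Gp F a b U).coeff d = aeval ![0, U, 1] F := by
  rw [Gp, aeval_def, eval₂_eq', aeval_def, eval₂_eq', Polynomial.finsetSum_coeff]
  refine Finset.sum_congr rfl fun m hm => ?_
  have h1 : m.degree = d := by
    have := h (mem_support_iff.1 hm)
    rw [Finsupp.degree_eq_weight_one]
    exact this
  rw [IsScalarTower.algebraMap_apply k R (Polynomial R), Polynomial.algebraMap_eq,
    Polynomial.coeff_C_mul]
  congr 1
  rw [← h1, Finsupp.degree_eq_sum]
  simp only [Fin.sum_univ_three, Fin.prod_univ_three, Matrix.cons_val_zero, Matrix.cons_val_one,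
    Matrix.cons_val]
  have e0 : ∀ n, (Polynomial.C U ^ n : Polynomial R).coeff n = 0 ^ n := by
    intro n
    rw [← Polynomial.C_pow, Polynomial.coeff_C]
    rcases n with _ | n <;> simp
  have d0 : ∀ n, (Polynomial.C U ^ n : Polynomial R).natDegree ≤ n := by
    intro n; rw [← Polynomial.C_pow, Polynomial.natDegree_C]; exact Nat.zero_le _
  have d1 : ∀ n, ((Polynomial.C U * Polynomial.X) ^ n : Polynomial R).natDegree ≤ n := by
    intro n
    refine (Polynomial.natDegree_pow_le_of_le (m := 1) n ?_).trans (by simp)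
    exact (Polynomial.natDegree_C_mul_le _ _).trans Polynomial.natDegree_X_le
  have dd : (Polynomial.C a + Polynomial.X + Polynomial.C (b * U) : Polynomial R).natDegree ≤ 1 := by
    compute_degree
  have d2 : ∀ n, ((Polynomial.C a + Polynomial.X + Polynomial.C (b * U)) ^ n : Polynomial R).natDegree
      ≤ n := by
    intro n
    exact (Polynomial.natDegree_pow_le_of_le (m := 1) n dd).trans (by simp)
  rw [Polynomial.coeff_mul_add_eq_of_natDegree_le ((Polynomial.natDegree_mul_le_of_le (d0 _) (d1 _))) (d2 _),
    Polynomial.coeff_mul_add_eq_of_natDegree_le (d0 _) (d1 _), e0]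
  congr 1
  · congr 1
    rw [mul_pow, ← Polynomial.C_pow, Polynomial.coeff_C_mul]; simp
  · have := Polynomial.coeff_pow_of_natDegree_le (m := m 2) dd
    rw [mul_one] at this
    rw [this]; simp [Polynomial.coeff_C]

theorem Gp_deriv (F : MvPolynomial (Fin 3) k) (a b U : R) :
    Polynomial.derivative (Gp F a b U) = Polynomial.C U * Gp (pderiv 1 F) a b U +
      Gp (pderiv 2 F) a b U := by
  have := deriv_aeval ((Polynomial.derivative' : Derivation R _ _).restrictScalars k)
    ![Polynomial.C U, Polynomial.C U * Polynomial.X,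
    Polynomial.C a + Polynomial.X + Polynomial.C (b * U)] F
  simp only [Fin.sum_univ_three] at this
  simp only [Derivation.restrictScalars_apply, Polynomial.derivative'_apply, Matrix.cons_val_zero,
    Matrix.cons_val_one, Matrix.cons_val, Polynomial.derivative_C, Polynomial.derivative_mul,
    Polynomial.derivative_add, Polynomial.derivative_X, zero_mul, zero_add, add_zero,
    smul_eq_mul, mul_one] at this
  unfold Gp
  rw [this]; ring

theorem Gp_add (F G : MvPolynomial (Fin 3) k) (a b U : R) :
    Gp (F + G) a b U = Gp F a b U + Gp G a b U := by
  simp [Gp]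

end

theorem line_scale {k R : Type*} [Field k] [Field R] [Algebra k R]
    {F : MvPolynomial (Fin 3) k} {d : ℕ} (h : F.IsHomogeneous d) (a b U t : R) (hU : U ≠ 0) :
    aeval ![U, U * t, a + t + b * U] F = U ^ d * aeval ![1, t, b + U⁻¹ * (t + a)] F := by
  rw [← hom_scale h]
  congr 3
  · simp
  · congr 2
    field_simp
    ring

end

section

/-- relative algebraic closure of the field generated by a set -/
noncomputable def ac (k : Type*) {W : Type*} [Field k] [Field W] [Algebra k W] (S : Set W) :
    IntermediateField k W :=
  (algebraicClosure (IntermediateField.adjoin k S) W).restrictScalars k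

section
variable {k W : Type*} [Field k] [Field W] [Algebra k W]

theorem mem_ac {S : Set W} {x : W} :
    x ∈ ac k S ↔ IsAlgebraic (IntermediateField.adjoin k S) x := by
  rw [ac, IntermediateField.mem_restrictScalars, mem_algebraicClosure_iff]

theorem alg_mono {A B : IntermediateField k W} (h : A ≤ B) {x : W} (hx : IsAlgebraic A x) :
    IsAlgebraic B x :=
  IsAlgebraic.tower_top_of_subalgebra_le (A := A.toSubalgebra) (B := B.toSubalgebra) h hx

theorem mem_ac_of_alg {S : Set W} {x : W} (hx : IsAlgebraic (ac k S) x) : x ∈ ac k S := by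
  rw [mem_ac]
  have h2 : IsAlgebraic (algebraicClosure (IntermediateField.adjoin k S) W) x := hx
  exact h2.restrictScalars (IntermediateField.adjoin k S)

theorem subset_ac (S : Set W) : S ⊆ ac k S := by
  intro x hx
  rw [SetLike.mem_coe, mem_ac]
  exact isAlgebraic_algebraMap
    (⟨x, IntermediateField.subset_adjoin k S hx⟩ : IntermediateField.adjoin k S)

theorem ac_le {S T : Set W} (h : S ⊆ ac k T) : ac k S ≤ ac k T := by
  intro x hx
  rw [mem_ac] at hx
  exact mem_ac_of_alg (alg_mono (IntermediateField.adjoin_le_iff.2 h) hx)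

theorem ac_mono {S T : Set W} (h : S ⊆ T) : ac k S ≤ ac k T :=
  ac_le (h.trans (subset_ac T))

theorem mem_ac_empty {x : W} : x ∈ ac k (∅ : Set W) ↔ IsAlgebraic k x := by
  rw [mem_ac]
  constructor
  · intro h
    have : Algebra.IsAlgebraic k (IntermediateField.adjoin k (∅ : Set W)) := by
      rw [IntermediateField.adjoin_empty]
      exact Algebra.IsAlgebraic.of_finite _ _
    exact h.restrictScalars k
  · intro h
    exact h.tower_top _

theorem ac_alg {S : Set W} (h : ac k S = ⊤) : Algebra.IsAlgebraic (Algebra.adjoin k S) W := by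
  constructor
  intro x
  have h1 : x ∈ ac k S := by rw [h]; trivial
  rw [mem_ac] at h1
  open scoped IntermediateField.algebraAdjoinAdjoin in
  exact (IsFractionRing.isAlgebraic_iff (Algebra.adjoin k S) (IntermediateField.adjoin k S) W).2 h1

theorem mem_ac_alg {S : Set W} {x : W} : x ∈ ac k S ↔ IsAlgebraic (Algebra.adjoin k S) x := by
  rw [mem_ac]
  open scoped IntermediateField.algebraAdjoinAdjoin in
  exact (IsFractionRing.isAlgebraic_iff (Algebra.adjoin k S) (IntermediateField.adjoin k S) W).symm

theorem ac_top_of_basis {ι : Type*} {p : ι → W} (h : IsTranscendenceBasis k p) :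
    ac k (Set.range p) = ⊤ := by
  have := h.isAlgebraic
  rw [eq_top_iff]
  intro x _
  rw [mem_ac_alg]
  exact this.isAlgebraic x

theorem ac_pair_ne {p : Fin 3 → W} (h : IsTranscendenceBasis k p) (x y : W) :
    ac k {x, y} ≠ ⊤ := by
  intro ht
  have := ac_alg ht
  have h1 := Algebra.IsAlgebraic.trdeg_le_cardinalMk k ({x, y} : Set W)
  have h2 := h.lift_cardinalMk_eq_trdeg
  have h3 : Cardinal.mk ({x, y} : Set W) ≤ 2 := by
    refine (Cardinal.mk_insert_le).trans ?_
    simp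
    norm_num
  have h4 : Algebra.trdeg k W ≤ 2 := h1.trans h3
  have h5 : Cardinal.lift.{0} (Algebra.trdeg k W) = 3 := by
    rw [← h2]; simp
  rw [Cardinal.lift_uzero] at h5
  rw [h5] at h4
  norm_num at h4

theorem exists_alg_of_dep {ι : Type*} {v : ι → W} (h : ¬ AlgebraicIndependent k v) :
    ∃ i, v i ∈ ac k (v '' {i}ᶜ) := by
  by_contra hc
  push Not at hc
  apply h
  apply algebraicIndependent_of_finite_type' (algebraMap k W).injective
  intro t _ _ i hi hal
  refine hc i (ac_mono (S := v '' t) (Set.image_mono ?_) (mem_ac_alg.2 hal))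
  intro j hj hji
  exact hi (hji ▸ hj)

theorem algInd_three {x y z : W} (hx : x ∉ ac k (∅ : Set W)) (hy : y ∉ ac k {x})
    (hz : z ∉ ac k {x, y}) : AlgebraicIndependent k ![x, y, z] := by
  have h1 : AlgebraicIndependent k (fun _ : Fin 1 => x) := by
    rw [algebraicIndependent_unique_type_iff]
    rw [mem_ac_empty] at hx
    exact hx
  have h2 := (h1.option_iff_transcendental y).2 (by
    rw [mem_ac_alg] at hy
    rw [Set.range_const]
    exact hy)
  have h3 := (h2.option_iff_transcendental z).2 (by
    rw [mem_ac_alg] at hz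
    have : Set.range (fun o : Option (Fin 1) => o.elim y (fun _ => x)) = {x, y} := by
      ext w; simp [Set.mem_range, Option.exists, eq_comm]
      tauto
    rw [this]
    exact hz)
  have h4 := h3.comp (![some (some 0), some none, none] : Fin 3 → Option (Option (Fin 1))) (by
    decide)
  convert h4 using 1
  ext i
  fin_cases i <;> rfl
end

theorem conj_hom {M W W' σ : Type*} [Field M] [Field W] [Field W'] [Algebra M W] [Algebra M W']
    [IsAlgClosed W'] (v : σ → W) (v' : σ → W')
    (hk : ∀ q : MvPolynomial σ M, aeval v q = 0 ↔ aeval v' q = 0)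
    (hW : ∀ w : W, w ∈ ac M (Set.range v)) : ∃ ψ : W →ₐ[M] W', ∀ i, ψ (v i) = v' i := by
  classical
  have hmem : ∀ y : Algebra.adjoin M (Set.range v), ∃ q : MvPolynomial σ M, aeval v q = y := by
    rintro ⟨y, hy⟩
    rw [Algebra.adjoin_range_eq_range_aeval] at hy
    exact hy
  choose r hr using hmem
  have hr' : ∀ (y : Algebra.adjoin M (Set.range v)) (q : MvPolynomial σ M), aeval v q = (y : W) → aeval v' (r y) = aeval v' q := by
    intro y q hq
    rw [← sub_eq_zero, ← map_sub, ← hk, map_sub, hr, hq, sub_self]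
  let φ : Algebra.adjoin M (Set.range v) →ₐ[M] W' :=
    { toFun := fun y => aeval v' (r y)
      map_one' := by rw [hr' 1 1 (by simp)]; simp
      map_mul' := fun x y => by rw [hr' (x * y) (r x * r y) (by simp [hr])]; simp
      map_zero' := by rw [hr' 0 0 (by simp)]; simp
      map_add' := fun x y => by rw [hr' (x + y) (r x + r y) (by simp [hr])]; simp
      commutes' := fun c => by rw [hr' _ (MvPolynomial.C c) (by simp)]; simp }
  have hφ : Function.Injective φ := by
    rw [injective_iff_map_eq_zero]
    intro y hy
    have : aeval v' (r y) = 0 := hy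
    rw [← hk, hr] at this
    exact Subtype.ext this
  letI := φ.toRingHom.toAlgebra
  haveI : FaithfulSMul (Algebra.adjoin M (Set.range v)) W' :=
    (faithfulSMul_iff_algebraMap_injective _ _).2 hφ
  haveI : Algebra.IsAlgebraic (Algebra.adjoin M (Set.range v)) W :=
    ⟨fun x => mem_ac_alg.1 (hW x)⟩
  let g : W →ₐ[Algebra.adjoin M (Set.range v)] W' := IsAlgClosed.lift
  refine ⟨{ g.toRingHom with commutes' := fun c => ?_ }, fun i => ?_⟩
  · have := g.commutes (algebraMap M _ c)
    have h2 := φ.commutes c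
    exact this.trans h2
  · have := g.commutes ⟨v i, Algebra.subset_adjoin ⟨i, rfl⟩⟩
    refine this.trans ?_
    change aeval v' (r _) = _
    rw [hr' _ (MvPolynomial.X i) (by simp)]; simp

theorem conj_equiv {M W σ : Type*} [Field M] [Field W] [Algebra M W]
    [IsAlgClosed W] (v : σ → W) (v' : σ → W)
    (hk : ∀ q : MvPolynomial σ M, aeval v q = 0 ↔ aeval v' q = 0)
    (hW : ∀ w : W, w ∈ ac M (Set.range v)) (hW' : ∀ w : W, w ∈ ac M (Set.range v')) :
    ∃ ψ : W ≃ₐ[M] W, ∀ i, ψ (v i) = v' i := by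
  obtain ⟨ψ, hψ⟩ := conj_hom v v' hk hW
  have hsurj : Function.Surjective ψ := by
    intro w
    have hac : IsAlgClosed ψ.fieldRange :=
      IsAlgClosed.of_ringEquiv W _ (AlgEquiv.ofInjectiveField ψ).toRingEquiv
    have hle : IntermediateField.adjoin M (Set.range v') ≤ ψ.fieldRange := by
      rw [IntermediateField.adjoin_le_iff]
      rintro _ ⟨i, rfl⟩
      exact ⟨v i, hψ i⟩
    have h1 := alg_mono hle (mem_ac.1 (hW' w))
    obtain ⟨c, hc⟩ := mem_range_of_alg h1
    obtain ⟨y, hy⟩ := c.2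
    exact ⟨y, hy.trans hc⟩
  exact ⟨AlgEquiv.ofBijective ψ ⟨ψ.injective, hsurj⟩, hψ⟩

end

section

theorem exists_lineQ {M : Type*} [Field M] (t0 x0 : M) (q : MvPolynomial (Fin 2) M) :
    ∃ (N : ℕ) (Q : MvPolynomial (Fin 2) M), ∀ (W : Type*) [Field W] [Algebra M W] (u s : W),
      aeval ![s, algebraMap M W x0 + u * (s - algebraMap M W t0)] Q =
        (s - algebraMap M W t0) ^ N * aeval ![u, s] q := by
  induction q using MvPolynomial.induction_on with
  | C c => exact ⟨0, C c, fun W _ _ u s => by simp⟩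
  | add p q hp hq =>
    obtain ⟨N1, Q1, h1⟩ := hp
    obtain ⟨N2, Q2, h2⟩ := hq
    refine ⟨N1 + N2, (X 0 - C t0) ^ N2 * Q1 + (X 0 - C t0) ^ N1 * Q2, fun W _ _ u s => ?_⟩
    simp only [map_add, map_mul, map_pow, map_sub, aeval_X, aeval_C, Matrix.cons_val_zero, h1, h2]
    ring
  | mul_X p i hp =>
    obtain ⟨N, Q, h⟩ := hp
    fin_cases i
    · refine ⟨N + 1, Q * (X 1 - C x0), fun W _ _ u s => ?_⟩
      simp only [map_mul, map_sub, aeval_X, aeval_C, Matrix.cons_val_one, h, Fin.zero_eta,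
        Matrix.cons_val_zero]
      ring
    · refine ⟨N, Q * X 0, fun W _ _ u s => ?_⟩
      simp only [map_mul, aeval_X, Matrix.cons_val_one, h, Fin.mk_one,
        Matrix.cons_val_zero]
      ring

theorem line_ker {M W : Type*} [Field M] [Field W] [Algebra M W] {f : MvPolynomial (Fin 2) M}
    (hf : Irreducible f) (t0 x0 : M) (u s s' : W) (hu : ¬ IsAlgebraic M u)
    (hs : s ≠ algebraMap M W t0) (hs' : s' ≠ algebraMap M W t0)
    (h : aeval ![s, algebraMap M W x0 + u * (s - algebraMap M W t0)] f = 0)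
    (h' : aeval ![s', algebraMap M W x0 + u * (s' - algebraMap M W t0)] f = 0)
    (q : MvPolynomial (Fin 2) M) (hq : aeval ![u, s] q = 0) : aeval ![u, s'] q = 0 := by
  obtain ⟨N, Q, hQ⟩ := exists_lineQ t0 x0 q
  have h1 := hQ W u s
  rw [hq, mul_zero] at h1
  have h2 : f ∣ Q := by
    refine gpl f Q hf _ h ?_ h1
    intro hal
    apply hu
    have a1 : IsAlgebraic M s := hal 0
    have a2 : IsAlgebraic M (algebraMap M W x0 + u * (s - algebraMap M W t0)) := hal 1
    have h0 : s - algebraMap M W t0 ≠ 0 := sub_ne_zero.2 hs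
    have : u = ((algebraMap M W x0 + u * (s - algebraMap M W t0)) - algebraMap M W x0) *
        (s - algebraMap M W t0)⁻¹ := by
      field_simp; ring
    rw [this]
    exact (a2.sub (isAlgebraic_algebraMap _)).mul ((a1.sub (isAlgebraic_algebraMap _)).inv)
  obtain ⟨g, rfl⟩ := h2
  have h3 := hQ W u s'
  rw [map_mul, h', zero_mul, eq_comm, mul_eq_zero] at h3
  rcases h3 with h3 | h3
  · exact absurd (eq_zero_of_pow_eq_zero h3) (sub_ne_zero.2 hs')
  · exact h3

theorem ac_tower {k W : Type*} [Field k] [Field W] [Algebra k W] (M : IntermediateField k W)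
    {T V : Set W} (h : T ⊆ IntermediateField.adjoin M V) {w : W} (hw : w ∈ ac k T) : w ∈ ac M V := by
  rw [mem_ac] at hw ⊢
  have : IntermediateField.adjoin k T ≤ (IntermediateField.adjoin M V).restrictScalars k := by
    rw [IntermediateField.adjoin_le_iff]
    exact h
  exact alg_mono this hw

theorem dep2 {k W : Type*} [Field k] [Field W] [Algebra k W] {f : MvPolynomial (Fin 2) k}
    (hf : f ≠ 0) {t x : W} (h : aeval ![t, x] f = 0) : t ∈ ac k {x} ∨ x ∈ ac k {t} := by
  have : ¬ AlgebraicIndependent k ![t, x] := by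
    intro hi
    exact hf (hi.eq_zero_of_aeval_eq_zero _ h)
  obtain ⟨i, hi⟩ := exists_alg_of_dep this
  fin_cases i
  · left
    refine ac_mono ?_ hi
    rintro _ ⟨j, hj, rfl⟩
    fin_cases j
    · simp at hj
    · simp
  · right
    refine ac_mono ?_ hi
    rintro _ ⟨j, hj, rfl⟩
    fin_cases j
    · simp
    · simp at hj

/-- two-point conjugation on a line through a fixed point -/
theorem line_conj {k W : Type*} [Field k] [IsAlgClosed k] [Field W] [Algebra k W] [IsAlgClosed W]
    {f : MvPolynomial (Fin 2) k} (hf : Irreducible f) (M : IntermediateField k W) (t0 x0 : M)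
    (u s s' : W) (hu : ¬ IsAlgebraic M u) (hs : s ≠ t0) (hs' : s' ≠ t0)
    (h : aeval ![s, (x0 : W) + u * (s - t0)] f = 0)
    (h' : aeval ![s', (x0 : W) + u * (s' - t0)] f = 0)
    (hW : ∀ w : W, w ∈ ac M {u}) : ∃ σ : W ≃ₐ[M] W, σ u = u ∧ σ s = s' := by
  have hf' : Irreducible (map (algebraMap k M) f) := (prime_map f hf).irreducible
  have h1 : ∀ v : Fin 2 → W, aeval v (map (algebraMap k M) f) = aeval v f := by
    intro v
    rw [aeval_map_algebraMap]
  rw [← h1] at h h'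
  have hT : ∀ s : W, ∀ w : W, w ∈ ac M (Set.range ![u, s]) := by
    intro s w
    refine ac_mono ?_ (hW w)
    rintro _ rfl
    exact ⟨0, rfl⟩
  obtain ⟨ψ, hψ⟩ := conj_equiv (M := M) ![u, s] ![u, s'] (fun q =>
    ⟨line_ker hf' t0 x0 u s s' hu hs hs' h h' q, line_ker hf' t0 x0 u s' s hu hs' hs h' h q⟩)
    (hT s) (hT s')
  exact ⟨ψ, hψ 0, hψ 1⟩

section
variable {k W : Type*} [Field k] [IsAlgClosed k] [Field W] [Algebra k W]
  {a b U : W}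

theorem top_of_mem (hB : IsTranscendenceBasis k ![a, b, U]) {S : Set W} (ha : a ∈ ac k S)
    (hb : b ∈ ac k S) (hU : U ∈ ac k S) : ac k S = ⊤ := by
  rw [eq_top_iff, ← ac_top_of_basis hB]
  apply ac_le
  rintro _ ⟨i, rfl⟩
  fin_cases i <;> assumption

theorem U_ne_zero (hB : IsTranscendenceBasis k ![a, b, U]) : U ≠ 0 := by
  rintro rfl
  refine ac_pair_ne hB a b (top_of_mem hB ?_ ?_ ?_)
  · exact subset_ac _ (by simp)
  · exact subset_ac _ (by simp)
  · exact zero_mem _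

theorem u_notMem_ab (hB : IsTranscendenceBasis k ![a, b, U]) : U⁻¹ ∉ ac k {a, b} := by
  intro h
  refine ac_pair_ne hB a b (top_of_mem hB ?_ ?_ ?_)
  · exact subset_ac _ (by simp)
  · exact subset_ac _ (by simp)
  · have := inv_mem h
    rwa [inv_inv] at this

variable {F : MvPolynomial (Fin 3) k} {d : ℕ} {t : W}

theorem root_aux (hB : IsTranscendenceBasis k ![a, b, U]) (hF : SmC F d)
    (ht : aeval ![1, t, b + U⁻¹ * (t + a)] F = 0) :
    ∃ z, ac k {a, z, U⁻¹} = ⊤ ∧ ac k {t, b + U⁻¹ * (t + a)} ≤ ac k {z} := by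
  rw [← aeval_dehom] at ht
  set x := b + U⁻¹ * (t + a) with hx
  have hb : b = x - U⁻¹ * (t + a) := by rw [hx]; ring
  have key : ∀ z, t ∈ ac k {z} → x ∈ ac k {z} → 
      ∃ z, ac k {a, z, U⁻¹} = ⊤ ∧ ac k {t, x} ≤ ac k {z} := by
    intro z h1 h2
    have hz : ac k {z} ≤ ac k {a, z, U⁻¹} := ac_mono (by simp)
    have ha : a ∈ ac k {a, z, U⁻¹} := subset_ac _ (by simp)
    have hu : U⁻¹ ∈ ac k {a, z, U⁻¹} := subset_ac _ (by simp)
    refine ⟨z, top_of_mem hB ha ?_ ?_, ac_le ?_⟩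
    · rw [hb]
      exact sub_mem (hz h2) (mul_mem hu (add_mem (hz h1) ha))
    · have := inv_mem hu
      rwa [inv_inv] at this
    · rintro _ (rfl | rfl) <;> assumption
  rcases dep2 hF.irr.ne_zero ht with h | h
  · exact key x h (subset_ac _ (by simp))
  · exact key t (subset_ac _ (by simp)) h

theorem root_u (hB : IsTranscendenceBasis k ![a, b, U]) (hF : SmC F d)
    (ht : aeval ![1, t, b + U⁻¹ * (t + a)] F = 0) :
    U⁻¹ ∉ ac k {a, t, b + U⁻¹ * (t + a)} := by
  obtain ⟨z, h1, h2⟩ := root_aux hB hF ht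
  intro hu
  refine ac_pair_ne hB a z ?_
  rw [eq_top_iff, ← h1]
  have ha : a ∈ ac k {a, z} := subset_ac _ (by simp)
  have hz : z ∈ ac k {a, z} := subset_ac _ (by simp)
  have h3 : ac k {t, b + U⁻¹ * (t + a)} ≤ ac k {a, z} := h2.trans (ac_mono (by simp))
  apply ac_le
  rintro _ (rfl | rfl | rfl)
  · exact ha
  · exact hz
  · refine ac_le ?_ hu
    rintro _ (rfl | rfl | rfl)
    · exact ha
    · exact h3 (subset_ac _ (by simp))
    · exact h3 (subset_ac _ (by simp))

theorem root_gen (hB : IsTranscendenceBasis k ![a, b, U]) (hF : SmC F d)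
    (ht : aeval ![1, t, b + U⁻¹ * (t + a)] F = 0) :
    ¬ ∀ i, IsAlgebraic k (![t, b + U⁻¹ * (t + a)] i) := by
  intro h
  have h0 := h 0
  have h1 := h 1
  simp only [Matrix.cons_val_zero, Matrix.cons_val_one] at h0 h1
  rw [← mem_ac_empty] at h0 h1
  have hle : ac k (∅ : Set W) ≤ ac k {a, U⁻¹} := ac_mono (by simp)
  have ha : a ∈ ac k {a, U⁻¹} := subset_ac _ (by simp)
  have hu : U⁻¹ ∈ ac k {a, U⁻¹} := subset_ac _ (by simp)
  refine ac_pair_ne hB a U⁻¹ (top_of_mem hB ha ?_ ?_)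
  · have : b = (b + U⁻¹ * (t + a)) - U⁻¹ * (t + a) := by ring
    rw [this]
    exact sub_mem (hle h1) (mul_mem hu (add_mem (hle h0) ha))
  · have := inv_mem hu
    rwa [inv_inv] at this

theorem root_ne (hB : IsTranscendenceBasis k ![a, b, U]) (hF : SmC F d)
    (ht : aeval ![1, t, b + U⁻¹ * (t + a)] F = 0) : t ≠ - a := by
  rintro rfl
  rw [neg_add_cancel, mul_zero, add_zero, ← aeval_dehom] at ht
  rcases dep2 hF.irr.ne_zero ht with h | h
  · refine ac_pair_ne hB b U (top_of_mem hB ?_ ?_ ?_)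
    · have := neg_mem h
      rw [neg_neg] at this
      exact ac_mono (by simp) this
    · exact subset_ac _ (by simp)
    · exact subset_ac _ (by simp)
  · refine ac_pair_ne hB a U (top_of_mem hB ?_ ?_ ?_)
    · exact subset_ac _ (by simp)
    · refine ac_le ?_ h
      rintro _ rfl
      exact neg_mem (subset_ac _ (by simp))
    · exact subset_ac _ (by simp)

theorem root_simple (hB : IsTranscendenceBasis k ![a, b, U]) (hF : SmC F d)
    (ht : aeval ![1, t, b + U⁻¹ * (t + a)] F = 0) :
    aeval ![1, t, b + U⁻¹ * (t + a)] (pderiv 1 F) +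
      U⁻¹ * aeval ![1, t, b + U⁻¹ * (t + a)] (pderiv 2 F) ≠ 0 := by
  intro h
  have h2 := gen_ne_zero hF ht (root_gen hB hF ht) (hF.hom.pderiv (i := 2)) (pderiv2_ne_zero hF)
    (by have := hF.two_le; omega)
  apply root_u hB hF ht
  set x := b + U⁻¹ * (t + a) with hx
  have hm : ∀ G : MvPolynomial (Fin 3) k, aeval ![1, t, x] G ∈ ac k {a, t, x} := by
    intro G
    have : aeval ![(1 : ac k {a, t, x}), ⟨t, subset_ac _ (by simp)⟩, ⟨x, subset_ac _ (by simp)⟩] G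
      = (⟨_, (Subtype.mem _)⟩ : ac k {a, t, x}) := rfl
    have h3 := aeval3_map (ac k {a, t, x}).val 1 ⟨t, subset_ac _ (by simp)⟩
      ⟨x, subset_ac _ (by simp)⟩ G
    change _ = aeval ![((1 : ac k {a, t, x}) : W), t, x] G at h3
    rw [OneMemClass.coe_one] at h3
    rw [← h3]
    exact Subtype.mem _
  have : U⁻¹ = - aeval ![1, t, x] (pderiv 1 F) * (aeval ![1, t, x] (pderiv 2 F))⁻¹ := by
    rw [eq_mul_inv_iff_mul_eq₀ h2]
    linear_combination h
  rw [this]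
  exact mul_mem (neg_mem (hm _)) (inv_mem (hm _))

theorem root_unique (hB : IsTranscendenceBasis k ![a, b, U]) (hF : SmC F d)
    (ht : aeval ![1, t, b + U⁻¹ * (t + a)] F = 0) {G : MvPolynomial (Fin 3) k}
    (hG : aeval ![1, t, b + U⁻¹ * (t + a)] G = 0) : dehom F ∣ dehom G := by
  have h1 := root_gen hB hF ht
  rw [← aeval_dehom] at ht hG
  exact gpl _ _ hF.irr _ ht h1 hG

variable [IsAlgClosed W]

theorem trans_one (hB : IsTranscendenceBasis k ![a, b, U]) (hF : SmC F d) {t' : W}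
    (ht : aeval ![1, t, b + U⁻¹ * (t + a)] F = 0)
    (ht' : aeval ![1, t', b + U⁻¹ * (t' + a)] F = 0) :
    ∃ σ : W ≃ₐ[k] W, σ a = a ∧ σ b = b ∧ σ U = U ∧ σ t = t' := by
  let M := IntermediateField.adjoin k ({a, b} : Set W)
  have ha : a ∈ M := IntermediateField.subset_adjoin _ _ (by simp)
  have hb : b ∈ M := IntermediateField.subset_adjoin _ _ (by simp)
  obtain ⟨σ, h1, h2⟩ := line_conj hF.irr M (⟨-a, neg_mem ha⟩ : M) (⟨b, hb⟩ : M) U⁻¹ t t'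
    (fun h => u_notMem_ab hB (mem_ac.2 h)) (root_ne hB hF ht) (root_ne hB hF ht')
    (by rw [aeval_dehom]; simpa using ht) (by rw [aeval_dehom]; simpa using ht') (by
      intro w
      have hw : w ∈ ac k (Set.range ![a, b, U]) := by
        rw [ac_top_of_basis hB]; trivial
      refine ac_tower M ?_ hw
      rintro _ ⟨i, rfl⟩
      fin_cases i
      · exact IntermediateField.algebraMap_mem _ (⟨a, ha⟩ : M)
      · exact IntermediateField.algebraMap_mem _ (⟨b, hb⟩ : M)
      · have : U⁻¹ ∈ IntermediateField.adjoin M {U⁻¹} :=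
          IntermediateField.subset_adjoin _ _ (by simp)
        have := inv_mem this
        rwa [inv_inv] at this)
  refine ⟨σ.restrictScalars k, ?_, ?_, ?_, h2⟩
  · exact σ.commutes ⟨a, ha⟩
  · exact σ.commutes ⟨b, hb⟩
  · have := map_inv₀ σ U⁻¹
    rw [h1, inv_inv] at this
    exact this

theorem trans_two (hB : IsTranscendenceBasis k ![a, b, U]) (hF : SmC F d) {t' t1 : W}
    (ht : aeval ![1, t, b + U⁻¹ * (t + a)] F = 0)
    (ht' : aeval ![1, t', b + U⁻¹ * (t' + a)] F = 0)
    (ht1 : aeval ![1, t1, b + U⁻¹ * (t1 + a)] F = 0)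
    (hne : t ≠ t1) (hne' : t' ≠ t1) :
    ∃ σ : W ≃ₐ[k] W, σ a = a ∧ σ b = b ∧ σ U = U ∧ σ t1 = t1 ∧ σ t = t' := by
  set x1 := b + U⁻¹ * (t1 + a) with hx1
  let M := IntermediateField.adjoin k ({a, t1, x1} : Set W)
  have ha : a ∈ M := IntermediateField.subset_adjoin _ _ (by simp)
  have hb : t1 ∈ M := IntermediateField.subset_adjoin _ _ (by simp)
  have hc : x1 ∈ M := IntermediateField.subset_adjoin _ _ (by simp)
  obtain ⟨σ, h1, h2⟩ := line_conj hF.irr M (⟨t1, hb⟩ : M) (⟨x1, hc⟩ : M) U⁻¹ t t'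
    (fun h => root_u hB hF ht1 (mem_ac.2 h)) hne hne'
    (by
      rw [aeval_dehom]
      have e : x1 + U⁻¹ * (t - t1) = b + U⁻¹ * (t + a) := by rw [hx1]; ring
      rw [← e] at ht
      exact ht) (by
      rw [aeval_dehom]
      have e : x1 + U⁻¹ * (t' - t1) = b + U⁻¹ * (t' + a) := by rw [hx1]; ring
      rw [← e] at ht'
      exact ht') (by
      intro w
      have hw : w ∈ ac k (Set.range ![a, b, U]) := by
        rw [ac_top_of_basis hB]; trivial
      have hu : U⁻¹ ∈ IntermediateField.adjoin M {U⁻¹} :=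
          IntermediateField.subset_adjoin _ _ (by simp)
      refine ac_tower M ?_ hw
      rintro _ ⟨i, rfl⟩
      fin_cases i
      · exact IntermediateField.algebraMap_mem _ (⟨a, ha⟩ : M)
      · change b ∈ _
        have : b = x1 - U⁻¹ * (t1 + a) := by rw [hx1]; ring
        rw [this]
        exact sub_mem (IntermediateField.algebraMap_mem _ (⟨x1, hc⟩ : M))
          (mul_mem hu (add_mem (IntermediateField.algebraMap_mem _ (⟨t1, hb⟩ : M))
           (IntermediateField.algebraMap_mem _ (⟨a, ha⟩ : M))))
      · have := inv_mem hu
        rwa [inv_inv] at this)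
  have ea : σ a = a := σ.commutes ⟨a, ha⟩
  have e1 : σ t1 = t1 := σ.commutes ⟨t1, hb⟩
  have ex : σ x1 = x1 := σ.commutes ⟨x1, hc⟩
  refine ⟨σ.restrictScalars k, ea, ?_, ?_, e1, h2⟩
  · change σ b = b
    have : b = x1 - U⁻¹ * (t1 + a) := by rw [hx1]; ring
    calc σ b = σ (x1 - U⁻¹ * (t1 + a)) := congrArg σ this
      _ = x1 - U⁻¹ * (t1 + a) := by
        have e2 : σ (t1 + a) = t1 + a := by rw [map_add, e1, ea]
        rw [map_sub σ x1, map_mul σ U⁻¹, h1, e2, ex]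
      _ = b := this.symm
  · have := map_inv₀ σ U⁻¹
    rw [h1, inv_inv] at this
    exact this
end

end

section

theorem hens_lift {Ω : Type*} [Field Ω] (P : Polynomial (PowerSeries Ω)) (hP : P.Monic) (s : Ω)
    (h : (P.map PowerSeries.constantCoeff).eval s = 0)
    (h' : (P.map PowerSeries.constantCoeff).derivative.eval s ≠ 0) :
    ∃ o : PowerSeries Ω, P.eval o = 0 ∧ PowerSeries.constantCoeff o = s := by
  have hev : ∀ (R : Polynomial (PowerSeries Ω)) (o : PowerSeries Ω),
      PowerSeries.constantCoeff (R.eval o) =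
      (R.map PowerSeries.constantCoeff).eval (PowerSeries.constantCoeff o) := by
    intro R o
    rw [Polynomial.eval_map_apply]
  have hmem : ∀ o : PowerSeries Ω, o ∈ Ideal.span {(PowerSeries.X : PowerSeries Ω)} ↔
      PowerSeries.constantCoeff o = 0 := by
    intro o
    rw [Ideal.mem_span_singleton, PowerSeries.X_dvd_iff]
  obtain ⟨o, h1, h2⟩ := HenselianRing.is_henselian (I := Ideal.span {(PowerSeries.X : PowerSeries Ω)})
    P hP (PowerSeries.C s) (by
      rw [hmem, hev]
      simpa using h) (by
      apply IsUnit.map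
      rw [PowerSeries.isUnit_iff_constantCoeff, hev, ← Polynomial.derivative_map]
      simpa using h')
  refine ⟨o, h1, ?_⟩
  rw [hmem, map_sub, sub_eq_zero] at h2
  simpa using h2

theorem hens_unique {Ω : Type*} [Field Ω] (P : Polynomial (PowerSeries Ω)) (o o' : PowerSeries Ω)
    (h : P.eval o = 0) (h' : P.eval o' = 0)
    (he : PowerSeries.constantCoeff o = PowerSeries.constantCoeff o')
    (hd : (P.map PowerSeries.constantCoeff).derivative.eval (PowerSeries.constantCoeff o) ≠ 0) :
    o = o' := by
  refine IsLocalRing.eq_of_eval_eq_zero_of_not_isUnit_sub h h' ?_ ?_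
  · rw [PowerSeries.isUnit_iff_constantCoeff, map_sub, he, sub_self]
    exact not_isUnit_zero
  · rw [PowerSeries.isUnit_iff_constantCoeff, isUnit_iff_ne_zero]
    rwa [Polynomial.derivative_map, Polynomial.eval_map_apply] at hd

theorem hens_swap {Ω : Type*} [Field Ω] [IsAlgClosed Ω] (P : Polynomial (PowerSeries Ω))
    (hP : P.Monic)
    (hsep : ∀ z : AlgebraicClosure (FractionRing (PowerSeries Ω)), Polynomial.aeval z P = 0 →
      Polynomial.aeval z P.derivative ≠ 0) (t0 : Ω)
    (hm : (P.map PowerSeries.constantCoeff).rootMultiplicity t0 = 2)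
    (hs : ∀ s, s ≠ t0 → (P.map PowerSeries.constantCoeff).eval s = 0 →
      (P.map PowerSeries.constantCoeff).derivative.eval s ≠ 0)
    (hno : ∀ o, P.eval o = 0 → PowerSeries.constantCoeff o ≠ t0) :
    ∃ (τ : AlgebraicClosure (FractionRing (PowerSeries Ω)) ≃ₐ[FractionRing (PowerSeries Ω)]
      AlgebraicClosure (FractionRing (PowerSeries Ω)))
      (t1 t2 : AlgebraicClosure (FractionRing (PowerSeries Ω))),
      t1 ≠ t2 ∧ Polynomial.aeval t1 P = 0 ∧ Polynomial.aeval t2 P = 0 ∧ τ t1 = t2 ∧ τ t2 = t1 ∧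
      ∀ z, Polynomial.aeval z P = 0 → z ≠ t1 → z ≠ t2 → τ z = z := by
  classical
  set Q := FractionRing (PowerSeries Ω) with hQ
  set S := AlgebraicClosure Q with hS
  set PB := P.map PowerSeries.constantCoeff with hPB
  have hPBm : PB.Monic := hP.map _
  set PS := P.map (algebraMap (PowerSeries Ω) S) with hPS
  have hPSm : PS.Monic := hP.map _
  have hroot : ∀ z : S, z ∈ PS.roots ↔ Polynomial.aeval z P = 0 := by
    intro z
    rw [Polynomial.mem_roots hPSm.ne_zero, Polynomial.IsRoot, hPS, Polynomial.eval_map_algebraMap]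
  have hnodup : PS.roots.Nodup := by
    rw [Multiset.nodup_iff_count_le_one]
    intro z
    rw [Polynomial.count_roots]
    by_contra hc
    push Not at hc
    rw [Polynomial.one_lt_rootMultiplicity_iff_isRoot hPSm.ne_zero] at hc
    obtain ⟨c1, c2⟩ := hc
    refine hsep z ?_ ?_
    · rwa [← hroot, Polynomial.mem_roots hPSm.ne_zero]
    · rwa [hPS, Polynomial.derivative_map, Polynomial.IsRoot, Polynomial.eval_map_algebraMap] at c2
  have hcardT : PS.roots.toFinset.card = P.natDegree := by
    rw [Multiset.toFinset_card_of_nodup hnodup, ← (IsAlgClosed.splits PS).natDegree_eq_card_roots,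
      hPS, hP.natDegree_map]
  have hcardB : Multiset.card PB.roots = P.natDegree := by
    rw [← (IsAlgClosed.splits PB).natDegree_eq_card_roots, hPB, hP.natDegree_map]
  have hL0 : (PB.roots.toFinset.erase t0).card + 2 = P.natDegree := by
    have h1 : (PB.roots.filter (fun s => s ≠ t0)).Nodup := by
      rw [Multiset.nodup_iff_count_le_one]
      intro s
      by_cases hst : s = t0
      · rw [Multiset.count_filter_of_neg (by simpa using hst)]; simp
      · rw [Multiset.count_filter_of_pos (by simpa using hst), Polynomial.count_roots]
        by_contra hc
        push Not at hc
        rw [Polynomial.one_lt_rootMultiplicity_iff_isRoot hPBm.ne_zero] at hc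
        exact hs s hst hc.1 hc.2
    have h2 : PB.roots.toFinset.erase t0 = (PB.roots.filter (fun s => s ≠ t0)).toFinset := by
      ext s; simp [and_comm]
    rw [h2, Multiset.toFinset_card_of_nodup h1, ← hcardB, ← hm, ← Polynomial.count_roots,
      Multiset.count_eq_card_filter_eq]
    have h3 := Multiset.filter_add_not (fun s => s ≠ t0) PB.roots
    have h4 := congrArg Multiset.card h3
    rw [Multiset.card_add] at h4
    rw [← h4]
    congr 2
    apply Multiset.filter_congr
    intro x _
    simp [eq_comm]
  have hlift : ∀ s : Ω, ∃ o : PowerSeries Ω, s ∈ PB.roots.toFinset.erase t0 →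
      P.eval o = 0 ∧ PowerSeries.constantCoeff o = s := by
    intro s
    by_cases h : s ∈ PB.roots.toFinset.erase t0
    · rw [Finset.mem_erase, Multiset.mem_toFinset, Polynomial.mem_roots hPBm.ne_zero] at h
      obtain ⟨o, ho⟩ := hens_lift P hP s h.2 (hs s h.1 h.2)
      exact ⟨o, fun _ => ho⟩
    · exact ⟨0, fun h' => absurd h' h⟩
  choose g hg using hlift
  have hinj : Function.Injective (algebraMap (PowerSeries Ω) S) := by
    rw [IsScalarTower.algebraMap_eq (PowerSeries Ω) Q S]
    exact (algebraMap Q S).injective.comp (IsFractionRing.injective _ _)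
  set L := (PB.roots.toFinset.erase t0).image (fun s => algebraMap (PowerSeries Ω) S (g s)) with hL
  have hLcard : L.card + 2 = P.natDegree := by
    rw [hL, Finset.card_image_of_injOn, hL0]
    intro s hs1 s' hs2 he
    have := hinj he
    rw [← (hg s hs1).2, ← (hg s' hs2).2, this]
  have hLT : L ⊆ PS.roots.toFinset := by
    intro z hz
    rw [hL, Finset.mem_image] at hz
    obtain ⟨s, hs1, rfl⟩ := hz
    rw [Multiset.mem_toFinset, hroot, Polynomial.aeval_algebraMap_apply, Polynomial.coe_aeval_eq_eval,
      (hg s hs1).1, map_zero]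
  have hcard2 : (PS.roots.toFinset \ L).card = 2 := by
    rw [Finset.card_sdiff_of_subset hLT]; omega
  obtain ⟨t1, t2, hne, hTL⟩ := Finset.card_eq_two.1 hcard2
  have hmemTL : ∀ z : S, Polynomial.aeval z P = 0 → z ∉ L → z = t1 ∨ z = t2 := by
    intro z h1 h2
    have : z ∈ PS.roots.toFinset \ L := by
      rw [Finset.mem_sdiff, Multiset.mem_toFinset, hroot]; exact ⟨h1, h2⟩
    rw [hTL] at this
    simpa using this
  have ht : ∀ z, z = t1 ∨ z = t2 → Polynomial.aeval z P = 0 ∧ z ∉ L := by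
    intro z hz
    have : z ∈ PS.roots.toFinset \ L := by
      rw [hTL]; simpa using hz
    rw [Finset.mem_sdiff, Multiset.mem_toFinset, hroot] at this
    exact this
  have hLfix : ∀ (τ : S ≃ₐ[Q] S), ∀ z ∈ L, τ z = z := by
    intro τ z hz
    rw [hL, Finset.mem_image] at hz
    obtain ⟨s, hs1, rfl⟩ := hz
    rw [IsScalarTower.algebraMap_apply (PowerSeries Ω) Q S, τ.commutes]
  have hpres : ∀ (τ : S ≃ₐ[Q] S) z, Polynomial.aeval z P = 0 → Polynomial.aeval (τ z) P = 0 := by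
    intro τ z hz
    have h1 : τ (Polynomial.aeval z P) = Polynomial.aeval (τ z) P := by
      exact (Polynomial.aeval_algHom_apply ((τ : S →ₐ[Q] S).restrictScalars (PowerSeries Ω)) z P).symm
    rw [← h1, hz, map_zero]
  have hpres2 : ∀ (τ : S ≃ₐ[Q] S) z, z = t1 ∨ z = t2 → τ z = t1 ∨ τ z = t2 := by
    intro τ z hz
    obtain ⟨h1, h2⟩ := ht z hz
    refine hmemTL _ (hpres τ z h1) fun h3 => ?_
    have h4 := hLfix τ _ h3
    have := τ.injective h4
    rw [this] at h3
    exact h2 h3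
  obtain ⟨hr1, hn1⟩ := ht t1 (Or.inl rfl)
  have hnotQ : ¬ ∃ q : Q, algebraMap Q S q = t1 := by
    rintro ⟨q, hq⟩
    have hIntg : IsIntegral (PowerSeries Ω) q := by
      refine ⟨P, hP, ?_⟩
      apply (algebraMap Q S).injective
      rw [← hq, Polynomial.aeval_algebraMap_apply] at hr1
      rw [map_zero]
      exact hr1
    obtain ⟨o, rfl⟩ := IsIntegrallyClosed.isIntegral_iff.1 hIntg
    rw [← IsScalarTower.algebraMap_apply] at hq
    have hPo : P.eval o = 0 := by
      apply hinj
      rw [← hq, Polynomial.aeval_algebraMap_apply, Polynomial.coe_aeval_eq_eval] at hr1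
      rw [hr1, map_zero]
    have h1 := hno o hPo
    have h2 : PB.eval (PowerSeries.constantCoeff o) = 0 := by
      rw [hPB, Polynomial.eval_map_apply, hPo, map_zero]
    have h3 : PowerSeries.constantCoeff o ∈ PB.roots.toFinset.erase t0 := by
      rw [Finset.mem_erase, Multiset.mem_toFinset, Polynomial.mem_roots hPBm.ne_zero]
      exact ⟨h1, h2⟩
    have h4 := hg _ h3
    have h5 := hens_unique P o _ hPo h4.1 h4.2.symm (hs _ h1 h2)
    apply hn1
    rw [hL, Finset.mem_image]
    exact ⟨_, h3, by rw [← h5, hq]⟩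
  have hmove : ∃ τ : S ≃ₐ[Q] S, τ t1 ≠ t1 := by
    by_contra hc
    push Not at hc
    apply hnotQ
    have hIntg : IsIntegral Q t1 := Algebra.IsIntegral.isIntegral t1
    have hsepm : (minpoly Q t1).Separable := by
      have hdvd : minpoly Q t1 ∣ P.map (algebraMap (PowerSeries Ω) Q) := by
        apply minpoly.dvd
        rw [Polynomial.aeval_map_algebraMap, hr1]
      refine Polynomial.Separable.of_dvd ?_ hdvd
      rw [← Polynomial.separable_map (algebraMap Q S), Polynomial.map_map,
        ← IsScalarTower.algebraMap_eq]
      exact (Polynomial.nodup_roots_iff_of_splits hPSm.ne_zero (IsAlgClosed.splits _)).1 hnodup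
    have hdeg : (minpoly Q t1).natDegree = 1 := by
      have h1 := Polynomial.card_rootSet_eq_natDegree (K := S) hsepm (IsAlgClosed.splits _)
      rw [← h1, Fintype.card_eq_one_iff]
      refine ⟨⟨t1, ?_⟩, ?_⟩
      · rw [Polynomial.mem_rootSet]
        exact ⟨minpoly.ne_zero hIntg, minpoly.aeval _ _⟩
      · rintro ⟨y, hy⟩
        rw [Polynomial.mem_rootSet] at hy
        have h2 : minpoly Q t1 = minpoly Q y :=
          minpoly.eq_of_irreducible_of_monic (minpoly.irreducible hIntg) hy.2 (minpoly.monic hIntg)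
        have h3 := (Normal.minpoly_eq_iff_mem_orbit (F := Q) S).1 h2.symm
        obtain ⟨τ, hτ⟩ := h3
        have h4 : τ t1 = y := hτ
        exact Subtype.ext (h4.symm.trans (hc τ))
    rw [minpoly.natDegree_eq_one_iff] at hdeg
    obtain ⟨q, hq⟩ := hdeg
    exact ⟨q, hq⟩
  obtain ⟨τ, hτ⟩ := hmove
  have e1 : τ t1 = t2 := (hpres2 τ t1 (Or.inl rfl)).resolve_left hτ
  have e2 : τ t2 = t1 := by
    refine (hpres2 τ t2 (Or.inr rfl)).resolve_right fun h => hne ?_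
    exact τ.injective (e1.trans h.symm)
  refine ⟨τ, t1, t2, hne, hr1, (ht t2 (Or.inr rfl)).1, e1, e2, fun z hz h1 h2 => ?_⟩
  apply hLfix
  by_contra h3
  rcases hmemTL z hz h3 with h | h
  · exact h1 h
  · exact h2 h

end

section

theorem rootMult_two {Ω : Type*} [Field Ω] (p : Polynomial Ω) (t : Ω) (h0 : p.eval t = 0)
    (h1 : p.derivative.eval t = 0) (h2 : p.derivative.derivative.eval t ≠ 0) :
    p.rootMultiplicity t = 2 := by
  have hp : p ≠ 0 := by rintro rfl; simp at h2
  apply le_antisymm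
  · by_contra hc
    push Not at hc
    have h3 : (Polynomial.X - Polynomial.C t) ^ 3 ∣ p :=
      (Polynomial.le_rootMultiplicity_iff hp).1 hc
    obtain ⟨q, rfl⟩ := h3
    apply h2
    simp [Polynomial.derivative_mul, Polynomial.derivative_pow]
  · exact (Polynomial.one_lt_rootMultiplicity_iff_isRoot hp).2 ⟨h0, h1⟩

theorem hens_all_monic {Ω : Type*} [Field Ω] [IsAlgClosed Ω] (P : Polynomial (PowerSeries Ω))
    (hP : P.Monic)
    (hs : ∀ s, (P.map PowerSeries.constantCoeff).eval s = 0 →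
      (P.map PowerSeries.constantCoeff).derivative.eval s ≠ 0)
    : ∀ z : AlgebraicClosure (FractionRing (PowerSeries Ω)), Polynomial.aeval z P = 0 →
    ∃ o : PowerSeries Ω, algebraMap _ _ o = z := by
  classical
  set Q := FractionRing (PowerSeries Ω) with hQ
  set S := AlgebraicClosure Q with hS
  set PB := P.map PowerSeries.constantCoeff with hPB
  have hPBm : PB.Monic := hP.map _
  set PS := P.map (algebraMap (PowerSeries Ω) S) with hPS
  have hPSm : PS.Monic := hP.map _
  have hroot : ∀ z : S, z ∈ PS.roots ↔ Polynomial.aeval z P = 0 := by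
    intro z
    rw [Polynomial.mem_roots hPSm.ne_zero, Polynomial.IsRoot, hPS, Polynomial.eval_map_algebraMap]
  have hcardT : PS.roots.toFinset.card ≤ P.natDegree := by
    refine (Multiset.toFinset_card_le _).trans ?_
    rw [← (IsAlgClosed.splits PS).natDegree_eq_card_roots, hPS, hP.natDegree_map]
  have hL0 : PB.roots.toFinset.card = P.natDegree := by
    rw [Multiset.toFinset_card_of_nodup, ← (IsAlgClosed.splits PB).natDegree_eq_card_roots, hPB,
      hP.natDegree_map]
    rw [Multiset.nodup_iff_count_le_one]
    intro s
    rw [Polynomial.count_roots]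
    by_contra hc
    push Not at hc
    rw [Polynomial.one_lt_rootMultiplicity_iff_isRoot hPBm.ne_zero] at hc
    exact hs s hc.1 hc.2
  have hlift : ∀ s : Ω, ∃ o : PowerSeries Ω, s ∈ PB.roots.toFinset →
      P.eval o = 0 ∧ PowerSeries.constantCoeff o = s := by
    intro s
    by_cases h : s ∈ PB.roots.toFinset
    · rw [Multiset.mem_toFinset, Polynomial.mem_roots hPBm.ne_zero] at h
      obtain ⟨o, ho⟩ := hens_lift P hP s h (hs s h)
      exact ⟨o, fun _ => ho⟩
    · exact ⟨0, fun h' => absurd h' h⟩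
  choose g hg using hlift
  have hinj : Function.Injective (algebraMap (PowerSeries Ω) S) := by
    rw [IsScalarTower.algebraMap_eq (PowerSeries Ω) Q S]
    exact (algebraMap Q S).injective.comp (IsFractionRing.injective _ _)
  set L := (PB.roots.toFinset).image (fun s => algebraMap (PowerSeries Ω) S (g s)) with hL
  have hLcard : L.card = P.natDegree := by
    rw [hL, Finset.card_image_of_injOn, hL0]
    intro s hs1 s' hs2 he
    have := hinj he
    rw [← (hg s hs1).2, ← (hg s' hs2).2, this]
  have hLT : L ⊆ PS.roots.toFinset := by
    intro z hz
    rw [hL, Finset.mem_image] at hz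
    obtain ⟨s, hs1, rfl⟩ := hz
    rw [Multiset.mem_toFinset, hroot, Polynomial.aeval_algebraMap_apply, Polynomial.coe_aeval_eq_eval,
      (hg s hs1).1, map_zero]
  have hLT' := Finset.eq_of_subset_of_card_le hLT (by rw [hLcard]; exact hcardT)
  intro z hz
  have : z ∈ L := by rw [hLT', Multiset.mem_toFinset, hroot]; exact hz
  rw [hL, Finset.mem_image] at this
  obtain ⟨s, _, h⟩ := this
  exact ⟨_, h⟩

theorem exists_monic_normal {R : Type*} [CommRing R] (P : Polynomial R)
    (hP : IsUnit P.leadingCoeff) : ∃ c c' : R, c * c' = 1 ∧ (Polynomial.C c * P).Monic := by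
  obtain ⟨u, hu⟩ := hP
  refine ⟨(u⁻¹ : Rˣ), u, by simp, ?_⟩
  rw [Polynomial.Monic, Polynomial.leadingCoeff_C_mul_of_isUnit (Units.isUnit _), ← hu]
  simp

theorem hens_all {Ω : Type*} [Field Ω] [IsAlgClosed Ω] (P : Polynomial (PowerSeries Ω))
    (hP : IsUnit P.leadingCoeff)
    (hs : ∀ s, (P.map PowerSeries.constantCoeff).eval s = 0 →
      (P.map PowerSeries.constantCoeff).derivative.eval s ≠ 0)
    (z : AlgebraicClosure (FractionRing (PowerSeries Ω))) (hz : Polynomial.aeval z P = 0) :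
    ∃ o : PowerSeries Ω, algebraMap _ _ o = z := by
  obtain ⟨c, c', hc, hm⟩ := exists_monic_normal P hP
  have hc0 : PowerSeries.constantCoeff c ≠ 0 := by
    intro h
    have := congrArg PowerSeries.constantCoeff hc
    rw [map_mul, h, zero_mul, map_one] at this
    exact zero_ne_one this
  refine hens_all_monic _ hm ?_ z ?_
  · intro s h1
    rw [Polynomial.map_mul, Polynomial.map_C, Polynomial.eval_C_mul] at h1
    rw [Polynomial.map_mul, Polynomial.map_C, Polynomial.derivative_C_mul, Polynomial.eval_C_mul]
    exact mul_ne_zero hc0 (hs s ((mul_eq_zero.1 h1).resolve_left hc0))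
  · rw [map_mul, hz, mul_zero]

theorem hens_swap' {Ω : Type*} [Field Ω] [IsAlgClosed Ω] (P : Polynomial (PowerSeries Ω))
    (hP : IsUnit P.leadingCoeff)
    (hsep : ∀ z : AlgebraicClosure (FractionRing (PowerSeries Ω)), Polynomial.aeval z P = 0 →
      Polynomial.aeval z P.derivative ≠ 0) (t0 : Ω)
    (h0 : (P.map PowerSeries.constantCoeff).eval t0 = 0)
    (h1 : (P.map PowerSeries.constantCoeff).derivative.eval t0 = 0)
    (h2 : (P.map PowerSeries.constantCoeff).derivative.derivative.eval t0 ≠ 0)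
    (hs : ∀ s, s ≠ t0 → (P.map PowerSeries.constantCoeff).eval s = 0 →
      (P.map PowerSeries.constantCoeff).derivative.eval s ≠ 0)
    (hno : ∀ o, P.eval o = 0 → PowerSeries.constantCoeff o ≠ t0) :
    ∃ (τ : AlgebraicClosure (FractionRing (PowerSeries Ω)) ≃ₐ[FractionRing (PowerSeries Ω)]
      AlgebraicClosure (FractionRing (PowerSeries Ω)))
      (t1 t2 : AlgebraicClosure (FractionRing (PowerSeries Ω))),
      t1 ≠ t2 ∧ Polynomial.aeval t1 P = 0 ∧ Polynomial.aeval t2 P = 0 ∧ τ t1 = t2 ∧ τ t2 = t1 ∧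
      ∀ z, Polynomial.aeval z P = 0 → z ≠ t1 → z ≠ t2 → τ z = z := by
  obtain ⟨c, c', hc, hm⟩ := exists_monic_normal P hP
  have hc0 : PowerSeries.constantCoeff c ≠ 0 := by
    intro h
    have := congrArg PowerSeries.constantCoeff hc
    rw [map_mul, h, zero_mul, map_one] at this
    exact zero_ne_one this
  have hcn : c ≠ 0 := by rintro rfl; simp at hc0
  have hinj : Function.Injective (algebraMap (PowerSeries Ω)
      (AlgebraicClosure (FractionRing (PowerSeries Ω)))) := by
    rw [IsScalarTower.algebraMap_eq (PowerSeries Ω) (FractionRing (PowerSeries Ω))]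
    exact (algebraMap (FractionRing (PowerSeries Ω)) _).injective.comp (IsFractionRing.injective _ _)
  have hcS : algebraMap (PowerSeries Ω) (AlgebraicClosure (FractionRing (PowerSeries Ω))) c ≠ 0 := by
    rwa [Ne, map_eq_zero_iff _ hinj]
  have hz : ∀ z : AlgebraicClosure (FractionRing (PowerSeries Ω)),
      Polynomial.aeval z (Polynomial.C c * P) = 0 ↔ Polynomial.aeval z P = 0 := by
    intro z
    rw [map_mul, Polynomial.aeval_C, mul_eq_zero]
    exact or_iff_right hcS
  obtain ⟨τ, t1, t2, e⟩ := hens_swap _ hm (by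
    intro z h
    rw [hz] at h
    rw [Polynomial.derivative_C_mul, map_mul, Polynomial.aeval_C]
    exact mul_ne_zero hcS (hsep z h)) t0 (by
      apply rootMult_two
      · rw [Polynomial.map_mul, Polynomial.map_C, Polynomial.eval_C_mul, h0, mul_zero]
      · rw [Polynomial.map_mul, Polynomial.map_C, Polynomial.derivative_C_mul,
          Polynomial.eval_C_mul, h1, mul_zero]
      · rw [Polynomial.map_mul, Polynomial.map_C, Polynomial.derivative_C_mul,
          Polynomial.derivative_C_mul, Polynomial.eval_C_mul]
        exact mul_ne_zero hc0 h2) (by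
      intro s hne h1
      rw [Polynomial.map_mul, Polynomial.map_C, Polynomial.eval_C_mul] at h1
      rw [Polynomial.map_mul, Polynomial.map_C, Polynomial.derivative_C_mul, Polynomial.eval_C_mul]
      exact mul_ne_zero hc0 (hs s hne ((mul_eq_zero.1 h1).resolve_left hc0))) (by
      intro o ho
      rw [Polynomial.eval_C_mul] at ho
      exact hno o ((mul_eq_zero.1 ho).resolve_left hcn))
  simp only [hz] at e
  exact ⟨τ, t1, t2, e⟩

end

section

theorem ind_line {k W : Type*} [Field k] [IsAlgClosed k] [Field W] [Algebra k W]
    (E : IntermediateField k W) {a u0 v0 : W} (hu : u0 ∈ E) (hv : v0 ∈ E)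
    (ha : ¬ IsAlgebraic E a) (hu0 : ¬ IsAlgebraic k u0) (P : MvPolynomial (Fin 2) k)
    (hP : aeval ![a, v0 - u0 * a] P = 0) : P = 0 := by
  have hinf : Infinite k := IsAlgClosed.instInfinite
  by_contra hP0
  set Q : Polynomial E := aeval ![Polynomial.X, Polynomial.C ⟨v0, hv⟩ -
    Polynomial.C ⟨u0, hu⟩ * Polynomial.X] P with hQ
  have h1 : Polynomial.aeval a Q = 0 := by
    rw [hQ, ← AlgHom.restrictScalars_apply k, ← AlgHom.comp_apply, comp_aeval, ← hP]
    congr 2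
    funext i
    fin_cases i <;> simp
  have hQ0 : Q = 0 := by
    by_contra h
    exact ha ⟨Q, h, h1⟩
  have h2 : ∀ α : k, aeval ![algebraMap k W α, v0 - u0 * algebraMap k W α] P = 0 := by
    intro α
    have : Polynomial.aeval (algebraMap k W α) Q = 0 := by rw [hQ0, map_zero]
    rw [← this, hQ, ← AlgHom.restrictScalars_apply k (Polynomial.aeval _), ← AlgHom.comp_apply, comp_aeval]
    congr 2
    funext i
    fin_cases i <;> simp
  have h3 : ∀ (α : k) (y : k), eval ![α, y] P ≠ 0 →
      IsAlgebraic k (v0 - u0 * algebraMap k W α) := by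
    intro α y hy
    refine ⟨aeval ![Polynomial.C α, Polynomial.X] P, ?_, ?_⟩
    · intro h
      apply hy
      have := congrArg (Polynomial.aeval y) h
      rw [← AlgHom.comp_apply, comp_aeval, map_zero] at this
      rw [← this, ← aeval_eq_eval, ]
      congr 2
      funext i
      fin_cases i <;> simp
    · rw [← AlgHom.comp_apply, comp_aeval, ← h2 α]
      congr 2
      funext i
      fin_cases i <;> simp
  have h4 : ∀ q : MvPolynomial (Fin 2) k, q ≠ 0 → ∃ x y : k, eval ![x, y] q ≠ 0 := by
    intro q hq
    by_contra hc
    push Not at hc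
    apply hq
    apply MvPolynomial.funext
    intro x
    rw [map_zero, ← hc (x 0) (x 1)]
    congr 2
    funext i
    fin_cases i <;> rfl
  obtain ⟨α1, y1, hy1⟩ := h4 P hP0
  obtain ⟨α2, y2, hy2⟩ := h4 (P * (X 0 - C α1)) (by
    refine mul_ne_zero hP0 ?_
    intro h
    have := congrArg (eval ![α1 + 1, 0]) h
    simp at this)
  have hy2' : eval ![α2, y2] P ≠ 0 := by
    intro h; apply hy2; rw [map_mul, h, zero_mul]
  have hne : α2 - α1 ≠ 0 := by
    intro h; apply hy2; simp [h]
  have e := (h3 _ _ hy1).sub (h3 _ _ hy2')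
  have e2 : v0 - u0 * algebraMap k W α1 - (v0 - u0 * algebraMap k W α2) =
      algebraMap k W (α2 - α1) * u0 := by rw [map_sub]; ring
  rw [e2] at e
  have e3 := (isAlgebraic_algebraMap (A := W) (α2 - α1)⁻¹).mul e
  rw [← mul_assoc, ← map_mul, inv_mul_cancel₀ hne, map_one, one_mul] at e3
  exact hu0 e3

theorem ind_series {k W : Type*} [Field k] [IsAlgClosed k] [Field W] [Algebra k W]
    {a b U0 : W} (hab : ∀ P : MvPolynomial (Fin 2) k, aeval ![a, b] P = 0 → P = 0)
    (P : MvPolynomial (Fin 3) k)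
    (hP : aeval ![PowerSeries.C a, PowerSeries.C b, PowerSeries.C U0 + PowerSeries.X] P = 0) :
    P = 0 := by
  have hinf : Infinite k := IsAlgClosed.instInfinite
  set Q : Polynomial W := aeval ![Polynomial.C a, Polynomial.C b, Polynomial.X] P with hQ
  have h1 : ((Q.comp (Polynomial.X + Polynomial.C U0) : Polynomial W) : PowerSeries W) = 0 := by
    let φ : Polynomial W →ₐ[W] PowerSeries W := Polynomial.coeToPowerSeries.algHom W
    have : φ (Polynomial.aeval (Polynomial.X + Polynomial.C U0) Q) = 0 := by
      rw [hQ, ← AlgHom.restrictScalars_apply k, ← AlgHom.restrictScalars_apply k (Polynomial.aeval _),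
        ← AlgHom.comp_apply, ← AlgHom.comp_apply, comp_aeval, ← hP]
      congr 2
      funext i
      fin_cases i <;> simp [φ, Polynomial.coeToPowerSeries.algHom_apply]
      rw [add_comm]
    simpa [φ, Polynomial.coeToPowerSeries.algHom_apply, Polynomial.comp, Polynomial.aeval_def] using this
  have hQ0 : Q = 0 := by
    have h2 : Q.comp (Polynomial.X + Polynomial.C U0) = 0 := by
      apply Polynomial.coe_injective; simpa using h1
    rw [← Polynomial.taylor_apply] at h2
    exact Polynomial.taylor_injective U0 (by rw [h2, map_zero])
  have h2 : ∀ γ : k, (aeval ![X 0, X 1, C γ] P : MvPolynomial (Fin 2) k) = 0 := by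
    intro γ
    apply hab
    have : Polynomial.aeval (algebraMap k W γ) Q = 0 := by rw [hQ0, map_zero]
    rw [← this, hQ, ← AlgHom.restrictScalars_apply k (Polynomial.aeval _), ← AlgHom.comp_apply,
      ← AlgHom.comp_apply, comp_aeval, comp_aeval]
    congr 2
    funext i
    fin_cases i <;> simp
  apply MvPolynomial.funext
  intro x
  rw [map_zero]
  have := congrArg (aeval ![x 0, x 1]) (h2 (x 2))
  rw [← AlgHom.comp_apply, comp_aeval, map_zero] at this
  rw [← this, ← aeval_eq_eval]
  congr 2
  funext i
  fin_cases i <;> simp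

theorem ac_map {k W W' : Type*} [Field k] [Field W] [Field W'] [Algebra k W] [Algebra k W']
    (φ : W →ₐ[k] W') {T : Set W} {w : W} (hw : w ∈ ac k T) : φ w ∈ ac k (φ '' T) := by
  rw [mem_ac_alg] at hw ⊢
  obtain ⟨p, hp, hpw⟩ := hw
  have hmem : ∀ x : Algebra.adjoin k T, φ x ∈ Algebra.adjoin k (φ '' T) := by
    intro x
    rw [← AlgHom.map_adjoin]
    exact ⟨x, x.2, rfl⟩
  let ψ : Algebra.adjoin k T →+* Algebra.adjoin k (φ '' T) :=
    ((φ : W →+* W').comp (Algebra.adjoin k T).val.toRingHom).codRestrict _ hmem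
  have hψ : Function.Injective ψ := by
    intro x y h
    have := congrArg Subtype.val h
    exact Subtype.ext (φ.injective this)
  refine ⟨p.map ψ, by rwa [Ne, Polynomial.map_eq_zero_iff hψ], ?_⟩
  rw [Polynomial.aeval_def, Polynomial.eval₂_map]
  have := congrArg φ hpw
  rw [map_zero] at this
  rw [← this, Polynomial.aeval_def]
  exact (Polynomial.hom_eval₂ p _ (φ : W →+* W') w).symm

end

section

section
variable {k W : Type*} [Field k] [Field W] [Algebra k W] {F : MvPolynomial (Fin 3) k} {d : ℕ}

theorem Gp_root_iff (hF : F.IsHomogeneous d) {a b U t : W} (hU : U ≠ 0) :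
    (Gp F a b U).eval t = 0 ↔ aeval ![1, t, b + U⁻¹ * (t + a)] F = 0 := by
  rw [Gp_eval, line_scale hF _ _ _ _ hU, mul_eq_zero]
  exact or_iff_right (pow_ne_zero _ hU)

theorem Gp_deriv_eval (hF : SmC F d) {a b U t : W} (hU : U ≠ 0) :
    (Gp F a b U).derivative.eval t = U ^ d * (aeval ![1, t, b + U⁻¹ * (t + a)] (pderiv 1 F) +
      U⁻¹ * aeval ![1, t, b + U⁻¹ * (t + a)] (pderiv 2 F)) := by
  obtain ⟨e, rfl⟩ : ∃ e, d = e + 1 := ⟨d - 1, by have := hF.two_le; omega⟩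
  rw [Gp_deriv, Polynomial.eval_add, Polynomial.eval_C_mul, Gp_eval, Gp_eval,
    line_scale hF.hom.pderiv _ _ _ _ hU, line_scale hF.hom.pderiv _ _ _ _ hU]
  simp only [Nat.add_sub_cancel]
  field_simp
  ring

theorem Gp_deriv2_eval (hF : SmC F d) {a b U t : W} (hU : U ≠ 0) :
    (Gp F a b U).derivative.derivative.eval t = U ^ d *
      (aeval ![1, t, b + U⁻¹ * (t + a)] (pderiv 1 (pderiv 1 F)) +
      2 * U⁻¹ * aeval ![1, t, b + U⁻¹ * (t + a)] (pderiv 1 (pderiv 2 F)) +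
      U⁻¹ ^ 2 * aeval ![1, t, b + U⁻¹ * (t + a)] (pderiv 2 (pderiv 2 F))) := by
  obtain ⟨e, rfl⟩ : ∃ e, d = e + 2 := ⟨d - 2, by have := hF.two_le; omega⟩
  rw [Gp_deriv, Polynomial.derivative_add, Polynomial.derivative_C_mul, Gp_deriv, Gp_deriv,
    pderiv_comm' 2 1]
  simp only [Polynomial.eval_add, Polynomial.eval_C_mul, Gp_eval]
  rw [line_scale hF.hom.pderiv.pderiv _ _ _ _ hU, line_scale hF.hom.pderiv.pderiv _ _ _ _ hU,
    line_scale hF.hom.pderiv.pderiv _ _ _ _ hU]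
  simp only [show e + 2 - 1 - 1 = e by omega]
  field_simp
  ring

theorem lead_ne (hF : SmC F d) {U : W} (hU : ¬ IsAlgebraic k U) : aeval ![0, U, 1] F ≠ 0 := by
  intro h
  apply hU
  refine ⟨_, infty_ne_zero hF, ?_⟩
  rw [aeval3_map, ← h]
  simp

theorem Gp_natDegree (hF : SmC F d) {a b U : W} (hU : ¬ IsAlgebraic k U) :
    (Gp F a b U).natDegree = d := by
  apply le_antisymm (Gp_natDegree_le hF.hom _ _ _)
  apply Polynomial.le_natDegree_of_ne_zero
  rw [Gp_coeff hF.hom]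
  exact lead_ne hF hU

end

noncomputable def ccHom (k W : Type*) [Field k] [Field W] [Algebra k W] : PowerSeries W →ₐ[k] W :=
  { (PowerSeries.constantCoeff (R := W)) with
    commutes' := by
      intro r
      change PowerSeries.constantCoeff (algebraMap k (PowerSeries W) r) = _
      rw [PowerSeries.algebraMap_apply, PowerSeries.constantCoeff_C] }

theorem ccHom_apply {k W : Type*} [Field k] [Field W] [Algebra k W] (o : PowerSeries W) :
    ccHom k W o = PowerSeries.constantCoeff o := rfl

theorem Gp_series_unit {k W : Type*} [Field k] [Field W] [Algebra k W] {F : MvPolynomial (Fin 3) k}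
    {d : ℕ} (hF : SmC F d) {a b V : PowerSeries W}
    (hU : ¬ IsAlgebraic k (PowerSeries.constantCoeff V)) :
    IsUnit (Gp F a b V).leadingCoeff := by
  have h1 : IsUnit ((Gp F a b V).coeff d) := by
    rw [PowerSeries.isUnit_iff_constantCoeff, Gp_coeff hF.hom]
    have : PowerSeries.constantCoeff (aeval ![0, V, 1] F) = aeval ![0, PowerSeries.constantCoeff V, 1] F := by
      have := aeval3_map (ccHom k W) 0 V 1 F
      rw [map_zero, map_one] at this
      exact this
    rw [this]
    exact (lead_ne hF hU).isUnit
  have h2 : (Gp F a b V).natDegree = d :=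
    le_antisymm (Gp_natDegree_le hF.hom _ _ _) (Polynomial.le_natDegree_of_ne_zero h1.ne_zero)
  rw [Polynomial.leadingCoeff, h2]
  exact h1

theorem series_no_root {k W : Type*} [Field k] [Field W] [Algebra k W] {F : MvPolynomial (Fin 3) k}
    {d : ℕ} (hF : SmC F d) {a b U0 t : W} (hU : U0 ≠ 0)
    (hz : aeval ![1, t, b + U0⁻¹ * (t + a)] F = 0)
    (hu : aeval ![1, t, b + U0⁻¹ * (t + a)] (pderiv 1 F) +
      U0⁻¹ * aeval ![1, t, b + U0⁻¹ * (t + a)] (pderiv 2 F) = 0)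
    (h2 : aeval ![1, t, b + U0⁻¹ * (t + a)] (pderiv 2 F) ≠ 0) (hta : t ≠ -a) (o : PowerSeries W)
    (ho : (Gp F (PowerSeries.C a) (PowerSeries.C b)
      (PowerSeries.C U0 + PowerSeries.X)).eval o = 0) : PowerSeries.constantCoeff o ≠ t := by
  intro hot
  have hD := congrArg ((PowerSeries.derivative W).restrictScalars k) ho
  rw [Gp_eval, deriv_aeval, map_zero, Fin.sum_univ_three] at hD
  have hD2 := congrArg (ccHom k W) hD
  simp only [map_add, smul_eq_mul, map_mul, aeval3_map, ccHom_apply, map_zero] at hD2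
  simp [hot, Derivation.leibniz] at hD2
  have e : ∀ G : MvPolynomial (Fin 3) k, G.IsHomogeneous (d - 1) →
      aeval ![U0, U0 * t, a + t + b * U0] G = U0 ^ (d - 1) * aeval ![1, t, b + U0⁻¹ * (t + a)] G :=
    fun G hG => line_scale hG _ _ _ _ hU
  rw [e _ hF.hom.pderiv, e _ hF.hom.pderiv, e _ hF.hom.pderiv] at hD2
  have eu := euler_aeval hF.hom ![1, t, b + U0⁻¹ * (t + a)]
  rw [Fin.sum_univ_three, hz] at eu
  simp only [Matrix.cons_val_zero, Matrix.cons_val_one, Matrix.cons_val, mul_zero, one_mul] at eu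
  set F0 := aeval ![1, t, b + U0⁻¹ * (t + a)] (pderiv 0 F)
  set F1 := aeval ![1, t, b + U0⁻¹ * (t + a)] (pderiv 1 F)
  set F2 := aeval ![1, t, b + U0⁻¹ * (t + a)] (pderiv 2 F)
  set c := U0 ^ (d - 1) with hc
  have hc0 : c ≠ 0 := pow_ne_zero _ hU
  have : c * F2 * (U0⁻¹ * (t + a)) = 0 := by
    have hu' : U0 * F1 + F2 = 0 := by
      have := congrArg (fun z => U0 * z) hu
      simp only [mul_add, ← mul_assoc, mul_inv_cancel₀ hU, one_mul, mul_zero] at this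
      exact this
    linear_combination c * eu - hD2 +
      c * PowerSeries.constantCoeff ((PowerSeries.derivative W) o) * hu'
  have h3 : t + a ≠ 0 := fun h => hta (eq_neg_of_add_eq_zero_left h)
  exact mul_ne_zero (mul_ne_zero hc0 h2) (mul_ne_zero (inv_ne_zero hU) h3) this

end

section

theorem restrict_auto.{u} {k : Type*} {W S : Type u} [Field k] [Field W] [IsAlgClosed W] [Field S] [Algebra k W]
    [Algebra k S] {ι : Type*} {v : ι → W} (hv : ac k (Set.range v) = ⊤) (Ψ : W →ₐ[k] S)
    (τ : S ≃ₐ[k] S) (hτ : ∀ i, τ (Ψ (v i)) = Ψ (v i)) :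
    ∃ σ : W ≃ₐ[k] W, ∀ w, Ψ (σ w) = τ (Ψ w) := by
  have hac : IsAlgClosed Ψ.fieldRange :=
    IsAlgClosed.of_ringEquiv W _ (AlgEquiv.ofInjectiveField Ψ).toRingEquiv
  have key : ∀ τ : S ≃ₐ[k] S, (∀ i, τ (Ψ (v i)) = Ψ (v i)) → ∀ w, ∃ w', Ψ w' = τ (Ψ w) := by
    intro τ hτ w
    have h1 : w ∈ ac k (Set.range v) := by rw [hv]; trivial
    have h2 := ac_map ((τ : S →ₐ[k] S).comp Ψ) h1
    have hle : IntermediateField.adjoin k (((τ : S →ₐ[k] S).comp Ψ) '' Set.range v) ≤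
        Ψ.fieldRange := by
      rw [IntermediateField.adjoin_le_iff]
      rintro _ ⟨_, ⟨i, rfl⟩, rfl⟩
      exact ⟨v i, (hτ i).symm⟩
    obtain ⟨c, hc⟩ := mem_range_of_alg (alg_mono hle (mem_ac.1 h2))
    obtain ⟨y, hy⟩ := c.2
    exact ⟨y, hy.trans hc⟩
  choose σ hσ using key τ hτ
  choose σ' hσ' using key τ.symm (fun i => by rw [AlgEquiv.symm_apply_eq, hτ])
  refine ⟨AlgEquiv.ofBijective (AlgHom.ofLinearMap
    { toFun := σ, map_add' := ?_, map_smul' := ?_ } ?_ ?_) ⟨?_, ?_⟩, hσ⟩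
  · intro x y; apply Ψ.injective; simp [hσ]
  · intro m x; apply Ψ.injective; simp [hσ]
  · apply Ψ.injective; simp [hσ]
  · intro x y; apply Ψ.injective; simp [hσ]
  · exact RingHom.injective _
  · intro y
    refine ⟨σ' y, ?_⟩
    apply Ψ.injective
    change Ψ (σ (σ' y)) = _
    rw [hσ, hσ', AlgEquiv.apply_symm_apply]
    rfl

section
variable {k W : Type*} [Field k] [IsAlgClosed k] [Field W] [IsAlgClosed W] [Algebra k W]
  {a b U : W}

theorem U_trans (hB : IsTranscendenceBasis k ![a, b, U]) : ¬ IsAlgebraic k U := by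
  have := hB.1.transcendental 2
  exact this

theorem exists_root (hB : IsTranscendenceBasis k ![a, b, U]) {F : MvPolynomial (Fin 3) k} {d : ℕ}
    (hF : SmC F d) : ∃ t : W, aeval ![1, t, b + U⁻¹ * (t + a)] F = 0 := by
  have h := Gp_natDegree hF (a := a) (b := b) (U_trans hB)
  obtain ⟨t, ht⟩ := IsAlgClosed.exists_root (Gp F a b U) (by
    intro hd
    have h1 : (Gp F a b U).natDegree = 0 := Polynomial.natDegree_eq_of_degree_eq_some hd
    have := hF.two_le
    omega)
  exact ⟨t, (Gp_root_iff hF.hom (U_ne_zero hB)).1 ht⟩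

set_option maxHeartbeats 1000000 in
theorem swap_exists (hB : IsTranscendenceBasis k ![a, b, U]) {r : ℕ}
    {F : Fin r → MvPolynomial (Fin 3) k} {d : Fin r → ℕ} (hF : ∀ i, SmC (F i) (d i))
    (hna : ∀ i j, i ≠ j → ¬ dehom (F i) ∣ dehom (F j)) (i : Fin r) :
    ∃ σ : W ≃ₐ[k] W, (∀ w ∈ ac k {a, b}, σ w = w) ∧ σ U = U ∧ ∃ t1 t2, t1 ≠ t2 ∧
      (Gp (F i) a b U).eval t1 = 0 ∧ (Gp (F i) a b U).eval t2 = 0 ∧ σ t1 = t2 ∧ σ t2 = t1 ∧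
      ∀ j z, (Gp (F j) a b U).eval z = 0 → z ≠ t1 → z ≠ t2 → σ z = z := by
  have hU := U_ne_zero hB
  obtain ⟨t, hz⟩ := exists_root hB (hF i)
  have hg := root_gen hB (hF i) hz
  have hta := root_ne hB (hF i) hz
  obtain ⟨z0, hz1, hz2⟩ := root_aux hB (hF i) hz
  set x := b + U⁻¹ * (t + a) with hx
  have hane : ¬ IsAlgebraic (ac k {t, x}) a := by
    intro h
    have h1 := hz2 (mem_ac_of_alg h)
    apply ac_pair_ne hB z0 U⁻¹
    rw [eq_top_iff, ← hz1]
    apply ac_le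
    rintro y (rfl | rfl | rfl)
    · exact ac_mono (by simp) h1
    · exact subset_ac _ (by simp)
    · exact subset_ac _ (by simp)
  have hγ2 : aeval ![1, t, x] (pderiv 2 (F i)) ≠ 0 :=
    gen_ne_zero (hF i) hz hg (hF i).hom.pderiv (pderiv2_ne_zero (hF i))
      (by have := (hF i).two_le; omega)
  set u0 := - aeval ![1, t, x] (pderiv 1 (F i)) / aeval ![1, t, x] (pderiv 2 (F i)) with hu0
  have hu : aeval ![1, t, x] (pderiv 1 (F i)) + u0 * aeval ![1, t, x] (pderiv 2 (F i)) = 0 := by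
    rw [hu0]; field_simp; ring
  have hut := slope_trans (hF i) hz hg u0 hu
  have hu00 : u0 ≠ 0 := by
    rintro h; apply hut; rw [h]; exact isAlgebraic_zero
  set U0 := u0⁻¹ with hU0
  have hU00 : U0 ≠ 0 := inv_ne_zero hu00
  have hU0i : U0⁻¹ = u0 := inv_inv _
  have hU0t : ¬ IsAlgebraic k U0 := by
    intro h; apply hut; rw [← hU0i]; exact h.inv
  set b' := x - u0 * (t + a) with hb'
  have hxb : b' + U0⁻¹ * (t + a) = x := by rw [hU0i, hb']; ring
  have htx : ∀ G : MvPolynomial (Fin 3) k, aeval ![1, t, x] G ∈ ac k {t, x} := by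
    intro G
    have := aeval3_map (ac k {t, x}).val 1 ⟨t, subset_ac _ (by simp)⟩ ⟨x, subset_ac _ (by simp)⟩ G
    have h2 : (ac k {t, x}).val 1 = 1 := rfl
    rw [h2] at this
    change _ = aeval ![1, t, x] G at this
    rw [← this]
    exact Subtype.prop _
  have hu0m : u0 ∈ ac k {t, x} := by
    rw [hu0]
    exact div_mem (neg_mem (htx _)) (htx _)
  have hab : ∀ P : MvPolynomial (Fin 2) k, aeval ![a, b'] P = 0 → P = 0 := by
    intro P hP
    refine ind_line (ac k {t, x}) (v0 := x - u0 * t) hu0m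
      (sub_mem (subset_ac _ (by simp)) (mul_mem hu0m (subset_ac _ (by simp)))) hane hut P ?_
    rw [← hP]
    congr 3
    rw [hb']; ring_nf
  have hind := ind_series (U0 := U0) hab
  -- the series embedding
  let O := PowerSeries W
  let S := AlgebraicClosure (FractionRing (PowerSeries W))
  have hinj : Function.Injective (algebraMap O S) := by
    rw [IsScalarTower.algebraMap_eq O (FractionRing (PowerSeries W)) S]
    exact (algebraMap (FractionRing (PowerSeries W)) S).injective.comp (IsFractionRing.injective _ _)
  let V : O := PowerSeries.C U0 + PowerSeries.X
  let v' : Fin 3 → O := ![PowerSeries.C a, PowerSeries.C b', V]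
  obtain ⟨Ψ, hΨ⟩ := conj_hom (M := k) (W' := S) ![a, b, U] (fun i => algebraMap O S (v' i)) (by
    intro q
    rw [show (fun i => algebraMap O S (v' i)) = algebraMap O S ∘ v' from rfl,
      MvPolynomial.aeval_algebraMap_apply, map_eq_zero_iff _ hinj]
    constructor
    · intro h
      rw [hB.1.eq_zero_of_aeval_eq_zero _ h, map_zero]
    · intro h
      rw [hind q h, map_zero]) (by
    intro w; rw [ac_top_of_basis hB]; trivial)
  have hΨa : Ψ a = algebraMap O S (PowerSeries.C a) := hΨ 0
  have hΨb : Ψ b = algebraMap O S (PowerSeries.C b') := hΨ 1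
  have hΨU : Ψ U = algebraMap O S V := hΨ 2
  let ιO : O →ₐ[k] S := IsScalarTower.toAlgHom k O S
  let G : Fin r → Polynomial O := fun j => Gp (F j) (PowerSeries.C a) (PowerSeries.C b') V
  have hGm : ∀ j, (G j).map (algebraMap O S) = (Gp (F j) a b U).map (Ψ : W →+* S) := by
    intro j
    rw [Gp_map, hΨa, hΨb, hΨU]
    exact Gp_map (F j) _ _ _ ιO
  have hGr : ∀ j, (G j).map PowerSeries.constantCoeff = Gp (F j) a b' U0 := by
    intro j
    have := Gp_map (F j) (PowerSeries.C a) (PowerSeries.C b') V (ccHom k W)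
    rw [ccHom_apply, ccHom_apply, ccHom_apply] at this
    simp only [V, map_add, PowerSeries.constantCoeff_C, PowerSeries.constantCoeff_X, add_zero] at this
    exact this
  have hGev : ∀ j (s : S), Polynomial.aeval s (G j) = ((Gp (F j) a b U).map (Ψ : W →+* S)).eval s := by
    intro j s
    rw [← hGm, Polynomial.eval_map_algebraMap]
  have hGW : ∀ j (w : W), Polynomial.aeval (Ψ w) (G j) = 0 ↔ (Gp (F j) a b U).eval w = 0 := by
    intro j w
    rw [hGev]
    change Polynomial.eval ((Ψ : W →+* S) w) _ = 0 ↔ _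
    rw [Polynomial.eval_map, Polynomial.eval₂_hom, map_eq_zero_iff _ (RingHom.injective _)]
  have hGs : ∀ j (s : S), Polynomial.aeval s (G j) = 0 → ∃ w, Ψ w = s := by
    intro j s hs
    rw [hGev] at hs
    have hne : Gp (F j) a b U ≠ 0 := by
      intro h
      have := Gp_natDegree (hF j) (a := a) (b := b) (U_trans hB)
      rw [h, Polynomial.natDegree_zero] at this
      have := (hF j).two_le
      omega
    exact (IsAlgClosed.splits (Gp (F j) a b U)).mem_range_of_isRoot hne hs
  have hVt : ¬ IsAlgebraic k (PowerSeries.constantCoeff V) := by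
    simpa [V] using hU0t
  have hunit : ∀ j, IsUnit (G j).leadingCoeff := fun j => Gp_series_unit (hF j) hVt
  have htan : ∀ j s, ((G j).map PowerSeries.constantCoeff).eval s = 0 →
      ((G j).map PowerSeries.constantCoeff).derivative.eval s = 0 → j = i ∧ s = t := by
    intro j s h1 h2
    rw [hGr, Gp_root_iff (hF j).hom hU00] at h1
    rw [hGr, Gp_deriv_eval (hF j) hU00, mul_eq_zero, or_iff_right (pow_ne_zero _ hU00), hU0i] at h2
    rw [hU0i] at h1
    obtain ⟨e1, e2⟩ := tangent_unique (hF i) (hF j) hz hg u0 hu h1 h2 (by rw [hb']; ring)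
    refine ⟨?_, e1⟩
    by_contra hij
    apply hna i j (Ne.symm hij)
    refine gpl _ _ (hF i).irr ![t, x] (by rw [aeval_dehom]; exact hz) hg ?_
    rw [aeval_dehom, ← e1, ← e2]
    exact h1
  have hall : ∀ j, j ≠ i → ∀ z : S, Polynomial.aeval z (G j) = 0 → ∃ o : O, algebraMap O S o = z := by
    intro j hj z hz
    exact hens_all (G j) (hunit j) (fun s h1 h2 => hj (htan j s h1 h2).1) z hz
  obtain ⟨τ, s1, s2, hs12, hs1, hs2, hτ1, hτ2, hτz⟩ := hens_swap' (G i) (hunit i) (by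
      intro s hs
      obtain ⟨w, rfl⟩ := hGs i s hs
      rw [hGW] at hs
      have hs' := (Gp_root_iff (hF i).hom hU).1 hs
      have h3 := root_simple hB (hF i) hs'
      rw [← Polynomial.eval_map_algebraMap, ← Polynomial.derivative_map]
      change Polynomial.eval ((Ψ : W →+* S) w) (Polynomial.derivative ((G i).map (algebraMap O S))) ≠ 0
      rw [hGm, Polynomial.derivative_map, Polynomial.eval_map, Polynomial.eval₂_hom,
        Ne, map_eq_zero_iff _ (RingHom.injective _), Gp_deriv_eval (hF i) hU]
      exact mul_ne_zero (pow_ne_zero _ hU) h3) t (by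
      rw [hGr, Gp_root_iff (hF i).hom hU00, hxb]; exact hz) (by
      rw [hGr, Gp_deriv_eval (hF i) hU00, hxb, hU0i, hu, mul_zero]) (by
      rw [hGr, Gp_deriv2_eval (hF i) hU00, hxb, hU0i]
      refine mul_ne_zero (pow_ne_zero _ hU00) ?_
      intro h
      apply Dl_ne_zero (hF i) hz hg
      rw [Dl]
      set γ1 := aeval ![1, t, x] (pderiv 1 (F i))
      set γ2 := aeval ![1, t, x] (pderiv 2 (F i))
      have : γ1 = - (u0 * γ2) := eq_neg_of_add_eq_zero_left hu
      rw [this]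
      linear_combination γ2 ^ 2 * h) (by
      intro s hs h1 h2
      exact hs (htan i s h1 h2).2) (by
      intro o ho
      refine series_no_root (hF i) hU00 (by rw [hxb]; exact hz) (by rw [hxb, hU0i]; exact hu)
        (by rw [hxb]; exact hγ2) hta o ho)
  have hτO : ∀ o : O, τ (algebraMap O S o) = algebraMap O S o := by
    intro o
    rw [IsScalarTower.algebraMap_apply O (FractionRing (PowerSeries W)) S]
    exact τ.commutes _
  obtain ⟨σ, hσ⟩ := restrict_auto (ac_top_of_basis hB) Ψ (τ.restrictScalars k) (by
    intro l
    rw [hΨ l]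
    exact hτO _)
  have hσ' : ∀ w, Ψ (σ w) = τ (Ψ w) := hσ
  obtain ⟨t1, rfl⟩ := hGs i s1 hs1
  obtain ⟨t2, rfl⟩ := hGs i s2 hs2
  have hΨi : Function.Injective Ψ := Ψ.injective
  refine ⟨σ, ?_, ?_, t1, t2, fun h => hs12 (congrArg Ψ h), (hGW i t1).1 hs1, (hGW i t2).1 hs2,
    Ψ.injective ((hσ' _).trans hτ1), Ψ.injective ((hσ' _).trans hτ2), ?_⟩
  · intro w hw
    apply hΨi
    rw [hσ']
    let κ : W →ₐ[k] S := IsScalarTower.toAlgHom k W S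
    have hac : IsAlgClosed κ.fieldRange :=
      IsAlgClosed.of_ringEquiv W _ (AlgEquiv.ofInjectiveField κ).toRingEquiv
    have hle : IntermediateField.adjoin k (Ψ '' {a, b}) ≤ κ.fieldRange := by
      rw [IntermediateField.adjoin_le_iff]
      rintro _ ⟨w', (hw' | hw'), rfl⟩
      · exact ⟨a, by rw [hw', hΨa]; exact IsScalarTower.algebraMap_apply W O S _⟩
      · exact ⟨b', by rw [hw', hΨb]; exact IsScalarTower.algebraMap_apply W O S _⟩
    obtain ⟨c, hc⟩ := mem_range_of_alg (alg_mono hle (mem_ac.1 (ac_map Ψ hw)))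
    obtain ⟨y, hy⟩ := c.2
    have : Ψ w = algebraMap O S (algebraMap W O y) := by
      rw [← IsScalarTower.algebraMap_apply, ← hc]
      exact hy.symm
    rw [this, hτO]
  · apply hΨi
    rw [hσ', hΨU, hτO]
  · intro j z hzr h1 h2
    apply hΨi
    rw [hσ']
    by_cases hj : j = i
    · subst hj
      exact hτz _ ((hGW _ _).2 hzr) (fun h => h1 (Ψ.injective h)) (fun h => h2 (Ψ.injective h))
    · obtain ⟨o, ho⟩ := hall j hj _ ((hGW _ _).2 hzr)
      rw [← ho, hτO]
end

end

section

theorem Gp_eval_map {k R S : Type*} [Field k] [CommRing R] [Algebra k R] [CommRing S] [Algebra k S]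
    (F : MvPolynomial (Fin 3) k) (a b U t : R) (φ : R →ₐ[k] S) :
    φ ((Gp F a b U).eval t) = (Gp F (φ a) (φ b) (φ U)).eval (φ t) := by
  rw [Gp_eval, Gp_eval, aeval3_map]
  simp

theorem fst_perm_induction {r : ℕ} {d : Fin r → ℕ} (N : Subgroup (Equiv.Perm (Σ i, Fin (d i))))
    (hN : ∀ i (l l' : Fin (d i)), l ≠ l' → Equiv.swap (⟨i, l⟩ : Σ i, Fin (d i)) ⟨i, l'⟩ ∈ N)
    (π : Equiv.Perm (Σ i, Fin (d i))) (hπ : ∀ x, (π x).1 = x.1) : π ∈ N := by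
  induction hn : π.support.card using Nat.strong_induction_on generalizing π with
  | _ n ih =>
    by_cases h1 : π = 1
    · rw [h1]; exact N.one_mem
    · obtain ⟨x, hx⟩ : ∃ x, π x ≠ x := by
        by_contra hc
        push Not at hc
        exact h1 (Equiv.ext hc)
      have hs : Equiv.swap x (π x) ∈ N := by
        obtain ⟨i, l⟩ := x
        have := hπ ⟨i, l⟩
        generalize hy : π ⟨i, l⟩ = y at *
        obtain ⟨j, l'⟩ := y
        simp only at this
        subst this
        apply hN
        rintro rfl
        exact hx rfl
      have h2 := ih _ (hn ▸ Equiv.Perm.card_support_swap_mul hx) (Equiv.swap x (π x) * π) (by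
        intro y
        rw [Equiv.Perm.mul_apply]
        rw [Equiv.swap_apply_def]
        split_ifs with h3 h4
        · rw [hπ, ← h3, hπ]
        · rw [← hπ y, h4, hπ]
        · exact hπ y) rfl
      have := N.mul_mem hs h2
      rwa [← mul_assoc, Equiv.swap_mul_self, one_mul] at this

section
variable {k W : Type*} [Field k] [IsAlgClosed k] [Field W] [IsAlgClosed W] [Algebra k W]
  {a b U : W}  {r : ℕ} {F : Fin r → MvPolynomial (Fin 3) k} {d : Fin r → ℕ}

theorem enum_roots (hB : IsTranscendenceBasis k ![a, b, U]) (hF : ∀ i, SmC (F i) (d i))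
    (hna : ∀ i j, i ≠ j → ¬ dehom (F i) ∣ dehom (F j)) :
    ∃ T : (Σ i, Fin (d i)) → W, Function.Injective T ∧
      ∀ i z, (Gp (F i) a b U).eval z = 0 ↔ ∃ l, T ⟨i, l⟩ = z := by
  classical
  have hU := U_ne_zero hB
  have hne : ∀ i, Gp (F i) a b U ≠ 0 := by
    intro i h
    have := Gp_natDegree (hF i) (a := a) (b := b) (U_trans hB)
    rw [h, Polynomial.natDegree_zero] at this
    have := (hF i).two_le
    omega
  have hcard : ∀ i, (Gp (F i) a b U).roots.toFinset.card = d i := by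
    intro i
    rw [Multiset.toFinset_card_of_nodup, ← (IsAlgClosed.splits _).natDegree_eq_card_roots,
      Gp_natDegree (hF i) (U_trans hB)]
    rw [Multiset.nodup_iff_count_le_one]
    intro s
    rw [Polynomial.count_roots]
    by_contra hc
    push Not at hc
    rw [Polynomial.one_lt_rootMultiplicity_iff_isRoot (hne i)] at hc
    obtain ⟨h1, h2⟩ := hc
    have h1' := (Gp_root_iff (hF i).hom hU).1 h1
    rw [Polynomial.IsRoot, Gp_deriv_eval (hF i) hU, mul_eq_zero, or_iff_right (pow_ne_zero _ hU)] at h2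
    exact root_simple hB (hF i) h1' h2
  have e : ∀ i, ∃ e : Fin (d i) → W, Function.Injective e ∧
      ∀ z, (Gp (F i) a b U).eval z = 0 ↔ ∃ l, e l = z := by
    intro i
    let e := (Finset.equivFinOfCardEq (hcard i)).symm
    refine ⟨fun l => e l, Subtype.val_injective.comp e.injective, ?_⟩
    intro z
    have : (Gp (F i) a b U).eval z = 0 ↔ z ∈ (Gp (F i) a b U).roots.toFinset := by
      rw [Multiset.mem_toFinset, Polynomial.mem_roots (hne i), Polynomial.IsRoot]
    rw [this]
    constructor
    · intro h
      exact ⟨e.symm ⟨z, h⟩, by simp⟩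
    · rintro ⟨l, rfl⟩
      exact (e l).2
  choose e he1 he2 using e
  refine ⟨fun x => e x.1 x.2, ?_, he2⟩
  rintro ⟨i, l⟩ ⟨j, l'⟩ h
  simp only at h
  have hij : i = j := by
    by_contra hij
    apply hna i j hij
    have h1 := (Gp_root_iff (hF i).hom hU).1 ((he2 i _).2 ⟨l, rfl⟩)
    have h2 := (Gp_root_iff (hF j).hom hU).1 ((he2 j _).2 ⟨l', rfl⟩)
    rw [← h] at h2
    exact root_unique hB (hF i) h1 h2
  subst hij
  rw [he1 i h]

theorem all_perms (hB : IsTranscendenceBasis k ![a, b, U]) (hF : ∀ i, SmC (F i) (d i))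
    (hna : ∀ i j, i ≠ j → ¬ dehom (F i) ∣ dehom (F j)) (T : (Σ i, Fin (d i)) → W)
    (hT : Function.Injective T) (hT2 : ∀ i z, (Gp (F i) a b U).eval z = 0 ↔ ∃ l, T ⟨i, l⟩ = z)
    (π : Equiv.Perm (Σ i, Fin (d i))) (hπ : ∀ x, (π x).1 = x.1) :
    ∃ σ : W ≃ₐ[k] W, (∀ w ∈ ac k {a, b}, σ w = w) ∧ σ U = U ∧ ∀ x, σ (T x) = T (π x) := by
  classical
  have hU := U_ne_zero hB
  let N : Subgroup (Equiv.Perm (Σ i, Fin (d i))) :=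
    { carrier := {π | ∃ σ : W ≃ₐ[k] W, (∀ w ∈ ac k {a, b}, σ w = w) ∧ σ U = U ∧
        ∀ x, σ (T x) = T (π x)}
      one_mem' := ⟨AlgEquiv.refl, by simp, by simp, by simp⟩
      mul_mem' := by
        rintro π π' ⟨σ, h1, h2, h3⟩ ⟨σ', h1', h2', h3'⟩
        refine ⟨σ'.trans σ, ?_, ?_, ?_⟩
        · intro w hw; rw [AlgEquiv.trans_apply, h1' w hw, h1 w hw]
        · rw [AlgEquiv.trans_apply, h2', h2]
        · intro x; rw [AlgEquiv.trans_apply, h3', h3, Equiv.Perm.mul_apply]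
      inv_mem' := by
        rintro π ⟨σ, h1, h2, h3⟩
        refine ⟨σ.symm, ?_, ?_, ?_⟩
        · intro w hw; rw [AlgEquiv.symm_apply_eq, h1 w hw]
        · rw [AlgEquiv.symm_apply_eq, h2]
        · intro x; rw [AlgEquiv.symm_apply_eq, h3]; simp }
  refine fst_perm_induction N ?_ π hπ
  intro i l l' hl
  obtain ⟨σ, hσ1, hσ2, t1, t2, ht12, ht1, ht2, hs1, hs2, hs3⟩ := swap_exists hB hF hna i
  have hroot : ∀ x, (Gp (F x.1) a b U).eval (T x) = 0 := fun x => (hT2 _ _).2 ⟨x.2, rfl⟩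
  have hpres : ∀ ρ : W ≃ₐ[k] W, ρ a = a → ρ b = b → ρ U = U → ∀ j z,
      (Gp (F j) a b U).eval z = 0 → (Gp (F j) a b U).eval (ρ z) = 0 := by
    intro ρ h1 h2 h3 j z hz
    have := Gp_eval_map (F j) a b U z (ρ : W →ₐ[k] W)
    rw [hz, map_zero] at this
    simp only [AlgEquiv.coe_toAlgHom, h1, h2, h3] at this
    exact this.symm
  have hx := fun j z => Gp_root_iff (hF j).hom hU (a := a) (b := b) (t := z)
  obtain ⟨ρ1, p1, p2, p3, p4⟩ := trans_one hB (hF i) ((hx _ _).1 ht1) ((hx _ _).1 (hroot ⟨i, l⟩))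
  obtain ⟨ρ2, q1, q2, q3, q4, q5⟩ := trans_two hB (hF i)
    ((hx _ _).1 (hpres ρ1 p1 p2 p3 i _ ht2)) ((hx _ _).1 (hroot ⟨i, l'⟩))
    ((hx _ _).1 (hroot ⟨i, l⟩)) (by rw [← p4]; exact fun h => ht12 (ρ1.injective h).symm)
    (fun h => hl (by have := hT h; simpa using this.symm))
  obtain ⟨ρ, hρ⟩ : ∃ ρ, ρ = ρ1.trans ρ2 := ⟨_, rfl⟩
  have ra : ρ a = a := by rw [hρ, AlgEquiv.trans_apply, p1, q1]
  have rb : ρ b = b := by rw [hρ, AlgEquiv.trans_apply, p2, q2]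
  have rU : ρ U = U := by rw [hρ, AlgEquiv.trans_apply, p3, q3]
  have r1 : ρ t1 = T ⟨i, l⟩ := by rw [hρ, AlgEquiv.trans_apply, p4, q4]
  have r2 : ρ t2 = T ⟨i, l'⟩ := by rw [hρ, AlgEquiv.trans_apply, q5]
  have sa : ρ.symm a = a := by rw [AlgEquiv.symm_apply_eq, ra]
  have sb : ρ.symm b = b := by rw [AlgEquiv.symm_apply_eq, rb]
  have sU : ρ.symm U = U := by rw [AlgEquiv.symm_apply_eq, rU]
  refine ⟨(ρ.symm.trans σ).trans ρ, ?_, ?_, ?_⟩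
  · intro w hw
    rw [AlgEquiv.trans_apply, AlgEquiv.trans_apply, hσ1, AlgEquiv.apply_symm_apply]
    have := ac_map (ρ.symm : W →ₐ[k] W) hw
    rw [Set.image_pair] at this
    simp only [AlgEquiv.coe_toAlgHom, sa, sb] at this
    exact this
  · rw [AlgEquiv.trans_apply, AlgEquiv.trans_apply, sU, hσ2, rU]
  · intro x
    rw [AlgEquiv.trans_apply, AlgEquiv.trans_apply]
    by_cases h1 : x = ⟨i, l⟩
    · rw [h1, Equiv.swap_apply_left, ← r1, AlgEquiv.symm_apply_apply, hs1, r2]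
    by_cases h2 : x = ⟨i, l'⟩
    · rw [h2, Equiv.swap_apply_right, ← r2, AlgEquiv.symm_apply_apply, hs2, r1]
    rw [Equiv.swap_apply_of_ne_of_ne h1 h2]
    rw [hs3 x.1 _ (hpres ρ.symm sa sb sU _ _ (hroot x)) ?_ ?_, AlgEquiv.apply_symm_apply]
    · intro h
      rw [AlgEquiv.symm_apply_eq, r1] at h
      exact h1 (hT h)
    · intro h
      rw [AlgEquiv.symm_apply_eq, r2] at h
      exact h2 (hT h)
end

end

section

theorem monic_root_natDegree_le {k : Type*} [Field k] (m : Polynomial (Polynomial k)) (hm : m.Monic)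
    (e : ℕ) (he : ∀ i, (m.coeff i).natDegree ≤ e) (q : Polynomial k) (hq : m.eval q = 0) :
    q.natDegree ≤ e := by
  by_contra hlt
  push Not at hlt
  have h1 : m.eval q = q ^ m.natDegree + ∑ i ∈ Finset.range m.natDegree, m.coeff i * q ^ i := by
    rw [Polynomial.eval_eq_sum_range, Finset.sum_range_succ, hm.coeff_natDegree, one_mul, add_comm]
  have hq0 : q ≠ 0 := by rintro rfl; simp at hlt
  have h2 : (∑ i ∈ Finset.range m.natDegree, m.coeff i * q ^ i).degree < (q ^ m.natDegree).degree := by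
    rw [Polynomial.degree_eq_natDegree (pow_ne_zero _ hq0), Polynomial.natDegree_pow]
    rw [Polynomial.degree_lt_iff_coeff_zero]
    intro j hj
    rw [Polynomial.finsetSum_coeff]
    apply Finset.sum_eq_zero
    intro i hi
    apply Polynomial.coeff_eq_zero_of_natDegree_lt
    have h3 := he i
    have h4 := Polynomial.natDegree_mul_le (p := m.coeff i) (q := q ^ i)
    rw [Polynomial.natDegree_pow] at h4
    have h5 : i + 1 ≤ m.natDegree := Finset.mem_range.mp hi
    have h6 := Nat.mul_le_mul_right q.natDegree h5
    rw [add_mul, one_mul] at h6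
    omega
  rw [h1] at hq
  have h7 : q ^ m.natDegree = - ∑ i ∈ Finset.range m.natDegree, m.coeff i * q ^ i :=
    eq_neg_of_add_eq_zero_left hq
  rw [h7, Polynomial.degree_neg] at h2
  exact lt_irrefl _ h2

theorem bn_eval {R S : Type*} [CommRing R] [CommRing S] (m : Polynomial (Polynomial R)) (e : ℕ)
    (θ : R →+* S) (q : Polynomial S) (hq : q.natDegree ≤ e) :
    Polynomial.mapRingHom (MvPolynomial.eval₂Hom θ (fun l : Fin (e+1) => q.coeff l))
      ((m.map (Polynomial.mapRingHom (MvPolynomial.C : R →+* MvPolynomial (Fin (e+1)) R))).eval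
        (∑ l : Fin (e+1), Polynomial.C (X l) * Polynomial.X ^ (l : ℕ))) =
      (m.map (Polynomial.mapRingHom θ)).eval q := by
  rw [← Polynomial.eval_map_apply, Polynomial.map_map, Polynomial.mapRingHom_comp]
  have hA : (MvPolynomial.eval₂Hom θ (fun l : Fin (e+1) => q.coeff l)).comp C = θ := by
    ext x; simp
  have hB : Polynomial.mapRingHom (MvPolynomial.eval₂Hom θ (fun l : Fin (e+1) => q.coeff l))
      (∑ l : Fin (e+1), Polynomial.C (X l) * Polynomial.X ^ (l : ℕ)) = q := by
    simp only [map_sum, map_mul, map_pow, Polynomial.coe_mapRingHom, Polynomial.map_C, Polynomial.map_X,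
      eval₂Hom_X', coe_eval₂Hom, eval₂_X]
    rw [Fin.sum_univ_eq_sum_range (fun l => Polynomial.C (q.coeff l) * Polynomial.X ^ l)]
    exact (Polynomial.as_sum_range_C_mul_X_pow' _ (Nat.lt_succ_of_le hq)).symm
  rw [hA, hB]

theorem bn {R Ω k : Type*} [CommRing R] [IsDomain R] [Field Ω] [IsAlgClosed Ω] [Algebra R Ω]
    [FaithfulSMul R Ω] [Field k] (m : Polynomial (Polynomial R)) (hm : m.Monic)
    (hno : ∀ q : Polynomial Ω, (m.map (Polynomial.mapRingHom (algebraMap R Ω))).eval q ≠ 0) :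
    ∃ D : R, D ≠ 0 ∧ ∀ (θ : R →+* k), θ D ≠ 0 → ∀ q : Polynomial k,
      (m.map (Polynomial.mapRingHom θ)).eval q ≠ 0 := by
  obtain ⟨e, he⟩ : ∃ e, ∀ i, (m.coeff i).natDegree ≤ e := by
    refine ⟨m.support.sup fun i => (m.coeff i).natDegree, fun i => ?_⟩
    by_cases hi : i ∈ m.support
    · exact Finset.le_sup (f := fun i => (m.coeff i).natDegree) hi
    · rw [Polynomial.notMem_support_iff.mp hi]; simp
  obtain ⟨P, hP⟩ : ∃ P, P = (m.map (Polynomial.mapRingHom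
    (MvPolynomial.C : R →+* MvPolynomial (Fin (e+1)) R))).eval
        (∑ l : Fin (e+1), Polynomial.C (X l) * Polynomial.X ^ (l : ℕ)) := ⟨_, rfl⟩
  let I : Ideal (MvPolynomial (Fin (e+1)) R) := Ideal.span (Set.range P.coeff)
  let : Algebra (FractionRing R) Ω := FractionRing.liftAlgebra R Ω
  have : IsScalarTower R (FractionRing R) Ω := FractionRing.isScalarTower_liftAlgebra R Ω
  let : Algebra (MvPolynomial (Fin (e+1)) R) (MvPolynomial (Fin (e+1)) (FractionRing R)) :=
    MvPolynomial.algebraMvPolynomial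
  have htop : I.map (algebraMap (MvPolynomial (Fin (e+1)) R) (MvPolynomial (Fin (e+1)) (FractionRing R))) = ⊤ := by
    by_contra hne
    obtain ⟨J, hJ, hIJ⟩ := Ideal.exists_le_maximal _ hne
    obtain ⟨x, hx⟩ := eq_vanishingIdeal_singleton_of_isMaximal Ω hJ
    have hz : ∀ j, MvPolynomial.eval₂Hom (algebraMap R Ω) x (P.coeff j) = 0 := by
      intro j
      have h1 : algebraMap _ (MvPolynomial (Fin (e+1)) (FractionRing R)) (P.coeff j) ∈ J :=
        hIJ (Ideal.mem_map_of_mem _ (Ideal.subset_span ⟨j, rfl⟩))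
      rw [hx, mem_vanishingIdeal_singleton_iff] at h1
      rw [MvPolynomial.algebraMap_def, MvPolynomial.aeval_map_algebraMap] at h1
      exact h1
    obtain ⟨q, hq⟩ : ∃ q : Polynomial Ω, q = ∑ l : Fin (e+1), Polynomial.C (x l) * Polynomial.X ^ (l : ℕ) :=
      ⟨_, rfl⟩
    have hqd : q.natDegree ≤ e := by
      rw [hq]
      apply Polynomial.natDegree_sum_le_of_forall_le
      intro i _
      exact (Polynomial.natDegree_C_mul_X_pow_le _ _).trans (by omega)
    have hqc : ∀ l : Fin (e+1), q.coeff l = x l := by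
      intro l
      rw [hq, Polynomial.finsetSum_coeff]
      simp only [Polynomial.coeff_C_mul, Polynomial.coeff_X_pow]
      rw [Finset.sum_eq_single l]
      · simp
      · intro b _ hb
        rw [if_neg, mul_zero]
        intro h
        exact hb (Fin.ext h.symm)
      · simp
    apply hno q
    rw [← bn_eval m e (algebraMap R Ω) q hqd, ← hP]
    ext j
    rw [Polynomial.coe_mapRingHom, Polynomial.coeff_map, Polynomial.coeff_zero]
    rw [show (fun l : Fin (e+1) => q.coeff l) = x from funext hqc]
    exact hz j
  have h1 : (1 : MvPolynomial (Fin (e+1)) (FractionRing R)) ∈ I.map (algebraMap (MvPolynomial (Fin (e+1)) R) (MvPolynomial (Fin (e+1)) (FractionRing R))) := by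
    rw [htop]; trivial
  rw [IsLocalization.mem_map_algebraMap_iff ((nonZeroDivisors R).map (C : R →+* MvPolynomial (Fin (e+1)) R))] at h1
  obtain ⟨⟨y, s⟩, h2⟩ := h1
  obtain ⟨s, D, hD, rfl⟩ := s
  rw [one_mul] at h2
  have h3 : (C D : MvPolynomial (Fin (e+1)) R) = y := by
    rw [MvPolynomial.algebraMap_def] at h2
    exact MvPolynomial.map_injective _ (IsFractionRing.injective R (FractionRing R)) h2
  have h4 : (C D : MvPolynomial (Fin (e+1)) R) ∈ I := h3 ▸ y.2
  refine ⟨D, nonZeroDivisors.ne_zero hD, fun θ hθ q hq => hθ ?_⟩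
  have hqd : q.natDegree ≤ e := by
    refine monic_root_natDegree_le _ (hm.map _) e ?_ q hq
    intro i
    rw [Polynomial.coeff_map]
    exact Polynomial.natDegree_map_le.trans (he i)
  rw [← bn_eval m e θ q hqd, ← hP] at hq
  have h5 : I ≤ RingHom.ker (MvPolynomial.eval₂Hom θ (fun l : Fin (e+1) => q.coeff l)) := by
    rw [Ideal.span_le]
    rintro _ ⟨j, rfl⟩
    have := congrArg (fun p => Polynomial.coeff p j) hq
    simpa [RingHom.mem_ker] using this
  have := h5 h4
  simpa [RingHom.mem_ker] using this

end

section

theorem ext_spec {A B V : Type*} [CommRing A] [CommRing B] [Algebra A B]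
    [Algebra.IsIntegral A B] [FaithfulSMul A B] [Field V] [IsAlgClosed V] (φ : A →+* V) :
    ∃ π : B →+* V, ∀ x, π (algebraMap A B x) = φ x := by
  have hP : (RingHom.ker φ).IsPrime := RingHom.ker_isPrime φ
  obtain ⟨Q, -, hQ, hQP⟩ := Ideal.exists_ideal_over_prime_of_isIntegral (S := B) (RingHom.ker φ) ⊥ (by
    intro x hx
    rw [Ideal.mem_comap, Ideal.mem_bot] at hx
    have : x = 0 := FaithfulSMul.algebraMap_injective A B (by rw [hx, map_zero])
    rw [this]; exact Ideal.zero_mem _)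
  have : Q.LiesOver (RingHom.ker φ) := ⟨hQP.symm⟩
  let i1 : Algebra (A ⧸ RingHom.ker φ) V := (RingHom.kerLift φ).toAlgebra
  have : FaithfulSMul (A ⧸ RingHom.ker φ) V :=
    (faithfulSMul_iff_algebraMap_injective _ _).2 (RingHom.kerLift_injective φ)
  have : FaithfulSMul (A ⧸ RingHom.ker φ) (B ⧸ Q) := inferInstance
  have : Algebra.IsIntegral (A ⧸ RingHom.ker φ) (B ⧸ Q) := inferInstance
  have : Algebra.IsAlgebraic (A ⧸ RingHom.ker φ) (B ⧸ Q) := inferInstance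
  have : Module.IsTorsionFree (A ⧸ RingHom.ker φ) (B ⧸ Q) :=
    Module.isTorsionFree_iff_faithfulSMul.2 inferInstance
  have : Module.IsTorsionFree (A ⧸ RingHom.ker φ) V :=
    Module.isTorsionFree_iff_faithfulSMul.2 inferInstance
  let f : (B ⧸ Q) →ₐ[A ⧸ RingHom.ker φ] V := IsAlgClosed.lift
  refine ⟨f.toRingHom.comp (Ideal.Quotient.mk Q), fun x => ?_⟩
  have h1 := f.commutes (Ideal.Quotient.mk _ x)
  exact h1

/-- resolvent product -/
noncomputable def eRes {ι k V : Type*} [Fintype ι] [DecidableEq ι] [Field k] [CommRing V] [Algebra k V]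
    (H : Subgroup (Equiv.Perm ι)) [Fintype H] (p : Option ι → k) (t : ι → V) : V :=
  ∏ h : H, (algebraMap k V (p none) - ∑ x, algebraMap k V (p (some x)) * t (h.1 x))

theorem eRes_mul {ι k V : Type*} [Fintype ι] [DecidableEq ι] [Field k] [CommRing V] [Algebra k V]
    (H : Subgroup (Equiv.Perm ι)) [Fintype H] (p : Option ι → k) (t : ι → V) (g : Equiv.Perm ι)
    (hg : g ∈ H) : eRes H p (fun x => t (g x)) = eRes H p t := by
  unfold eRes
  exact Fintype.prod_equiv (Equiv.mulLeft (⟨g, hg⟩ : H)) _ _ (fun h => by simp)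

theorem eRes_map {ι k V V' : Type*} [Fintype ι] [DecidableEq ι] [Field k] [CommRing V] [Algebra k V]
    [CommRing V'] [Algebra k V']
    (H : Subgroup (Equiv.Perm ι)) [Fintype H] (p : Option ι → k) (t : ι → V) (f : V →ₐ[k] V') :
    f (eRes H p t) = eRes H p (fun x => f (t x)) := by
  simp [eRes, map_prod]

theorem eRes_exists {ι k W : Type*} [Fintype ι] [DecidableEq ι] [Field k] [Infinite k] [Field W]
    [Algebra k W] (H : Subgroup (Equiv.Perm ι)) [Fintype H] (t : ι → W) (ht : Function.Injective t) :
    ∃ p : Option ι → k, ∀ σ : Equiv.Perm ι, σ ∉ H →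
      eRes H p (fun x => t (σ x)) ≠ eRes H p t := by
  classical
  let E : (ι → W) → MvPolynomial (Option ι) W := fun t => ∏ h : H, (X none - ∑ x, C (t (h.1 x)) * X (some x))
  have hE : ∀ σ, σ ∉ H → E (fun x => t (σ x)) - E t ≠ 0 := by
    intro σ hσ h0
    let ev : MvPolynomial (Option ι) W →ₐ[W] MvPolynomial ι W :=
      aeval (fun o => o.elim (∑ x, C (t (σ x)) * X x) X)
    have h1 := congrArg ev h0
    rw [map_sub, map_zero] at h1
    have h2 : ev (E (fun x => t (σ x))) = 0 := by
      simp only [E, map_prod]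
      apply Finset.prod_eq_zero (Finset.mem_univ (1 : H))
      simp [ev, MvPolynomial.algHom_C]
    rw [h2, zero_sub, neg_eq_zero] at h1
    simp only [E, map_prod, Finset.prod_eq_zero_iff] at h1
    obtain ⟨h, -, h3⟩ := h1
    apply hσ
    have : σ = h.1 := by
      ext x
      apply ht
      have h4 := congrArg (coeff (Finsupp.single x 1)) h3
      simp [ev, MvPolynomial.algHom_C, coeff_sum, coeff_C_mul, coeff_X, Finsupp.single_left_inj] at h4
      rw [sub_eq_zero] at h4
      simpa using h4
    rw [this]; exact h.2
  obtain ⟨x, hx⟩ : ∃ p : Option ι → k, eval (fun o => algebraMap k W (p o))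
      (∏ σ : {σ : Equiv.Perm ι // σ ∉ H}, (E (fun x => t (σ.1 x)) - E t)) ≠ 0 := by
    by_contra hc
    push Not at hc
    have : (∏ σ : {σ : Equiv.Perm ι // σ ∉ H}, (E (fun x => t (σ.1 x)) - E t)) ≠ 0 :=
      Finset.prod_ne_zero_iff.2 (fun σ _ => hE σ.1 σ.2)
    apply this
    apply MvPolynomial.funext_set (fun _ => Set.range (algebraMap k W))
      (fun _ => Set.infinite_range_of_injective (algebraMap k W).injective)
    intro x hx
    choose p hp using fun i => hx i trivial
    rw [map_zero, ← hc p]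
    congr 2
    ext i
    exact (hp i).symm
  refine ⟨x, fun σ hσ h => hx ?_⟩
  rw [map_prod]
  apply Finset.prod_eq_zero (Finset.mem_univ ⟨σ, hσ⟩)
  rw [map_sub, sub_eq_zero]
  simpa [E, eRes, map_prod, mul_comm] using h

end

section

theorem bn' {R Ω k : Type*} [CommRing R] [IsDomain R] [Field Ω] [IsAlgClosed Ω] (ρ : R →+* Ω)
    (hρ : Function.Injective ρ) [Field k] (m : Polynomial (Polynomial R)) (hm : m.Monic)
    (hno : ∀ q : Polynomial Ω, (m.map (Polynomial.mapRingHom ρ)).eval q ≠ 0) :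
    ∃ D : R, D ≠ 0 ∧ ∀ (θ : R →+* k), θ D ≠ 0 → ∀ q : Polynomial k,
      (m.map (Polynomial.mapRingHom θ)).eval q ≠ 0 := by
  let : Algebra R Ω := ρ.toAlgebra
  have : FaithfulSMul R Ω := (faithfulSMul_iff_algebraMap_injective _ _).2 hρ
  exact bn (Ω := Ω) m hm hno

theorem ac_isAlgClosed {k W : Type*} [Field k] [Field W] [Algebra k W] [IsAlgClosed W] (S : Set W) :
    IsAlgClosed (ac k S) := by
  apply IsAlgClosed.of_exists_root
  intro p hp hpi
  obtain ⟨x, hx⟩ := IsAlgClosed.exists_aeval_eq_zero W p (by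
    rw [Polynomial.degree_eq_natDegree hpi.ne_zero]
    exact_mod_cast hpi.natDegree_pos.ne')
  have h1 : x ∈ ac k S := mem_ac_of_alg ⟨p, hpi.ne_zero, hx⟩
  refine ⟨⟨x, h1⟩, ?_⟩
  have h2 : Polynomial.aeval (algebraMap (ac k S) W ⟨x, h1⟩) p = 0 := hx
  rw [Polynomial.aeval_algebraMap_apply] at h2
  exact (algebraMap (ac k S) W).injective (by rw [map_zero]; exact h2)

section
variable {k W : Type*} [Field k] [Field W] [Algebra k W]
  [Algebra (Polynomial (MvPolynomial (Fin 2) k)) W]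
  [IsScalarTower k (Polynomial (MvPolynomial (Fin 2) k)) W]

theorem C_mem_ac (x : MvPolynomial (Fin 2) k) :
    algebraMap (Polynomial (MvPolynomial (Fin 2) k)) W (Polynomial.C x) ∈
      ac k ({algebraMap (Polynomial (MvPolynomial (Fin 2) k)) W (Polynomial.C (X 0)),
      algebraMap (Polynomial (MvPolynomial (Fin 2) k)) W (Polynomial.C (X 1))} : Set W) := by
  induction x using MvPolynomial.induction_on with
  | C c =>
    have : algebraMap (Polynomial (MvPolynomial (Fin 2) k)) W (Polynomial.C (C c)) = algebraMap k W c := by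
      rw [IsScalarTower.algebraMap_apply k (Polynomial (MvPolynomial (Fin 2) k)) W]; rfl
    rw [this]; exact IntermediateField.algebraMap_mem _ _
  | add p q hp hq => rw [map_add, map_add]; exact add_mem hp hq
  | mul_X p i hp =>
    rw [map_mul, map_mul]
    refine mul_mem hp (subset_ac _ ?_)
    fin_cases i <;> simp

variable [FaithfulSMul (Polynomial (MvPolynomial (Fin 2) k)) W]

theorem gen_basis [Algebra.IsAlgebraic (Polynomial (MvPolynomial (Fin 2) k)) W] :
    IsTranscendenceBasis k (![algebraMap (Polynomial (MvPolynomial (Fin 2) k)) W (Polynomial.C (X 0)),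
      algebraMap (Polynomial (MvPolynomial (Fin 2) k)) W (Polynomial.C (X 1)),
      algebraMap (Polynomial (MvPolynomial (Fin 2) k)) W Polynomial.X] : Fin 3 → W) := by
  obtain ⟨v, hv⟩ : ∃ v : Fin 3 → W, v = ![algebraMap (Polynomial (MvPolynomial (Fin 2) k)) W Polynomial.X,
      algebraMap (Polynomial (MvPolynomial (Fin 2) k)) W (Polynomial.C (X 0)),
      algebraMap (Polynomial (MvPolynomial (Fin 2) k)) W (Polynomial.C (X 1))] := ⟨_, rfl⟩
  have h1 : ∀ y : MvPolynomial (Fin 3) k, aeval v y =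
      algebraMap (Polynomial (MvPolynomial (Fin 2) k)) W (finSuccEquiv k 2 y) := by
    intro y
    have : (aeval v : MvPolynomial (Fin 3) k →ₐ[k] W) =
        (IsScalarTower.toAlgHom k (Polynomial (MvPolynomial (Fin 2) k)) W).comp
          (finSuccEquiv k 2 : MvPolynomial (Fin 3) k →ₐ[k] Polynomial (MvPolynomial (Fin 2) k)) := by
      apply MvPolynomial.algHom_ext
      intro i
      rw [hv]
      fin_cases i
      · have := finSuccEquiv_X_zero (R := k) (n := 2)
        simp at this ⊢
        rw [this]
      · have := finSuccEquiv_X_succ (R := k) (n := 2) (j := 0)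
        simp at this ⊢
        rw [this]
      · have := finSuccEquiv_X_succ (R := k) (n := 2) (j := 1)
        simp at this ⊢
        rw [this]
    rw [this]; rfl
  have hind : AlgebraicIndependent k v := by
    rw [algebraicIndependent_iff_injective_aeval]
    intro x y hxy
    rw [h1, h1] at hxy
    exact (finSuccEquiv k 2).injective (FaithfulSMul.algebraMap_injective _ _ hxy)
  have hB : IsTranscendenceBasis k v := by
    rw [hind.isTranscendenceBasis_iff_isAlgebraic]
    constructor
    intro w
    have hmem : ∀ x, (IsScalarTower.toAlgHom k (Polynomial (MvPolynomial (Fin 2) k)) W) x ∈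
        Algebra.adjoin k (Set.range v) := by
      intro x
      rw [Algebra.adjoin_range_eq_range_aeval]
      refine ⟨(finSuccEquiv k 2).symm x, ?_⟩
      rw [AlgHom.toRingHom_eq_coe, RingHom.coe_coe, h1]
      simp
    obtain ⟨p, hp0, hp⟩ := Algebra.IsAlgebraic.isAlgebraic
      (R := Polynomial (MvPolynomial (Fin 2) k)) w
    let g := ((IsScalarTower.toAlgHom k (Polynomial (MvPolynomial (Fin 2) k)) W).codRestrict _ hmem).toRingHom
    have hg : Function.Injective g := by
      intro x y hxy
      have := congrArg Subtype.val hxy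
      exact FaithfulSMul.algebraMap_injective _ _ this
    refine ⟨p.map g, (Polynomial.map_ne_zero_iff hg).2 hp0, ?_⟩
    rw [Polynomial.aeval_def, Polynomial.eval₂_map]
    exact hp
  have := hB.comp_equiv (Equiv.ofBijective (![1, 2, 0] : Fin 3 → Fin 3) (by decide))
  convert this using 1
  ext i
  rw [hv]
  fin_cases i <;> rfl

/-- inclusion of coefficient ring in the algebraic closure of `k(a,b)` -/
noncomputable def rhoAc (k W : Type*) [Field k] [Field W] [Algebra k W]
  [Algebra (Polynomial (MvPolynomial (Fin 2) k)) W]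
  [IsScalarTower k (Polynomial (MvPolynomial (Fin 2) k)) W] : MvPolynomial (Fin 2) k →+*
    ac k ({algebraMap (Polynomial (MvPolynomial (Fin 2) k)) W (Polynomial.C (X 0)),
      algebraMap (Polynomial (MvPolynomial (Fin 2) k)) W (Polynomial.C (X 1))} : Set W) :=
  ((algebraMap (Polynomial (MvPolynomial (Fin 2) k)) W).comp Polynomial.C).codRestrict _ C_mem_ac

theorem rhoAc_inj : Function.Injective (rhoAc k W) := by
  intro x y hxy
  have := congrArg Subtype.val hxy
  exact Polynomial.C_injective (FaithfulSMul.algebraMap_injective _ _ this)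

theorem no_root [Algebra.IsAlgebraic (Polynomial (MvPolynomial (Fin 2) k)) W] [IsAlgClosed W]
    (e : W) (he : IsIntegral (Polynomial (MvPolynomial (Fin 2) k)) e) (τ : W ≃ₐ[k] W)
    (h1 : ∀ w ∈ ac k ({algebraMap (Polynomial (MvPolynomial (Fin 2) k)) W (Polynomial.C (X 0)),
      algebraMap (Polynomial (MvPolynomial (Fin 2) k)) W (Polynomial.C (X 1))} : Set W), τ w = w)
    (h2 : τ (algebraMap (Polynomial (MvPolynomial (Fin 2) k)) W Polynomial.X) =
      algebraMap (Polynomial (MvPolynomial (Fin 2) k)) W Polynomial.X) (h3 : τ e ≠ e)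
    (q : Polynomial (ac k ({algebraMap (Polynomial (MvPolynomial (Fin 2) k)) W (Polynomial.C (X 0)),
      algebraMap (Polynomial (MvPolynomial (Fin 2) k)) W (Polynomial.C (X 1))} : Set W)))
     : ((minpoly (Polynomial (MvPolynomial (Fin 2) k)) e).map
        (Polynomial.mapRingHom (rhoAc k W))).eval q ≠ 0 := by
  intro hq
  obtain ⟨w, hw⟩ : ∃ w, w = Polynomial.aeval (algebraMap (Polynomial (MvPolynomial (Fin 2) k)) W Polynomial.X) q := ⟨_, rfl⟩
  have hw0 : Polynomial.aeval w (minpoly (Polynomial (MvPolynomial (Fin 2) k)) e) = 0 := by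
    have h4 := congrArg (Polynomial.aeval (algebraMap (Polynomial (MvPolynomial (Fin 2) k)) W Polynomial.X)) hq
    rw [map_zero] at h4
    have h4' := Polynomial.eval_map_apply (p := (Polynomial.map (Polynomial.mapRingHom (rhoAc k W))
      (minpoly (Polynomial (MvPolynomial (Fin 2) k)) e))) (f := (Polynomial.aeval (R :=
        ac k ({algebraMap (Polynomial (MvPolynomial (Fin 2) k)) W (Polynomial.C (X 0)),
      algebraMap (Polynomial (MvPolynomial (Fin 2) k)) W (Polynomial.C (X 1))} : Set W))
      (algebraMap (Polynomial (MvPolynomial (Fin 2) k)) W Polynomial.X)).toRingHom) (x := q)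
    refine Eq.trans ?_ (h4'.trans h4)
    rw [Polynomial.map_map, Polynomial.aeval_def, ← Polynomial.eval_map, hw]
    congr 2
    · apply Polynomial.ringHom_ext
      · intro x
        simp [rhoAc]
      · simp
  let : Algebra (FractionRing (Polynomial (MvPolynomial (Fin 2) k))) W :=
    FractionRing.liftAlgebra _ _
  have : IsScalarTower (Polynomial (MvPolynomial (Fin 2) k)) (FractionRing (Polynomial (MvPolynomial (Fin 2) k))) W :=
    FractionRing.isScalarTower_liftAlgebra _ _
  have : Algebra.IsAlgebraic (FractionRing (Polynomial (MvPolynomial (Fin 2) k))) W :=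
    ⟨fun x => (Algebra.IsAlgebraic.isAlgebraic (R := (Polynomial (MvPolynomial (Fin 2) k))) x).extendScalars
      (IsFractionRing.injective _ _)⟩
  have : Normal (FractionRing (Polynomial (MvPolynomial (Fin 2) k))) W :=
    have : IsAlgClosure (FractionRing (Polynomial (MvPolynomial (Fin 2) k))) W := ⟨inferInstance, inferInstance⟩
    IsAlgClosure.normal _ _
  obtain ⟨σ, hσ⟩ := minpoly.exists_algEquiv_of_root'
    (K := FractionRing (Polynomial (MvPolynomial (Fin 2) k))) (x := w) (y := e)
    (Algebra.IsAlgebraic.isAlgebraic _) (by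
      rw [minpoly.isIntegrallyClosed_eq_field_fractions' _ he, Polynomial.aeval_map_algebraMap]
      exact hw0)
  have hσA : ∀ x, σ (algebraMap (Polynomial (MvPolynomial (Fin 2) k)) W x) = algebraMap _ W x := by
    intro x
    rw [IsScalarTower.algebraMap_apply _ (FractionRing (Polynomial (MvPolynomial (Fin 2) k))) W, σ.commutes]
  have hσA' : ∀ x, σ.symm (algebraMap (Polynomial (MvPolynomial (Fin 2) k)) W x) = algebraMap _ W x := by
    intro x
    rw [AlgEquiv.symm_apply_eq, hσA]
  have hσk : ∀ x, σ.symm (algebraMap k W x) = algebraMap k W x := by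
    intro x
    rw [IsScalarTower.algebraMap_apply k (Polynomial (MvPolynomial (Fin 2) k)) W, hσA']
  let σs : W →ₐ[k] W := { (σ.symm : W →+* W) with commutes' := hσk }
  -- conjugate fixes w
  have h5 : σ (τ (σ.symm w)) = w := by
    have h6 : ∀ z ∈ ac k ({algebraMap (Polynomial (MvPolynomial (Fin 2) k)) W (Polynomial.C (X 0)),
      algebraMap (Polynomial (MvPolynomial (Fin 2) k)) W (Polynomial.C (X 1))} : Set W), σ (τ (σ.symm z)) = z := by
      intro z hz
      have h7 := ac_map σs hz
      rw [Set.image_pair] at h7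
      have h8 : ∀ x, σs (algebraMap (Polynomial (MvPolynomial (Fin 2) k)) W x) = algebraMap _ W x := hσA'
      rw [h8, h8] at h7
      have h9 := h1 _ h7
      have h10 : σs z = σ.symm z := rfl
      rw [h10] at h9
      rw [h9, AlgEquiv.apply_symm_apply]
    rw [hw, Polynomial.aeval_def, Polynomial.eval₂_eq_sum_range]
    simp only [map_sum, map_mul, map_pow, hσA', h2, hσA]
    apply Finset.sum_congr rfl
    intro i _
    congr 1
    exact h6 _ (q.coeff i).2
  apply h3
  rw [← hσ] at h5
  rw [AlgEquiv.symm_apply_apply] at h5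
  exact σ.injective h5

end

end

section

theorem gp_scaled {k R : Type*} [Field k] [CommRing R] [Algebra k R]
    {F : MvPolynomial (Fin 3) k} {d : ℕ} (h : F.IsHomogeneous d) (L a b U s : R) :
    aeval ![L * U, U * (L * s), L * a + L * s + L * b * U] F = L ^ d * (Gp F a b U).eval s := by
  rw [Gp_eval, ← hom_scale h]
  rw [show U * (L * s) = L * (U * s) by ring, show L * a + L * s + L * b * U = L * (a + s + b * U) by ring]

theorem aeval_transfer {k B W V : Type*} [Field k] [CommRing B] [Algebra k B] [CommRing W] [Algebra k W]
    [CommRing V] [Algebra k V] (F : MvPolynomial (Fin 3) k) (f : B →ₐ[k] W) (g : B →ₐ[k] V)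
    (hf : Function.Injective f) (L a b u t : B)
    (h : aeval ![f L * f u, f u * f t, f L * f a + f t + f L * f b * f u] F = 0) :
    aeval ![g L * g u, g u * g t, g L * g a + g t + g L * g b * g u] F = 0 := by
  have h1 : aeval ![L * u, u * t, L * a + t + L * b * u] F = 0 := by
    apply hf
    rw [map_zero, aeval3_map, ← h]
    simp only [map_mul, map_add]
  have h4 := congrArg g h1
  rw [aeval3_map, map_zero] at h4
  simpa only [map_mul, map_add] using h4

theorem roots_of_inj {k V : Type*} [Field k] [Field V] [Algebra k V] {F : MvPolynomial (Fin 3) k} {d : ℕ}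
    (hF : SmC F d) {a b U : V} (hU : ¬ IsAlgebraic k U) (s : Fin d → V) (hs : Function.Injective s)
    (h : ∀ l, (Gp F a b U).eval (s l) = 0) (z : V) : (Gp F a b U).eval z = 0 ↔ ∃ l, s l = z := by
  classical
  constructor
  · intro hz
    have hdeg := Gp_natDegree hF (a := a) (b := b) hU
    have hne : Gp F a b U ≠ 0 := by
      intro h0
      rw [h0, Polynomial.natDegree_zero] at hdeg
      have := hF.two_le
      omega
    have h1 : (Finset.univ.image s) ⊆ (Gp F a b U).roots.toFinset := by
      intro y hy
      obtain ⟨l, -, rfl⟩ := Finset.mem_image.1 hy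
      rw [Multiset.mem_toFinset, Polynomial.mem_roots hne]
      exact h l
    have h2 : (Gp F a b U).roots.toFinset.card ≤ (Finset.univ.image s).card := by
      rw [Finset.card_image_of_injective _ hs, Finset.card_univ, Fintype.card_fin, ← hdeg]
      exact (Multiset.toFinset_card_le _).trans (Polynomial.card_roots' _)
    have h3 := Finset.eq_of_subset_of_card_le h1 h2
    have h4 : z ∈ Finset.univ.image s := by
      rw [h3, Multiset.mem_toFinset, Polynomial.mem_roots hne]
      exact hz
    obtain ⟨l, -, hl⟩ := Finset.mem_image.1 h4
    exact ⟨l, hl⟩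
  · rintro ⟨l, rfl⟩
    exact h l

section
variable {k V : Type*} [Field k] [IsAlgClosed k] [Field V] [IsAlgClosed V] [Algebra k V]
  [Algebra (Polynomial k) V] [IsScalarTower k (Polynomial k) V] [FaithfulSMul (Polynomial k) V]
  {r : ℕ} {F : Fin r → MvPolynomial (Fin 3) k} {d : Fin r → ℕ}

open Classical in
theorem spec_gen_aux (W : Type*)
  [Field W] [Algebra k W] [Algebra (Polynomial (MvPolynomial (Fin 2) k)) W]
  [IsScalarTower k (Polynomial (MvPolynomial (Fin 2) k)) W]
  [FaithfulSMul (Polynomial (MvPolynomial (Fin 2) k)) W]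
  [Algebra.IsAlgebraic (Polynomial (MvPolynomial (Fin 2) k)) W] [IsAlgClosed W]
  (hF : ∀ i, SmC (F i) (d i))
    (hna : ∀ i j, i ≠ j → ¬ dehom (F i) ∣ dehom (F j)) (S : Set k) (hS : S.Infinite) :
    ∃ α ∈ S, ∃ β ∈ S, ∃ s : (Σ i, Fin (d i)) → V, Function.Injective s ∧
      (∀ i z, (Gp (F i) (algebraMap k V α) (algebraMap k V β)
        (algebraMap (Polynomial k) V Polynomial.X)).eval z = 0 ↔ ∃ l, s ⟨i, l⟩ = z) ∧
      ∃ L : Polynomial k, ∀ H : Subgroup (Equiv.Perm (Σ i, Fin (d i))),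
        (∃ g, (∀ x, (g x).1 = x.1) ∧ g ∉ H) → ∃ p : Option (Σ i, Fin (d i)) → k,
          IsIntegral (Polynomial k) (eRes H p (fun x => algebraMap _ V L * s x)) ∧
          ∀ q : Polynomial k, eRes H p (fun x => algebraMap _ V L * s x) ≠ algebraMap _ V q := by
  have hB := gen_basis (k := k) (W := W)
  obtain ⟨T, hTi, hT2⟩ := enum_roots hB hF hna
  have hU := U_trans hB
  let A := Polynomial (MvPolynomial (Fin 2) k)
  let a : A := Polynomial.C (X 0)
  let b : A := Polynomial.C (X 1)
  let u : A := Polynomial.X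
  let iA : A →ₐ[k] W := IsScalarTower.toAlgHom k A W
  have iA_inj : Function.Injective iA := FaithfulSMul.algebraMap_injective A W
  let lam : Fin r → A := fun i => aeval ![0, u, 1] (F i)
  have hlam : ∀ i, lam i ≠ 0 := by
    intro i h0
    apply lead_ne (hF i) hU
    have h1 : iA (lam i) = aeval ![0, iA u, 1] (F i) := by
      simp only [lam]
      rw [aeval3_map]; simp
    rw [h0, map_zero] at h1
    exact h1.symm
  let L0 : A := ∏ i, lam i
  have hL0 : L0 ≠ 0 := Finset.prod_ne_zero_iff.2 fun i _ => hlam i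
  have hTint : ∀ x, IsIntegral A (iA L0 * T x) := by
    rintro ⟨i, l⟩
    have h1 : (Gp (F i) (iA a) (iA b) (iA u)).eval (T ⟨i, l⟩) = 0 := (hT2 i _).2 ⟨l, rfl⟩
    have h2 : (Gp (F i) a b u).leadingCoeff = lam i := by
      have h3 := Gp_coeff (hF i).hom a b u
      have h4 : (Gp (F i) a b u).natDegree = d i := by
        apply le_antisymm (Gp_natDegree_le (hF i).hom _ _ _)
        apply Polynomial.le_natDegree_of_ne_zero
        rw [h3]; exact hlam i
      rw [Polynomial.leadingCoeff, h4, h3]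
    have h5 : IsIntegral A (iA (lam i) * T ⟨i, l⟩) := by
      rw [← h2]
      apply RingHom.isIntegralElem_leadingCoeff_mul (algebraMap A W)
      rw [← Polynomial.eval_map]
      have h6 := Gp_map (F i) a b u iA
      rw [← h1, ← h6]
      rfl
    have h7 : iA L0 * T ⟨i, l⟩ = iA (∏ j ∈ Finset.univ.erase i, lam j) * (iA (lam i) * T ⟨i, l⟩) := by
      simp only [L0]
      rw [← Finset.mul_prod_erase _ _ (Finset.mem_univ i), map_mul]
      ring
    rw [h7]
    exact IsIntegral.mul isIntegral_algebraMap h5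
  let B := integralClosure A W
  let t : (Σ i, Fin (d i)) → B := fun x => ⟨iA L0 * T x, hTint x⟩
  have hL0W : iA L0 ≠ 0 := (map_ne_zero_iff _ iA_inj).2 hL0
  have hti : Function.Injective t := by
    intro x y hxy
    have := congrArg Subtype.val hxy
    exact hTi (mul_left_cancel₀ hL0W this)
  let bW : B →ₐ[k] W := B.val.restrictScalars k
  have hbW : ∀ x, bW (t x) = iA L0 * T x := fun x => rfl
  have hpe : ∀ H : Subgroup (Equiv.Perm (Σ i, Fin (d i))), ∃ p : Option (Σ i, Fin (d i)) → k,
      ∀ σ, σ ∉ H → eRes H p (fun x => bW (t (σ x))) ≠ eRes H p (fun x => bW (t x)) := by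
    intro H
    refine eRes_exists H (fun x => bW (t x)) ?_
    intro x y hxy
    exact hti (Subtype.ext hxy)
  choose p hp using hpe
  let e : Subgroup (Equiv.Perm (Σ i, Fin (d i))) → B := fun H => eRes H (p H) t
  have heW : ∀ H, bW (e H) = eRes H (p H) (fun x => bW (t x)) := fun H => eRes_map H (p H) t bW
  let HH := {H : Subgroup (Equiv.Perm (Σ i, Fin (d i))) // ∃ g, (∀ x, (g x).1 = x.1) ∧ g ∉ H}
  have : Fintype HH := Fintype.ofFinite _
  let m : Polynomial A := ∏ H : HH, minpoly A (bW (e H.1))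
  have hIntg : ∀ H, IsIntegral A (bW (e H)) := fun H => (e H).2
  have hm : m.Monic := Polynomial.monic_prod_of_monic _ _ fun H _ => minpoly.monic (hIntg _)
  have hΩ := ac_isAlgClosed (k := k) (W := W) {algebraMap (Polynomial (MvPolynomial (Fin 2) k)) W (Polynomial.C (X 0)),
      algebraMap (Polynomial (MvPolynomial (Fin 2) k)) W (Polynomial.C (X 1))}
  obtain ⟨D', hD', hD'2⟩ := bn' (k := k) (rhoAc k W) rhoAc_inj m hm (by
    intro q hq
    simp only [m, Polynomial.map_prod, Polynomial.eval_prod, Finset.prod_eq_zero_iff] at hq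
    obtain ⟨⟨H, g, hg1, hg2⟩, -, hq⟩ := hq
    obtain ⟨τ, hτ1, hτ2, hτ3⟩ := all_perms hB hF hna T hTi hT2 g hg1
    refine no_root _ (hIntg H) τ hτ1 hτ2 ?_ q hq
    rw [heW, ← AlgEquiv.coe_toAlgHom, eRes_map]
    convert hp H g hg2 using 3 with x
    rw [AlgEquiv.coe_toAlgHom, hbW, hbW, map_mul, hτ3]
    congr 1
    simp only [L0, map_prod]
    apply Finset.prod_congr rfl
    intro i _
    simp only [lam]
    have hτ2' : τ (iA u) = iA u := hτ2
    rw [aeval3_map, map_zero, map_one, ← AlgEquiv.coe_toAlgHom, aeval3_map, AlgEquiv.coe_toAlgHom,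
      map_zero, map_one, hτ2'])
  -- discriminant
  let δ : B := ∏ x : {x : (Σ i, Fin (d i)) × (Σ i, Fin (d i)) // x.1 ≠ x.2}, (t x.1.1 - t x.1.2)
  have hδ : δ ≠ 0 := Finset.prod_ne_zero_iff.2 fun x _ => sub_ne_zero.2 fun h => x.2 (hti h)
  have hc := Ideal.comap_ne_bot_of_integral_mem (R := A) (I := Ideal.span {δ}) hδ
    (Ideal.subset_span rfl) (Algebra.IsIntegral.isIntegral δ)
  obtain ⟨c0, hc0, hc0'⟩ := Submodule.exists_mem_ne_zero_of_ne_bot hc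
  rw [Ideal.mem_comap, Ideal.mem_span_singleton] at hc0
  obtain ⟨y, hy⟩ := hc0
  have hD : (c0 * L0).leadingCoeff * D' ≠ 0 :=
    mul_ne_zero (Polynomial.leadingCoeff_ne_zero.2 (mul_ne_zero hc0' hL0)) hD'
  obtain ⟨x, hxS, hx⟩ : ∃ x : Fin 2 → k, (∀ i, x i ∈ S) ∧ eval x ((c0 * L0).leadingCoeff * D') ≠ 0 := by
    by_contra hcon
    push Not at hcon
    apply hD
    apply MvPolynomial.funext_set (fun _ => S) (fun _ => hS)
    intro x hx
    rw [map_zero]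
    exact hcon x fun i => hx i trivial
  rw [map_mul] at hx
  let sp : A →+* Polynomial k := Polynomial.mapRingHom (eval x)
  have hspC : ∀ z, sp (Polynomial.C z) = Polynomial.C (eval x z) := fun z => Polynomial.map_C _
  have hspX : sp Polynomial.X = Polynomial.X := Polynomial.map_X _
  have hspc : sp (c0 * L0) ≠ 0 := by
    intro h0
    have := congrArg (fun p => Polynomial.coeff p (c0 * L0).natDegree) h0
    have h1 : (sp (c0 * L0)).coeff (c0 * L0).natDegree = eval x (c0 * L0).leadingCoeff :=
      Polynomial.coeff_map _ _
    simp only [h1, Polynomial.coeff_zero] at this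
    exact left_ne_zero_of_mul hx this
  rw [map_mul] at hspc
  let φ : A →+* V := (algebraMap (Polynomial k) V).comp sp
  have hφ0 : ∀ z, sp z ≠ 0 → φ z ≠ 0 := fun z hz h => hz (FaithfulSMul.algebraMap_injective (Polynomial k) V (by
    rw [map_zero]; exact h))
  have : FaithfulSMul A B := (faithfulSMul_iff_algebraMap_injective A B).2 (by
    intro x y hxy
    exact iA_inj (congrArg Subtype.val hxy))
  obtain ⟨π, hπ⟩ := ext_spec (B := B) φ
  have hπk : ∀ c, π (algebraMap k B c) = algebraMap k V c := by
    intro c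
    rw [IsScalarTower.algebraMap_apply k A B, hπ, IsScalarTower.algebraMap_apply k (Polynomial k) V]
    have : sp (algebraMap k A c) = algebraMap k (Polynomial k) c := by
      have h1 : algebraMap k A c = Polynomial.C (C c) := rfl
      rw [h1, hspC, eval_C]
      rfl
    simp only [φ, RingHom.comp_apply]
    rw [this]
  let πk : B →ₐ[k] V := { π with commutes' := hπk }
  have hπ' : ∀ z, πk z = π z := fun z => rfl
  have hφL : φ L0 ≠ 0 := hφ0 _ (right_ne_zero_of_mul hspc)
  let s : (Σ i, Fin (d i)) → V := fun z => π (t z) / φ L0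
  have hs : ∀ z, φ L0 * s z = π (t z) := fun z => mul_div_cancel₀ _ hφL
  have hsi : Function.Injective s := by
    intro z w hzw
    by_contra hne
    have h1 : π δ ≠ 0 := by
      have h2 := congrArg π hy
      rw [map_mul, hπ] at h2
      apply left_ne_zero_of_mul (b := π y)
      rw [← h2]
      exact hφ0 _ (left_ne_zero_of_mul hspc)
    apply h1
    simp only [δ, map_prod]
    apply Finset.prod_eq_zero (Finset.mem_univ ⟨(z, w), hne⟩)
    have h9 : π (t z - t w) = π (t z) - π (t w) := map_sub π _ _
    refine h9.trans ?_
    rw [← hs, ← hs, hzw, sub_self]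
  have hXtr : ¬ IsAlgebraic k (algebraMap (Polynomial k) V Polynomial.X) := by
    rw [← Transcendental, transcendental_algebraMap_iff (FaithfulSMul.algebraMap_injective (Polynomial k) V)]
    exact Polynomial.transcendental_X k
  have hφa : φ a = algebraMap k V (x 0) := by
    simp only [φ, a, RingHom.comp_apply]
    rw [hspC, eval_X, IsScalarTower.algebraMap_apply k (Polynomial k) V]
    rfl
  have hφb : φ b = algebraMap k V (x 1) := by
    simp only [φ, b, RingHom.comp_apply]
    rw [hspC, eval_X, IsScalarTower.algebraMap_apply k (Polynomial k) V]
    rfl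
  have hφu : φ u = algebraMap (Polynomial k) V Polynomial.X := by
    simp only [φ, u, RingHom.comp_apply]
    rw [hspX]
  have hsroot : ∀ i l, (Gp (F i) (algebraMap k V (x 0)) (algebraMap k V (x 1))
        (algebraMap (Polynomial k) V Polynomial.X)).eval (s ⟨i, l⟩) = 0 := by
    intro i l
    have hbi : Function.Injective bW := Subtype.val_injective
    have h4 := aeval_transfer (F i) bW πk hbi (algebraMap A B L0) (algebraMap A B a)
      (algebraMap A B b) (algebraMap A B u) (t ⟨i, l⟩) (by
        have h2 := gp_scaled (hF i).hom (iA L0) (iA a) (iA b) (iA u) (T ⟨i, l⟩)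
        have h3 : (Gp (F i) (iA a) (iA b) (iA u)).eval (T ⟨i, l⟩) = 0 := (hT2 i _).2 ⟨l, rfl⟩
        rw [h3, mul_zero] at h2
        exact h2)
    simp only [hπ', hπ, ← hs, hφa, hφb, hφu] at h4
    rw [gp_scaled (hF i).hom] at h4
    exact (mul_eq_zero.1 h4).resolve_left (pow_ne_zero _ hφL)
  refine ⟨x 0, hxS 0, x 1, hxS 1, s, hsi, ?_, sp L0, ?_⟩
  · intro i z
    exact roots_of_inj (hF i) hXtr (fun l => s ⟨i, l⟩) (fun l l' h => by
      have := hsi h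
      simpa using this) (hsroot i) z
  · intro H hH
    refine ⟨p H, ?_⟩
    have h1 : eRes H (p H) (fun x => algebraMap (Polynomial k) V (sp L0) * s x) = π (e H) := by
      have h2 := eRes_map H (p H) t πk
      refine Eq.trans ?_ h2.symm
      congr 1
      ext z
      exact hs z
    rw [h1]
    have h3 : ((minpoly A (bW (e H))).map sp).eval₂ (algebraMap (Polynomial k) V) (π (e H)) = 0 := by
      rw [Polynomial.eval₂_map]
      have h4 : Polynomial.aeval (e H) (minpoly A (bW (e H))) = 0 := by
        have h5 := minpoly.aeval A (bW (e H))
        have h6 := Polynomial.aeval_algHom_apply B.val (e H) (minpoly A (bW (e H)))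
        have hbi : Function.Injective B.val := Subtype.val_injective
        apply hbi
        rw [map_zero, ← h6]
        exact h5
      have h7 := congrArg π h4
      rw [map_zero, Polynomial.aeval_def, Polynomial.hom_eval₂] at h7
      rw [← h7]
      congr 1
      exact RingHom.ext fun z => (hπ z).symm
    refine ⟨⟨(minpoly A (bW (e H))).map sp, (minpoly.monic (hIntg H)).map _, h3⟩, fun q hq => ?_⟩
    rw [hq, Polynomial.eval₂_at_apply] at h3
    have h8 : ((minpoly A (bW (e H))).map sp).eval q = 0 :=
      FaithfulSMul.algebraMap_injective (Polynomial k) V (by rw [h3, map_zero])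
    apply hD'2 (eval x) (right_ne_zero_of_mul hx) q
    simp only [m, Polynomial.map_prod, Polynomial.eval_prod]
    exact Finset.prod_eq_zero (Finset.mem_univ (⟨H, hH⟩ : HH)) h8

end

end

section

theorem mem_range_of_fixed {E V : Type*} [Field E] [Field V] [Algebra E V] [IsAlgClosed V]
    [Algebra.IsAlgebraic E V] (e : V) (hs : IsSeparable E e) (h : ∀ τ : V ≃ₐ[E] V, τ e = e) :
    e ∈ (algebraMap E V).range := by
  classical
  have hV : IsAlgClosure E V := ⟨inferInstance, inferInstance⟩
  have hN : Normal E V := IsAlgClosure.normal E V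
  have hei : IsIntegral E e := Algebra.IsIntegral.isIntegral e
  rw [← minpoly.natDegree_eq_one_iff]
  have hsp : ((minpoly E e).map (algebraMap E V)).Splits := IsAlgClosed.splits _
  have hc := hsp.natDegree_eq_card_roots
  have hnd : ((minpoly E e).map (algebraMap E V)).roots.Nodup :=
    Polynomial.nodup_roots (Polynomial.Separable.map hs)
  have hr : ∀ z ∈ ((minpoly E e).map (algebraMap E V)).roots, z = e := by
    intro z hz
    rw [Polynomial.mem_roots', Polynomial.IsRoot.def, Polynomial.eval_map_algebraMap] at hz
    obtain ⟨σ, hσ⟩ := minpoly.exists_algEquiv_of_root' (x := z) (y := e) (Algebra.IsAlgebraic.isAlgebraic e) hz.2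
    rw [← hσ, h]
  have hle : Multiset.card ((minpoly E e).map (algebraMap E V)).roots ≤ 1 := by
    have : ((minpoly E e).map (algebraMap E V)).roots ≤ {e} :=
      (Multiset.le_iff_subset hnd).2 fun z hz => by simp [hr z hz]
    simpa using Multiset.card_le_card this
  rw [Polynomial.natDegree_map] at hc
  have := minpoly.natDegree_pos hei
  omega

theorem sep_of_roots {E V : Type*} [Field E] [Field V] [Algebra E V] [IsAlgClosed V]
    (P : Polynomial E) (hP : P ≠ 0) (s : Fin P.natDegree → V) (hs : Function.Injective s)
    (h : ∀ l, Polynomial.aeval (s l) P = 0) (l) : IsSeparable E (s l) := by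
  classical
  have hsp : (P.map (algebraMap E V)).Splits := IsAlgClosed.splits _
  have : P.Separable := by
    rw [← Polynomial.card_rootSet_eq_natDegree_iff_of_splits hP hsp]
    apply le_antisymm
    · rw [← Nat.card_eq_fintype_card, Nat.card_coe_set_eq]
      exact Polynomial.ncard_rootSet_le _ _
    · let f : Fin P.natDegree → P.rootSet V := fun l => ⟨s l, by rw [Polynomial.mem_rootSet]; exact ⟨hP, h l⟩⟩
      have := Fintype.card_le_of_injective f (fun a b hab => hs (congrArg Subtype.val hab))
      simpa using this
  exact this.of_dvd (minpoly.dvd _ _ (h l))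

section
variable {k : Type*} [Field k] {E : Type*} [Field E] [Algebra k E]
  [Algebra (Polynomial k) E] [IsScalarTower k (Polynomial k) E]
  {V : Type*} [Field V] [IsAlgClosed V] [Algebra k V]
  [Algebra E V] [IsScalarTower k E V]

theorem not_alg_X [FaithfulSMul (Polynomial k) E] :
    ¬ IsAlgebraic k (algebraMap (Polynomial k) E Polynomial.X) := by
  rw [isAlgebraic_algebraMap_iff (FaithfulSMul.algebraMap_injective (Polynomial k) E)]
  exact Polynomial.transcendental_X k

theorem Gp_sep {F : MvPolynomial (Fin 3) k} {d : ℕ} (hF : SmC F d) {a b U : E} (hU : ¬ IsAlgebraic k U)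
    (s : Fin d → V) (hs : Function.Injective s)
    (h : ∀ l, (Gp F (algebraMap E V a) (algebraMap E V b) (algebraMap E V U)).eval (s l) = 0) (l) :
    IsSeparable E (s l) := by
  have hdeg := Gp_natDegree hF (a := a) (b := b) hU
  have h0 : Gp F a b U ≠ 0 := by
    intro h0
    rw [h0, Polynomial.natDegree_zero] at hdeg
    have := hF.two_le
    omega
  subst hdeg
  refine sep_of_roots (Gp F a b U) h0 s hs (fun l => ?_) l
  rw [Polynomial.aeval_def, ← Polynomial.eval_map]
  have := Gp_map F a b U (IsScalarTower.toAlgHom k E V)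
  exact (congrArg (Polynomial.eval (s l)) this).trans (h l)

end

section
variable {k : Type*} [Field k] [IsAlgClosed k] {E : Type*} [Field E] [Algebra k E]
  [Algebra (Polynomial k) E] [IsScalarTower k (Polynomial k) E] [IsFractionRing (Polynomial k) E]
  {V : Type*} [Field V] [IsAlgClosed V] [Algebra k V] [Algebra (Polynomial k) V]
  [Algebra E V] [IsScalarTower k E V] [IsScalarTower (Polynomial k) E V] [IsScalarTower k (Polynomial k) V]
  [Algebra.IsAlgebraic E V]
  {r : ℕ} {F : Fin r → MvPolynomial (Fin 3) k} {d : Fin r → ℕ}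

open Classical in
theorem spec_main (hF : ∀ i, SmC (F i) (d i)) (hna : ∀ i j, i ≠ j → ¬ dehom (F i) ∣ dehom (F j))
    (S : Set k) (hS : S.Infinite) :
    ∃ α ∈ S, ∃ β ∈ S, ∃ s : (Σ i, Fin (d i)) → V, Function.Injective s ∧
      (∀ i z, (Gp (F i) (algebraMap k V α) (algebraMap k V β) (algebraMap (Polynomial k) V Polynomial.X)).eval z = 0 ↔ ∃ l, s ⟨i, l⟩ = z) ∧
      ∀ g : Equiv.Perm (Σ i, Fin (d i)), (∀ x, (g x).1 = x.1) → ∃ τ : V ≃ₐ[E] V, ∀ x, τ (s x) = s (g x) := by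
  have hfE : FaithfulSMul (Polynomial k) E := (faithfulSMul_iff_algebraMap_injective _ _).2 (IsFractionRing.injective _ _)
  have hfV : FaithfulSMul (Polynomial k) V := (faithfulSMul_iff_algebraMap_injective _ _).2 (by
    rw [IsScalarTower.algebraMap_eq (Polynomial k) E V]
    exact (algebraMap E V).injective.comp (IsFractionRing.injective _ _))
  have hfW : FaithfulSMul (Polynomial (MvPolynomial (Fin 2) k))
      (AlgebraicClosure (FractionRing (Polynomial (MvPolynomial (Fin 2) k)))) :=
    (faithfulSMul_iff_algebraMap_injective _ _).2 (by
      rw [IsScalarTower.algebraMap_eq (Polynomial (MvPolynomial (Fin 2) k)) (FractionRing (Polynomial (MvPolynomial (Fin 2) k)))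
        (AlgebraicClosure (FractionRing (Polynomial (MvPolynomial (Fin 2) k))))]
      exact (algebraMap (FractionRing (Polynomial (MvPolynomial (Fin 2) k)))
        (AlgebraicClosure (FractionRing (Polynomial (MvPolynomial (Fin 2) k))))).injective.comp
        (IsFractionRing.injective _ _))
  have haW : Algebra.IsAlgebraic (Polynomial (MvPolynomial (Fin 2) k))
      (AlgebraicClosure (FractionRing (Polynomial (MvPolynomial (Fin 2) k)))) :=
    (IsFractionRing.comap_isAlgebraic_iff (K := FractionRing (Polynomial (MvPolynomial (Fin 2) k)))).2 inferInstance
  obtain ⟨α, hα, β, hβ, s, hs, hr, L, hL⟩ := spec_gen_aux (V := V)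
    (AlgebraicClosure (FractionRing (Polynomial (MvPolynomial (Fin 2) k)))) hF hna S hS
  refine ⟨α, hα, β, hβ, s, hs, hr, ?_⟩
  -- every automorphism permutes
  have hperm : ∀ τ : V ≃ₐ[E] V, ∃ π : Equiv.Perm (Σ i, Fin (d i)), (∀ x, τ (s x) = s (π x)) := by
    intro τ
    have h1 : ∀ x : (Σ i, Fin (d i)), ∃ y, τ (s x) = s y := by
      rintro ⟨i, l⟩
      have h2 : (Gp (F i) (algebraMap k V α) (algebraMap k V β) (algebraMap (Polynomial k) V Polynomial.X)).eval (τ (s ⟨i, l⟩)) = 0 := by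
        have h3 := Gp_eval_map (F i) (algebraMap k V α) (algebraMap k V β)
          (algebraMap (Polynomial k) V Polynomial.X) (s ⟨i, l⟩) ((τ : V →ₐ[E] V).restrictScalars k)
        rw [(hr i _).2 ⟨l, rfl⟩, map_zero, AlgHom.commutes, AlgHom.commutes] at h3
        have h4 : ((τ : V →ₐ[E] V).restrictScalars k) (algebraMap (Polynomial k) V Polynomial.X) =
            algebraMap (Polynomial k) V Polynomial.X := by
          rw [IsScalarTower.algebraMap_apply (Polynomial k) E V]
          exact τ.commutes _
        rw [h4] at h3
        exact h3.symm
      obtain ⟨l', hl'⟩ := (hr i _).1 h2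
      exact ⟨_, hl'.symm⟩
    choose f hf using h1
    have hfi : Function.Injective f := by
      intro x y hxy
      apply hs
      apply τ.injective
      rw [hf, hf, hxy]
    exact ⟨Equiv.ofBijective f (Finite.injective_iff_bijective.1 hfi), hf⟩
  let H : Subgroup (Equiv.Perm (Σ i, Fin (d i))) :=
    { carrier := {g | ∃ τ : V ≃ₐ[E] V, ∀ x, τ (s x) = s (g x)}
      mul_mem' := by
        rintro g g' ⟨τ, hτ⟩ ⟨τ', hτ'⟩
        refine ⟨τ * τ', fun x => ?_⟩
        rw [AlgEquiv.mul_apply, hτ', hτ]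
        rfl
      one_mem' := ⟨1, fun x => rfl⟩
      inv_mem' := by
        rintro g ⟨τ, hτ⟩
        refine ⟨τ.symm, fun x => ?_⟩
        rw [AlgEquiv.symm_apply_eq, hτ]
        simp }
  intro g hg
  by_contra hcon
  obtain ⟨p, hIntg, hne⟩ := hL H ⟨g, hg, hcon⟩
  have hLE : ∀ q : Polynomial k, algebraMap (Polynomial k) V q = algebraMap E V (algebraMap (Polynomial k) E q) :=
    fun q => IsScalarTower.algebraMap_apply (Polynomial k) E V q
  have hmem : eRes H p (fun x => algebraMap _ V L * s x) ∈ (algebraMap E V).range := by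
    apply mem_range_of_fixed
    · rw [← mem_separableClosure_iff]
      have hk : ∀ c : k, algebraMap k V c ∈ separableClosure E V := by
        intro c
        rw [IsScalarTower.algebraMap_apply k E V]
        exact (separableClosure E V).algebraMap_mem _
      unfold eRes
      refine prod_mem fun h _ => sub_mem (hk _) (sum_mem fun x _ => mul_mem (hk _) (mul_mem ?_ ?_))
      · rw [hLE]
        exact (separableClosure E V).algebraMap_mem _
      · obtain ⟨i, l⟩ := h.1 x
        rw [mem_separableClosure_iff]
        refine Gp_sep (E := E) (hF i) (a := algebraMap k E α) (b := algebraMap k E β)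
          (U := algebraMap (Polynomial k) E Polynomial.X) not_alg_X (fun l => s ⟨i, l⟩) ?_ ?_ l
        · intro a b hab
          simpa using hs hab
        · intro l
          rw [← hLE, ← IsScalarTower.algebraMap_apply, ← IsScalarTower.algebraMap_apply]
          exact (hr i _).2 ⟨l, rfl⟩
    · intro τ
      obtain ⟨π, hπ⟩ := hperm τ
      have h1 := eRes_map H p (fun x => algebraMap _ V L * s x) ((τ : V →ₐ[E] V).restrictScalars k)
      refine h1.trans ?_
      have h2 := eRes_mul H p (fun x => algebraMap _ V L * s x) π ⟨τ, hπ⟩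
      refine Eq.trans ?_ h2
      congr 1
      funext x
      change τ _ = _
      rw [map_mul, hπ, hLE, AlgEquiv.commutes]
  obtain ⟨y, hy⟩ := hmem
  rw [← hy] at hIntg
  have hyi : IsIntegral (Polynomial k) y := (isIntegral_algebraMap_iff (algebraMap E V).injective).1 hIntg
  obtain ⟨q, hq⟩ := IsIntegrallyClosed.isIntegral_iff.1 hyi
  apply hne q
  rw [hLE q, hq, hy]

end

end

section

theorem fst_perm_mem {r : ℕ} {d : Fin r → ℕ} (g : Equiv.Perm (Σ i, Fin (d i))) (hg : ∀ x, (g x).1 = x.1) :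
    g ∈ (Equiv.Perm.sigmaCongrRightHom (fun i => Fin (d i))).range := by
  have h1 : ∀ i (l : Fin (d i)), ∃ l', g ⟨i, l⟩ = ⟨i, l'⟩ := by
    intro i l
    have := hg ⟨i, l⟩
    rcases hgx : g ⟨i, l⟩ with ⟨j, l'⟩
    rw [hgx] at this
    simp only at this
    subst this
    exact ⟨l', rfl⟩
  choose f hf using h1
  have hfi : ∀ i, Function.Injective (f i) := by
    intro i a b hab
    have : g ⟨i, a⟩ = g ⟨i, b⟩ := by rw [hf, hf, hab]
    simpa using g.injective this
  refine ⟨fun i => Equiv.ofBijective (f i) (Finite.injective_iff_bijective.1 (hfi i)), ?_⟩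
  ext1 ⟨i, l⟩
  rw [hf]
  rfl

theorem gal_equiv {E V : Type*} [Field E] [Field V] [Algebra E V] [IsAlgClosed V] [Algebra.IsAlgebraic E V]
    {r : ℕ} {d : Fin r → ℕ} (P : Fin r → Polynomial E) (hP : ∀ i, P i ≠ 0)
    (s : (Σ i, Fin (d i)) → V) (hs : Function.Injective s)
    (hr : ∀ i z, Polynomial.aeval z (P i) = 0 ↔ ∃ l, s ⟨i, l⟩ = z)
    (hg : ∀ g : Equiv.Perm (Σ i, Fin (d i)), (∀ x, (g x).1 = x.1) → ∃ τ : V ≃ₐ[E] V, ∀ x, τ (s x) = s (g x)) :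
    Nonempty ((∏ i, P i).Gal ≃* ((i : Fin r) → Equiv.Perm (Fin (d i)))) := by
  classical
  have hV : IsAlgClosure E V := ⟨inferInstance, inferInstance⟩
  have hN : Normal E V := IsAlgClosure.normal E V
  obtain ⟨Q, hQ⟩ : ∃ Q, Q = ∏ i, P i := ⟨_, rfl⟩
  rw [← hQ]
  have hQ0 : Q ≠ 0 := by rw [hQ]; exact Finset.prod_ne_zero_iff.2 fun i _ => hP i
  have hfact : Fact ((Q.map (algebraMap E V)).Splits) := ⟨IsAlgClosed.splits _⟩
  have hmem : ∀ z, z ∈ Q.rootSet V ↔ ∃ x, s x = z := by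
    intro z
    rw [Polynomial.mem_rootSet]
    constructor
    · rintro ⟨-, h⟩
      rw [hQ, map_prod, Finset.prod_eq_zero_iff] at h
      obtain ⟨i, -, h⟩ := h
      obtain ⟨l, hl⟩ := (hr i z).1 h
      exact ⟨_, hl⟩
    · rintro ⟨⟨i, l⟩, h⟩
      refine ⟨hQ0, ?_⟩
      rw [hQ, map_prod, Finset.prod_eq_zero_iff]
      exact ⟨i, Finset.mem_univ _, (hr i z).2 ⟨l, h⟩⟩
  let e : (Σ i, Fin (d i)) ≃ Q.rootSet V := Equiv.ofBijective (fun x => ⟨s x, (hmem _).2 ⟨x, rfl⟩⟩) (by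
    constructor
    · intro a b hab
      exact hs (congrArg Subtype.val hab)
    · rintro ⟨z, hz⟩
      obtain ⟨x, hx⟩ := (hmem z).1 hz
      exact ⟨x, Subtype.ext hx⟩)
  have he : ∀ x, ((e x : Q.rootSet V) : V) = s x := fun x => rfl
  let Φ : Q.Gal →* Equiv.Perm (Σ i, Fin (d i)) :=
    (e.symm.permCongrHom : Equiv.Perm (Q.rootSet V) →* Equiv.Perm (Σ i, Fin (d i))).comp
      (Polynomial.Gal.galActionHom Q V)
  have hΦi : Function.Injective Φ :=
    (MulEquiv.injective e.symm.permCongrHom).comp (Polynomial.Gal.galActionHom_injective Q V)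
  have hΦ : ∀ (τ : V ≃ₐ[E] V) x, s (Φ (Polynomial.Gal.restrict Q V τ) x) = τ (s x) := by
    intro τ x
    rw [← he, ← he, ← Polynomial.Gal.galActionHom_restrict]
    congr 1
    exact e.apply_symm_apply _
  have hrange : Φ.range = (Equiv.Perm.sigmaCongrRightHom (fun i => Fin (d i))).range := by
    apply le_antisymm
    · rintro _ ⟨σ, rfl⟩
      obtain ⟨τ, rfl⟩ := Polynomial.Gal.restrict_surjective Q V σ
      apply fst_perm_mem
      rintro ⟨i, l⟩
      have h1 : Polynomial.aeval (τ (s ⟨i, l⟩)) (P i) = 0 := by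
        have := Polynomial.aeval_algHom_apply τ.toAlgHom (s ⟨i, l⟩) (P i)
        rw [(hr i _).2 ⟨l, rfl⟩, map_zero] at this
        exact this
      obtain ⟨l', hl'⟩ := (hr i _).1 h1
      rw [← hΦ] at hl'
      rw [← hs hl']
    · rintro _ ⟨g, rfl⟩
      obtain ⟨τ, hτ⟩ := hg (Equiv.Perm.sigmaCongrRightHom (fun i => Fin (d i)) g) (fun x => rfl)
      refine ⟨Polynomial.Gal.restrict Q V τ, ?_⟩
      ext1 x
      apply hs
      rw [hΦ, hτ]
  exact ⟨(MonoidHom.ofInjective hΦi).trans ((MulEquiv.subgroupCongr hrange).trans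
    (MonoidHom.ofInjective Equiv.Perm.sigmaCongrRightHom_injective).symm)⟩

end

theorem lineSubU_eq_Gp {K : Type*} [Field K] (F : MvPolynomial (Fin 3) (AlgebraicClosure K))
    (f : MvPolynomial (Fin 2) K) (d : ℕ) (hF : F.IsHomogeneous d)
    (hf : dehom F = f.map (algebraMap K (AlgebraicClosure K))) (α β : K) :
    lineSubU f d α β = Gp F
      (algebraMap (AlgebraicClosure K) (FractionRing (Polynomial (AlgebraicClosure K))) (algebraMap K _ α))
      (algebraMap (AlgebraicClosure K) (FractionRing (Polynomial (AlgebraicClosure K))) (algebraMap K _ β))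
      (algebraMap (Polynomial (AlgebraicClosure K)) (FractionRing (Polynomial (AlgebraicClosure K))) Polynomial.X) := by
  unfold lineSubU
  rw [← hf, aeval_dehom, Polynomial.C_pow, ← hom_scale hF]
  unfold Gp
  have hu : algebraMap (Polynomial (AlgebraicClosure K)) (FractionRing (Polynomial (AlgebraicClosure K)))
      Polynomial.X ≠ 0 := by
    intro h
    exact Polynomial.X_ne_zero (IsFractionRing.injective _ (FractionRing (Polynomial (AlgebraicClosure K)))
      (h.trans (map_zero _).symm))
  congr 2
  generalize algebraMap (Polynomial (AlgebraicClosure K)) (FractionRing (Polynomial (AlgebraicClosure K)))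
      Polynomial.X = u at hu
  generalize algebraMap (AlgebraicClosure K) (FractionRing (Polynomial (AlgebraicClosure K))) (algebraMap K _ α) = a
  generalize algebraMap (AlgebraicClosure K) (FractionRing (Polynomial (AlgebraicClosure K))) (algebraMap K _ β) = b
  have hc : Polynomial.C u * Polynomial.C u⁻¹ = 1 := by
    rw [← Polynomial.C_mul, mul_inv_cancel₀ hu, Polynomial.C_1]
  congr 2
  · rw [mul_one]
  congr 2
  simp only [Polynomial.C_add, Polynomial.C_mul]
  linear_combination (Polynomial.C a + Polynomial.X) * hc

theorem dehom_map {K k : Type*} [Field K] [Field k] (φ : K →+* k) (F : MvPolynomial (Fin 3) K) :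
    dehom (F.map φ) = (dehom F).map φ := by
  unfold dehom
  induction F using MvPolynomial.induction_on with
  | C a => simp
  | add p q hp hq => simp only [map_add, hp, hq]
  | mul_X p i hp =>
    simp only [map_mul, hp, map_X, aeval_X]
    congr 1
    fin_cases i <;> simp

theorem scalar_descent {K k : Type*} [Field K] [Field k] (φ : K →+* k) {f g : MvPolynomial (Fin 2) K}
    (hf : f ≠ 0) (hfi : Irreducible (f.map φ)) (hgi : Irreducible (g.map φ)) (h : f.map φ ∣ g.map φ) :
    ∃ c : K, g = c • f := by
  have ha := hfi.associated_of_dvd hgi h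
  obtain ⟨u, hu⟩ := ha
  obtain ⟨c, hc, hcu⟩ := MvPolynomial.isUnit_iff_eq_C_of_isReduced.1 u.isUnit
  rw [hcu] at hu
  have hco : ∀ m, φ (f.coeff m) * c = φ (g.coeff m) := by
    intro m
    have := congrArg (coeff m) hu
    rwa [mul_comm, coeff_C_mul, coeff_map, coeff_map, mul_comm] at this
  obtain ⟨m, hm⟩ := MvPolynomial.ne_zero_iff.1 hf
  have hm' : φ (f.coeff m) ≠ 0 := fun h => hm (φ.injective (h.trans (map_zero φ).symm))
  have hc' : c = φ (g.coeff m / f.coeff m) := by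
    rw [map_div₀, ← hco m]; field_simp
  refine ⟨g.coeff m / f.coeff m, ?_⟩
  ext n
  rw [coeff_smul, smul_eq_mul]
  apply φ.injective
  rw [map_mul, ← hc', ← hco n, mul_comm]

theorem exists_lineSubU_gal_prod_symmGroups (K : Type*) [Field K] [Infinite K] (p : ℕ)
    [CharP K p] (r : ℕ) (f : Fin r → MvPolynomial (Fin 2) K) (d : Fin r → ℕ)
    (hdeg : ∀ i, (f i).totalDegree = d i)
    (hd2 : ∀ i, 2 ≤ d i)
    (hp : ∀ i, ¬ (p ∣ d i * (d i - 1)))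
    (hirr : ∀ i, AbsolutelyIrreducible (f i))
    (hassoc : ∀ i j, i ≠ j → ∀ c : K, f i ≠ c • f j)
    (hsm : ∀ i, ∃ F : MvPolynomial (Fin 3) K, IsSmoothHomogenization F (f i) (d i)) :
    ∃ α β : K,
      Nonempty ((∏ i, lineSubU (f i) (d i) α β).Gal ≃*
        ((i : Fin r) → Equiv.Perm (Fin (d i)))) := by
  classical
  choose F0 hF0 using hsm
  let φ : K →+* AlgebraicClosure K := algebraMap K (AlgebraicClosure K)
  have hφ : Function.Injective φ := φ.injective
  have hCP : CharP (AlgebraicClosure K) p := charP_of_injective_algebraMap hφ p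
  have hde : ∀ i, dehom ((F0 i).map φ) = (f i).map φ := by
    intro i
    rw [dehom_map]
    congr 1
    exact (hF0 i).2.1
  have hF : ∀ i, SmC ((F0 i).map φ) (d i) := by
    intro i
    have h2 := hd2 i
    refine ⟨(hF0 i).1.map φ, ?_, ?_, h2, ?_, ?_, ?_, ?_⟩
    · rw [hde, totalDegree, support_map_of_injective _ hφ, ← totalDegree, hdeg]
    · rw [hde]; exact hirr i
    · intro h
      apply hp i
      have : p ∣ 2 := (CharP.cast_eq_zero_iff (AlgebraicClosure K) p 2).1 (by exact_mod_cast h)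
      exact this.trans (Nat.even_mul_pred_self (d i)).two_dvd
    · intro h
      exact hp i (((CharP.cast_eq_zero_iff _ p _).1 h).mul_right _)
    · intro h
      exact hp i (((CharP.cast_eq_zero_iff _ p _).1 h).mul_left _)
    · intro x hx hx0
      obtain ⟨j, hj⟩ := (hF0 i).2.2 x hx hx0
      refine ⟨j, ?_⟩
      rw [pderiv_map]
      exact hj
  have hna : ∀ i j, i ≠ j → ¬ dehom ((F0 i).map φ) ∣ dehom ((F0 j).map φ) := by
    intro i j hij hdv
    rw [hde, hde] at hdv
    have hf0 : f i ≠ 0 := by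
      intro h0
      have := (hirr i).ne_zero
      rw [h0, map_zero] at this
      exact this rfl
    obtain ⟨c, hc⟩ := scalar_descent φ hf0 (hirr i) (hirr j) hdv
    exact hassoc j i hij.symm c hc
  obtain ⟨_, ⟨α, rfl⟩, _, ⟨β, rfl⟩, s, hs, hr, hg⟩ := spec_main
    (E := FractionRing (Polynomial (AlgebraicClosure K)))
    (V := AlgebraicClosure (FractionRing (Polynomial (AlgebraicClosure K)))) hF hna (Set.range φ)
    (Set.infinite_range_of_injective hφ)
  refine ⟨α, β, ?_⟩
  have hl : ∀ i, lineSubU (f i) (d i) α β = _ := fun i =>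
    lineSubU_eq_Gp ((F0 i).map φ) (f i) (d i) (hF i).hom (hde i) α β
  refine gal_equiv (V := AlgebraicClosure (FractionRing (Polynomial (AlgebraicClosure K)))) _ ?_ s hs ?_ hg
  · intro i h0
    rw [hl] at h0
    have := Gp_natDegree (hF i) (a := algebraMap _ (FractionRing (Polynomial (AlgebraicClosure K))) (φ α))
      (b := algebraMap _ (FractionRing (Polynomial (AlgebraicClosure K))) (φ β))
      (not_alg_X (k := AlgebraicClosure K) (E := FractionRing (Polynomial (AlgebraicClosure K))))
    have h3 := congrArg Polynomial.natDegree h0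
    rw [Polynomial.natDegree_zero] at h3
    have := hd2 i
    have h4 := this.trans_eq (‹_ = d i›.symm.trans h3)
    omega
  · intro i z
    rw [← hr i z, hl, Polynomial.aeval_def, ← Polynomial.eval_map]
    have := Gp_map ((F0 i).map φ) (algebraMap _ (FractionRing (Polynomial (AlgebraicClosure K))) (φ α))
      (algebraMap _ (FractionRing (Polynomial (AlgebraicClosure K))) (φ β))
      (algebraMap (Polynomial (AlgebraicClosure K)) (FractionRing (Polynomial (AlgebraicClosure K))) Polynomial.X)
      (IsScalarTower.toAlgHom (AlgebraicClosure K) (FractionRing (Polynomial (AlgebraicClosure K)))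
        (AlgebraicClosure (FractionRing (Polynomial (AlgebraicClosure K)))))
    have h5 := congrArg (Polynomial.eval z) this
    refine Iff.of_eq (congrArg (· = 0) (h5.trans ?_))
    simp only [IsScalarTower.coe_toAlgHom', ← IsScalarTower.algebraMap_apply]
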